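/- Quantitative inequality for general planar convex sets: let p ∈ (1,∞) and let m be a positive integer. There exists a positive constant c′ = c′(p,m) (given by an explicit formula) such that for every open bounded convex domain Ω ⊂ ℝ² with diameter D_Ω = 1, positioned so that the segment [0,1]×{0} is a diameter of Ω, and for every positive (1/m)-concave function φ on Ω, one has μ_p(Ω,φ) ≥ π_p^p + c′·η_Ω². -/

import Mathlib

open MeasureTheory Set Filter Topology

/-- `π_p := 2π (p-1)^{1/p} / (p sin(π/p))`. -/
noncomputable def piP (p : ℝ) : ℝ :=
  2 * Real.pi * (p - 1) ^ (1 / p) / (p * Real.sin (Real.pi / p))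

/-- The first nontrivial Neumann `p`-Laplacian eigenvalue of `Ω` with weight `φ`. -/
noncomputable def muP (p : ℝ) {N : ℕ} (Ω : Set (EuclideanSpace ℝ (Fin N)))
    (φ : EuclideanSpace ℝ (Fin N) → ℝ) : ℝ :=
  sInf { r : ℝ | ∃ (u : EuclideanSpace ℝ (Fin N) → ℝ) (K : NNReal),
    LipschitzWith K u ∧
    ¬ (∀ᵐ x ∂(volume.restrict Ω), u x = 0) ∧
    (∫ x in Ω, φ x * |u x| ^ (p - 2) * u x) = 0 ∧
    r = (∫ x in Ω, φ x * ‖fderiv ℝ u x‖ ^ p) / (∫ x in Ω, φ x * |u x| ^ p) }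

/-- A positive function is `α`-concave on `Ω` if its `α`-th power is concave. -/
def IsAlphaConcaveOn {N : ℕ} (α : ℝ) (Ω : Set (EuclideanSpace ℝ (Fin N)))
    (φ : EuclideanSpace ℝ (Fin N) → ℝ) : Prop :=
  (∀ x ∈ Ω, 0 < φ x) ∧ ConcaveOn ℝ Ω fun x => φ x ^ α


/-- The maximal length of vertical chords of a planar set `Ω`:
`η_Ω := sup_x H¹({y : (x,y) ∈ Ω})`. -/
noncomputable def etaOmega (Ω : Set (EuclideanSpace ℝ (Fin 2))) : ℝ :=
  ⨆ x : ℝ, (volume { y : ℝ | ∃ z ∈ Ω, z 0 = x ∧ z 1 = y }).toReal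

theorem lintegral_rpow_div_one_add {s : ℝ} (hs0 : 0 < s) (hs1 : s < 1) :
    ∫⁻ x in Ioi (0 : ℝ), ENNReal.ofReal (x ^ (s - 1) / (1 + x)) =
      ENNReal.ofReal (Real.pi / Real.sin (Real.pi * s)) := by
  have inner1 : ∀ x ∈ Ioi (0 : ℝ), ENNReal.ofReal (x ^ (s - 1) / (1 + x)) =
      ∫⁻ r in Ioi (0 : ℝ), ENNReal.ofReal (x ^ (s - 1) * Real.exp (-(1 + x) * r)) := by
    intro x hx
    have hx' : (0 : ℝ) < x := hx
    rw [← ofReal_integral_eq_lintegral_ofReal]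
    · rw [integral_const_mul, integral_exp_mul_Ioi (by linarith)]
      congr 1
      simp only [mul_zero, Real.exp_zero]
      rw [div_eq_mul_inv, neg_div_neg_eq, one_div]
    · exact (integrableOn_exp_mul_Ioi (by linarith) 0).const_mul _
    · exact Eventually.of_forall fun r => by positivity
  have inner2 : ∀ r ∈ Ioi (0 : ℝ),
      ∫⁻ x in Ioi (0 : ℝ), ENNReal.ofReal (x ^ (s - 1) * Real.exp (-(1 + x) * r)) =
        ENNReal.ofReal (Real.Gamma s * (Real.exp (-r) * r ^ ((1 - s) - 1))) := by
    intro r hr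
    have hr' : (0 : ℝ) < r := hr
    have heq : ∀ x : ℝ, x ^ (s - 1) * Real.exp (-(1 + x) * r) =
        Real.exp (-r) * (x ^ (s - 1) * Real.exp (-(r * x))) := by
      intro x
      rw [mul_left_comm, ← Real.exp_add]
      congr 3
      ring
    simp_rw [heq]
    have hi := Real.integral_rpow_mul_exp_neg_mul_Ioi hs0 hr'
    have hkint : IntegrableOn (fun x : ℝ => x ^ (s - 1) * Real.exp (-(r * x))) (Ioi 0) := by
      by_contra hcon
      rw [integral_undef hcon] at hi
      have : 0 < (1 / r) ^ s * Real.Gamma s :=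
        mul_pos (by positivity) (Real.Gamma_pos_of_pos hs0)
      linarith
    rw [← ofReal_integral_eq_lintegral_ofReal (hkint.const_mul _)]
    · rw [integral_const_mul, hi]
      congr 1
      rw [one_div, Real.inv_rpow hr'.le, ← Real.rpow_neg hr'.le]
      rw [show (1 - s) - 1 = -s by ring]
      ring
    · filter_upwards [self_mem_ae_restrict measurableSet_Ioi] with x hx
      have hx' : (0 : ℝ) < x := hx
      simp only [Pi.zero_apply]
      positivity
  rw [setLIntegral_congr_fun measurableSet_Ioi inner1]
  rw [lintegral_lintegral_swap (by fun_prop)]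
  rw [setLIntegral_congr_fun measurableSet_Ioi inner2]
  have hG := Real.Gamma_eq_integral (show (0 : ℝ) < 1 - s by linarith)
  rw [← ofReal_integral_eq_lintegral_ofReal]
  · rw [integral_const_mul, ← hG, Real.Gamma_mul_Gamma_one_sub]
  · exact (Real.GammaIntegral_convergent (show (0 : ℝ) < 1 - s by linarith)).const_mul _
  · filter_upwards [self_mem_ae_restrict measurableSet_Ioi] with x hx
    have hx' : (0 : ℝ) < x := hx
    have := Real.Gamma_pos_of_pos hs0
    simp only [Pi.zero_apply]
    positivity

theorem integrableOn_and_integral_rpow_div_one_add {s : ℝ} (hs0 : 0 < s) (hs1 : s < 1) :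
    IntegrableOn (fun x : ℝ => x ^ (s - 1) / (1 + x)) (Ioi 0) ∧
    ∫ x in Ioi (0 : ℝ), x ^ (s - 1) / (1 + x) = Real.pi / Real.sin (Real.pi * s) := by
  have h := lintegral_rpow_div_one_add hs0 hs1
  have hnn : 0 ≤ᵐ[volume.restrict (Ioi (0 : ℝ))] fun x : ℝ => x ^ (s - 1) / (1 + x) := by
    filter_upwards [self_mem_ae_restrict measurableSet_Ioi] with x hx
    have hx' : (0 : ℝ) < x := hx
    simp only [Pi.zero_apply]
    positivity
  have hm : AEStronglyMeasurable (fun x : ℝ => x ^ (s - 1) / (1 + x))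
      (volume.restrict (Ioi (0 : ℝ))) := by
    apply Measurable.aestronglyMeasurable
    fun_prop
  have hsin : 0 < Real.sin (Real.pi * s) :=
    Real.sin_pos_of_pos_of_lt_pi (by positivity) (by nlinarith [Real.pi_pos])
  refine ⟨⟨hm, ?_⟩, ?_⟩
  · rw [hasFiniteIntegral_iff_ofReal hnn, h]
    exact ENNReal.ofReal_lt_top
  · rw [integral_eq_lintegral_of_nonneg_ae hnn hm, h, ENNReal.toReal_ofReal]
    have := Real.pi_pos
    positivity

/-- The Riccati nonlinearity `λ + (p - 1) y ^ (p / (p - 1))`. -/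
noncomputable def riccatiA (p lam y : ℝ) : ℝ := lam + (p - 1) * y ^ (p / (p - 1))

theorem integrableOn_and_integral_inv_one_add_rpow {a : ℝ} (ha : 1 < a) :
    IntegrableOn (fun t : ℝ => 1 / (1 + t ^ a)) (Ioi 0) ∧
    ∫ t in Ioi (0 : ℝ), 1 / (1 + t ^ a) = Real.pi / a / Real.sin (Real.pi / a) := by
  have ha0 : 0 < a := by linarith
  obtain ⟨h1, h2⟩ := integrableOn_and_integral_rpow_div_one_add (s := 1 / a) (by positivity)
    (by rw [div_lt_one ha0]; exact ha)
  have key : ∀ t ∈ Ioi (0 : ℝ), (|a| * t ^ (a - 1)) •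
      (fun x : ℝ => x ^ (1 / a - 1) / (1 + x)) (t ^ a) = a * (1 / (1 + t ^ a)) := by
    intro t ht
    have ht' : (0 : ℝ) < t := ht
    simp only [smul_eq_mul, abs_of_pos ha0]
    rw [← Real.rpow_mul ht'.le, mul_div_assoc', mul_assoc, ← Real.rpow_add ht']
    rw [show a - 1 + a * (1 / a - 1) = 0 by field_simp; ring, Real.rpow_zero]
    ring
  have i1 := integrableOn_Ioi_comp_rpow_iff (fun x : ℝ => x ^ (1 / a - 1) / (1 + x)) ha0.ne'
  have i2 := integral_comp_rpow_Ioi (fun x : ℝ => x ^ (1 / a - 1) / (1 + x)) ha0.ne'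
  rw [integrableOn_congr_fun key measurableSet_Ioi] at i1
  rw [setIntegral_congr_fun measurableSet_Ioi key, h2, integral_const_mul] at i2
  refine ⟨?_, ?_⟩
  · have := (i1.2 h1).const_mul a⁻¹
    refine (integrableOn_congr_fun (fun t _ => ?_) measurableSet_Ioi).1 this
    field_simp
  · rw [mul_one_div] at i2
    field_simp at i2 ⊢
    linarith

theorem integrableOn_and_integral_inv_riccatiA {p lam : ℝ} (hp : 1 < p) (hl : 0 < lam) :
    IntegrableOn (fun y : ℝ => 1 / riccatiA p lam y) (Ioi 0) ∧
    ∫ y in Ioi (0 : ℝ), 1 / riccatiA p lam y = piP p / 2 * lam ^ (-(1 / p)) := by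
  have hp0 : 0 < p - 1 := by linarith
  have hpp : 0 < p := by linarith
  set a := p / (p - 1) with ha
  have ha1 : 1 < a := by rw [ha, lt_div_iff₀ hp0]; linarith
  obtain ⟨h1, h2⟩ := integrableOn_and_integral_inv_one_add_rpow ha1
  set b : ℝ := ((p - 1) / lam) ^ (1 / a) with hb
  have hb0 : 0 < b := by positivity
  have hba : b ^ a = (p - 1) / lam := by
    rw [hb, ← Real.rpow_mul (by positivity), one_div_mul_cancel (by linarith), Real.rpow_one]
  have key : ∀ y ∈ Ioi (0 : ℝ), 1 / riccatiA p lam y =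
      lam⁻¹ * (fun t : ℝ => 1 / (1 + t ^ a)) (b * y) := by
    intro y hy
    have hy' : (0 : ℝ) < y := hy
    simp only [riccatiA]
    rw [Real.mul_rpow hb0.le hy'.le, hba]
    have : (0 : ℝ) < y ^ a := by positivity
    rw [← ha]
    field_simp
  have j1 := integrableOn_Ioi_comp_mul_left_iff (fun t : ℝ => 1 / (1 + t ^ a)) 0 hb0
  have j2 := integral_comp_mul_left_Ioi (fun t : ℝ => 1 / (1 + t ^ a)) 0 hb0
  rw [mul_zero] at j1 j2
  refine ⟨(integrableOn_congr_fun key measurableSet_Ioi).2 ((j1.2 h1).const_mul _), ?_⟩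
  rw [setIntegral_congr_fun measurableSet_Ioi key, integral_const_mul, j2, h2, smul_eq_mul]
  have hsin : Real.sin (Real.pi / a) = Real.sin (Real.pi / p) := by
    rw [ha, ← Real.sin_pi_sub]
    congr 1
    field_simp
    ring
  rw [hsin, hb, piP]
  have e1 : 1 / a = 1 - 1 / p := by rw [ha]; field_simp
  have e2 : (((p - 1) / lam) ^ (1 / a))⁻¹ = (p - 1) ^ (1 / p) / (p - 1) * (lam * lam ^ (-(1 / p))) := by
    rw [e1, ← Real.rpow_neg (by positivity), Real.div_rpow hp0.le hl.le]
    rw [show -(1 - 1 / p) = 1 / p - 1 by ring, Real.rpow_sub_one hp0.ne', Real.rpow_sub_one hl.ne',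
      Real.rpow_neg hl.le]
    field_simp
  rw [e2, ha]
  by_cases hs : Real.sin (Real.pi / p) = 0
  · simp [hs]
  field_simp

theorem exists_inverse_primitive {k : ℝ → ℝ} (hk : Continuous k) (hpos : ∀ y, 0 < k y)
    (hkint : IntegrableOn k (Ioi 0)) :
    ∃ g : ℝ → ℝ, ∀ t, 0 < t → t < ∫ y in Ioi (0 : ℝ), k y →
      0 < g t ∧ ∫ y in (0 : ℝ)..(g t), k y = t ∧ HasDerivAt g (k (g t))⁻¹ t := by
  set S : ℝ → ℝ := fun x => ∫ y in (0 : ℝ)..x, k y with hS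
  have hd : ∀ x, HasStrictDerivAt S (k x) x := fun x => hk.integral_hasStrictDerivAt 0 x
  have hSc : Continuous S := continuous_iff_continuousAt.2 fun x => (hd x).hasDerivAt.continuousAt
  have hmono : StrictMono S := strictMono_of_deriv_pos fun x => by
    rw [(hd x).hasDerivAt.deriv]; exact hpos x
  have hS0 : S 0 = 0 := by simp [hS]
  have hex : ∀ t, 0 < t → t < ∫ y in Ioi (0 : ℝ), k y → ∃ y, S y = t := by
    intro t ht0 ht1
    have hlim := intervalIntegral_tendsto_integral_Ioi (0 : ℝ) hkint tendsto_id
    obtain ⟨b, hb⟩ := (hlim.eventually (lt_mem_nhds ht1)).exists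
    exact mem_range_of_exists_le_of_exists_ge hSc ⟨0, by rw [hS0]; exact ht0.le⟩ ⟨b, hb.le⟩
  choose! g hg using hex
  refine ⟨g, fun t h0 h1 => ?_⟩
  refine ⟨?_, hg t h0 h1, ?_⟩
  · rw [← hmono.lt_iff_lt, hS0, hg t h0 h1]; exact h0
  · have hne := (hpos (g t)).ne'
    have hL := (hd (g t)).to_localInverse hne
    have hR := (hd (g t)).eventually_right_inverse hne
    rw [hg t h0 h1] at hL hR
    refine hL.hasDerivAt.congr_of_eventuallyEq ?_
    filter_upwards [hR, Ioo_mem_nhds h0 h1] with x hx hx'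
    exact hmono.injective (by rw [hx, hg x hx'.1 hx'.2])

theorem young_mul {p a b : ℝ} (hp : 1 < p) (ha : 0 ≤ a) (hb : 0 ≤ b) :
    p * (a * b) ≤ a ^ p + (p - 1) * b ^ (p / (p - 1)) := by
  have hp0 : 0 < p - 1 := by linarith
  have := Real.young_inequality_of_nonneg ha hb (Real.HolderConjugate.conjExponent hp)
  rw [Real.conjExponent] at this
  have h2 := mul_le_mul_of_nonneg_left this (show 0 ≤ p by linarith)
  calc p * (a * b) ≤ _ := h2
    _ = _ := by field_simp

theorem tail_le_rpow {p C y : ℝ} {k : ℝ → ℝ} (hp : 1 < p) (hkint : IntegrableOn k (Ioi 0))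
    (hC : ∀ y, 0 < y → k y * y ^ (p / (p - 1)) ≤ C) (hy : 0 < y) :
    (∫ x in Ioi (0 : ℝ), k x) - ∫ x in (0 : ℝ)..y, k x ≤ C * (p - 1) * y ^ (-(1 / (p - 1))) := by
  have hp0 : 0 < p - 1 := by linarith
  have ha : -(p / (p - 1)) < -1 := by
    rw [neg_lt_neg_iff, lt_div_iff₀ hp0]; linarith
  rw [← intervalIntegral.integral_Ioi_sub_Ioi hkint hy.le, sub_sub_cancel]
  have h1 : ∫ x in Ioi y, k x ≤ ∫ x in Ioi y, C * x ^ (-(p / (p - 1))) := by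
    refine setIntegral_mono_on (hkint.mono_set (Ioi_subset_Ioi hy.le))
      ((integrableOn_Ioi_rpow_of_lt ha hy).const_mul C) measurableSet_Ioi fun x hx => ?_
    have hx0 : 0 < x := hy.trans hx
    rw [Real.rpow_neg hx0.le, ← div_eq_mul_inv, le_div_iff₀ (by positivity)]
    exact hC x hx0
  refine h1.trans (le_of_eq ?_)
  rw [integral_const_mul, integral_Ioi_rpow_of_lt ha hy]
  have e : -(p / (p - 1)) + 1 = -(1 / (p - 1)) := by field_simp; ring
  rw [e]
  field_simp

/-- One-dimensional weighted Dirichlet–Neumann inequality obtained from a supersolution of the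
Riccati equation. -/
theorem dirichlet_neumann_of_riccati {p lam C x1 z : ℝ} {k f q v v' : ℝ → ℝ} (hp : 1 < p)
    (hk : Continuous k) (hpos : ∀ y, 0 < k y) (hkint : IntegrableOn k (Ioi 0))
    (hC : ∀ y, 0 < y → k y * y ^ (p / (p - 1)) ≤ C)
    (hT : ∫ y in Ioi (0 : ℝ), k y = x1 - z)
    (hf : ContinuousOn f (Ico z x1)) (hf0 : ∀ s ∈ Ico z x1, 0 ≤ f s)
    (hfi : IntegrableOn f (Ioo z x1))
    (hq : ∀ s ∈ Ioo z x1, HasDerivWithinAt f (f s * q s) (Ioi s) s)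
    (hcond : ∀ s ∈ Ioo z x1, ∀ y, 0 ≤ y → ∫ x in (0 : ℝ)..y, k x = x1 - s →
      (riccatiA p lam y + q s * y) * k y ≤ 1)
    (hv : ∀ s, HasDerivAt v (v' s) s) (hv' : Continuous v') :
    lam * ∫ s in Ioo z x1, f s * |v s - v z| ^ p ≤ ∫ s in Ioo z x1, f s * |v' s| ^ p := by
  have hp0 : 0 < p - 1 := by linarith
  have hzx : z < x1 := by
    have : 0 < ∫ y in Ioi (0 : ℝ), k y := by
      rw [setIntegral_pos_iff_support_of_nonneg_ae (Eventually.of_forall fun y => (hpos y).le) hkint]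
      have : Function.support k = univ := by ext y; simp [(hpos y).ne']
      rw [this]; simp
    linarith
  have hvc : Continuous v := continuous_iff_continuousAt.2 fun x => (hv x).continuousAt
  obtain ⟨g0, hg0⟩ := exists_inverse_primitive hk hpos hkint
  set g : ℝ → ℝ := fun s => g0 (x1 - s) with hgdef
  have hg : ∀ s ∈ Ioo z x1, 0 < g s ∧ ∫ y in (0 : ℝ)..(g s), k y = x1 - s ∧
      HasDerivAt g (-(k (g s))⁻¹) s := by
    intro s hs
    obtain ⟨h1, h2, h3⟩ := hg0 (x1 - s) (by linarith [hs.2]) (by rw [hT]; linarith [hs.1])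
    refine ⟨h1, h2, ?_⟩
    have := h3.comp s ((hasDerivAt_id s).const_sub x1)
    rw [mul_neg_one] at this
    exact this
  set w : ℝ → ℝ := fun s => v s - v z with hw
  have hwd : ∀ s, HasDerivAt w (v' s) s := fun s => (hv s).sub_const _
  have hwc : Continuous w := hvc.sub continuous_const
  set F : ℝ → ℝ := fun s => f s * g s * |w s| ^ p with hF
  set D : ℝ → ℝ := fun s => f s * |v' s| ^ p - lam * (f s * |w s| ^ p) with hD
  have hi1 : ∀ h : ℝ → ℝ, Continuous h → IntegrableOn (fun s => f s * |h s| ^ p) (Ioo z x1) := by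
    intro h hh
    have hc : Continuous fun s => |h s| ^ p :=
      hh.abs.rpow_const fun _ => Or.inr (by linarith)
    obtain ⟨B, hB⟩ := (isCompact_Icc (a := z) (b := x1)).exists_bound_of_continuousOn hc.continuousOn
    refine hfi.mul_bdd (c := B) hc.aestronglyMeasurable ?_
    filter_upwards [self_mem_ae_restrict measurableSet_Ioo] with x hx
    exact hB x (Ioo_subset_Icc_self hx)
  have hDi : IntegrableOn D (Icc z x1) := by
    rw [integrableOn_Icc_iff_integrableOn_Ioo]
    exact (hi1 _ hv').sub ((hi1 _ hwc).const_mul lam)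
  have hstep : ∀ a b, z < a → a ≤ b → b < x1 → -F a ≤ ∫ s in a..b, D s := by
    intro a b ha hab hb
    have hsub : Icc a b ⊆ Ioo z x1 := fun x hx => ⟨ha.trans_le hx.1, hx.2.trans_lt hb⟩
    have hFc : ContinuousOn F (Icc a b) := by
      refine ((hf.mono (hsub.trans Ioo_subset_Ico_self)).mul fun x hx =>
        (hg x (hsub hx)).2.2.continuousAt.continuousWithinAt).mul ?_
      exact (hwc.abs.rpow_const fun _ => Or.inr (by linarith)).continuousOn
    have hFb : 0 ≤ F b := by
      have hb' := hsub (right_mem_Icc.2 hab)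
      have := hf0 b (Ioo_subset_Ico_self hb')
      have := (hg b hb').1
      simp only [hF]
      positivity
    have := intervalIntegral.sub_le_integral_of_hasDeriv_right_of_le (g := F)
      (g' := fun s => (f s * q s * g s + f s * (-(k (g s))⁻¹)) * |w s| ^ p +
        f s * g s * (p * |w s| ^ (p - 2) * w s * v' s)) (φ := D) hab hFc ?_
        (hDi.mono_set (hsub.trans Ioo_subset_Icc_self)) ?_
    · linarith
    · intro s hs
      have hs' := hsub (Ioo_subset_Icc_self hs)
      have e1 := (hq s hs').mul (hg s hs').2.2.hasDerivWithinAt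
      have e2 := ((hasDerivAt_abs_rpow (w s) hp).comp s (hwd s)).hasDerivWithinAt (s := Ioi s)
      exact e1.mul e2
    · intro s hs
      have hs' := hsub (Ioo_subset_Icc_self hs)
      obtain ⟨g1, g2, _⟩ := hg s hs'
      have hfs := hf0 s (Ioo_subset_Ico_self hs')
      have hc := hcond s hs' (g s) g1.le g2
      have hkp := hpos (g s)
      have hc' : q s * g s + (-(k (g s))⁻¹) ≤ -riccatiA p lam (g s) := by
        have : riccatiA p lam (g s) + q s * g s ≤ (k (g s))⁻¹ := by
          rw [← one_div, le_div_iff₀ hkp]; exact hc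
        linarith
      have hy := young_mul hp (abs_nonneg (v' s))
        (mul_nonneg g1.le (Real.rpow_nonneg (abs_nonneg (w s)) (p - 1)))
      have e3 : (g s * |w s| ^ (p - 1)) ^ (p / (p - 1)) = g s ^ (p / (p - 1)) * |w s| ^ p := by
        rw [Real.mul_rpow g1.le (by positivity), ← Real.rpow_mul (abs_nonneg _)]
        congr 2
        field_simp
      have e4 : |w s| ^ (p - 2) * w s * v' s ≤ |v' s| * |w s| ^ (p - 1) := by
        by_cases h0 : w s = 0
        · simp only [h0, mul_zero, zero_mul]; positivity
        · have hwpos : 0 < |w s| := abs_pos.2 h0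
          calc |w s| ^ (p - 2) * w s * v' s ≤ |(|w s| ^ (p - 2) * w s * v' s)| := le_abs_self _
            _ = |w s| ^ (p - 2) * |w s| * |v' s| := by
              rw [abs_mul, abs_mul, abs_of_nonneg (Real.rpow_nonneg (abs_nonneg (w s)) (p - 2))]
            _ = |v' s| * |w s| ^ (p - 1) := by
              rw [← Real.rpow_add_one hwpos.ne']
              ring_nf
      rw [e3] at hy
      have hW : 0 ≤ |w s| ^ p := by positivity
      simp only [hD]
      have a1 : (q s * g s + (-(k (g s))⁻¹)) * |w s| ^ p ≤ -riccatiA p lam (g s) * |w s| ^ p :=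
        mul_le_mul_of_nonneg_right hc' hW
      have a2 : g s * p * (|w s| ^ (p - 2) * w s * v' s) ≤ g s * p * (|v' s| * |w s| ^ (p - 1)) :=
        mul_le_mul_of_nonneg_left e4 (by positivity)
      rw [riccatiA] at a1
      have a3 : (q s * g s + (-(k (g s))⁻¹)) * |w s| ^ p +
          g s * p * (|w s| ^ (p - 2) * w s * v' s) ≤ |v' s| ^ p - lam * |w s| ^ p := by
        linarith
      have a4 := mul_le_mul_of_nonneg_left a3 hfs
      linarith
  -- boundary term at `z`
  obtain ⟨L, hL⟩ := (isCompact_Icc (a := z) (b := x1)).exists_bound_of_continuousOn hv'.continuousOn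
  have hL0 : 0 ≤ L := (norm_nonneg _).trans (hL z ⟨le_rfl, hzx.le⟩)
  have hC0 : 0 < C := (mul_pos (hpos 1) (by positivity)).trans_le (hC 1 one_pos)
  have hFle : ∀ s ∈ Ioo z x1, F s ≤ f s * ((C * (p - 1)) ^ (p - 1) * L ^ p * (s - z)) := by
    intro s hs
    obtain ⟨g1, g2, _⟩ := hg s hs
    have hsz : 0 < s - z := by linarith [hs.1]
    have ht := tail_le_rpow hp hkint hC g1
    rw [hT, g2, Real.rpow_neg g1.le, ← div_eq_mul_inv, le_div_iff₀ (by positivity)] at ht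
    have hgle : g s ≤ (C * (p - 1)) ^ (p - 1) / (s - z) ^ (p - 1) := by
      have h1 : g s ^ (1 / (p - 1)) ≤ C * (p - 1) / (s - z) := by
        rw [le_div_iff₀ hsz]; linarith
      have h2 := Real.rpow_le_rpow (by positivity) h1 hp0.le
      rwa [← Real.rpow_mul g1.le, one_div_mul_cancel hp0.ne', Real.rpow_one,
        Real.div_rpow (by positivity) hsz.le] at h2
    have hwle : |w s| ≤ L * (s - z) := by
      have := (convex_Icc z x1).norm_image_sub_le_of_norm_hasDerivWithin_le (f := v) (f' := v')
        (C := L) (fun x _ => (hv x).hasDerivWithinAt) hL ⟨le_rfl, hzx.le⟩ (Ioo_subset_Icc_self hs)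
      rwa [Real.norm_eq_abs, Real.norm_eq_abs, abs_of_pos hsz] at this
    have hwp : |w s| ^ p ≤ L ^ p * (s - z) ^ p := by
      rw [← Real.mul_rpow hL0 hsz.le]
      exact Real.rpow_le_rpow (abs_nonneg _) hwle (by linarith)
    simp only [hF, mul_assoc]
    refine mul_le_mul_of_nonneg_left ?_ (hf0 s (Ioo_subset_Ico_self hs))
    calc g s * |w s| ^ p ≤ ((C * (p - 1)) ^ (p - 1) / (s - z) ^ (p - 1)) *
          (L ^ p * (s - z) ^ p) := by gcongr
      _ = _ := by
        rw [show (s - z) ^ p = (s - z) ^ (p - 1) * (s - z) by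
          rw [← Real.rpow_add_one hsz.ne']; ring_nf]
        field_simp
  set P : ℝ → ℝ := fun x => ∫ t in z..x, D t with hP
  have hPc : ContinuousOn P (Icc z x1) := by
    have := intervalIntegral.continuousOn_primitive_interval (μ := volume) (f := D) (a := z) (b := x1)
      (by rwa [uIcc_of_le hzx.le])
    rwa [uIcc_of_le hzx.le] at this
  have hDii : ∀ a ∈ Icc z x1, IntervalIntegrable D volume z a := fun a ha => by
    rw [intervalIntegrable_iff_integrableOn_Icc_of_le ha.1]
    exact hDi.mono_set (Icc_subset_Icc_right ha.2)
  have hstep1 : ∀ a ∈ Ioo z x1, -F a ≤ P x1 - P a := by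
    intro a ha
    have hlim : Tendsto P (𝓝[<] x1) (𝓝 (P x1)) :=
      (hPc x1 ⟨hzx.le, le_rfl⟩).mono_left (nhdsWithin_le_of_mem
        (mem_of_superset (Ioo_mem_nhdsLT hzx) Ioo_subset_Icc_self))
    refine ge_of_tendsto (hlim.sub_const (P a)) ?_
    · filter_upwards [Ico_mem_nhdsLT ha.2] with b hb
      have := hstep a b ha.1 hb.1 hb.2
      rwa [← intervalIntegral.integral_interval_sub_left
        (hDii b ⟨by linarith [ha.1, hb.1], hb.2.le⟩) (hDii a (Ioo_subset_Icc_self ha))] at this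
  have hlim0 : Tendsto (fun a => f a * ((C * (p - 1)) ^ (p - 1) * L ^ p * (a - z))) (𝓝[>] z)
      (𝓝 (f z * ((C * (p - 1)) ^ (p - 1) * L ^ p * (z - z)))) := by
    refine Tendsto.mul ?_ ?_
    · exact (hf z ⟨le_rfl, hzx⟩).mono_left (nhdsWithin_le_of_mem
        (mem_of_superset (Ioo_mem_nhdsGT hzx) Ioo_subset_Ico_self))
    · exact (Continuous.tendsto (by fun_prop) z).mono_left nhdsWithin_le_nhds
  have hlimP : Tendsto P (𝓝[>] z) (𝓝 (P z)) :=
    (hPc z ⟨le_rfl, hzx.le⟩).mono_left (nhdsWithin_le_of_mem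
        (mem_of_superset (Ioo_mem_nhdsGT hzx) Ioo_subset_Icc_self))
  have hfin : 0 ≤ P x1 := by
    have h1 := hlim0.add (hlimP.const_sub (P x1))
    have h2 : 0 ≤ f z * ((C * (p - 1)) ^ (p - 1) * L ^ p * (z - z)) + (P x1 - P z) := by
      refine ge_of_tendsto h1 ?_
      filter_upwards [Ioo_mem_nhdsGT hzx] with a ha
      linarith [hstep1 a ha, hFle a ha]
    have h3 : P z = 0 := by simp [hP]
    rw [h3] at h2
    simpa using h2
  have hfin2 : P x1 = (∫ s in Ioo z x1, f s * |v' s| ^ p) - lam * ∫ s in Ioo z x1, f s * |w s| ^ p := by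
    rw [← integral_const_mul, ← integral_sub (hi1 _ hv') ((hi1 _ hwc).const_mul lam)]
    simp only [hP]
    rw [intervalIntegral.integral_of_le hzx.le, integral_Ioc_eq_integral_Ioo]
  linarith

theorem riccatiA_pos {p lam y : ℝ} (hp : 1 < p) (hl : 0 < lam) (hy : 0 ≤ y) :
    0 < riccatiA p lam y := by
  have : 0 < p - 1 := by linarith
  have : 0 ≤ y ^ (p / (p - 1)) := Real.rpow_nonneg hy _
  unfold riccatiA
  positivity

theorem lam_le_riccatiA {p lam y : ℝ} (hp : 1 < p) (hy : 0 ≤ y) :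
    lam ≤ riccatiA p lam y := by
  have : 0 < p - 1 := by linarith
  have : 0 ≤ y ^ (p / (p - 1)) := Real.rpow_nonneg hy _
  have : 0 ≤ (p - 1) * y ^ (p / (p - 1)) := by positivity
  unfold riccatiA
  linarith

theorem continuous_riccatiA_abs {p lam : ℝ} (hp : 1 < p) :
    Continuous fun y => riccatiA p lam |y| := by
  have : 0 < p - 1 := by linarith
  unfold riccatiA
  exact continuous_const.add (continuous_const.mul
    (continuous_abs.rpow_const fun _ => Or.inr (by positivity)))

/-- Kernel whose primitive inverts the solution of the comparison Riccati equation with constant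
logarithmic slope `κ`. -/
noncomputable def riccatiKernel (p lam κ y : ℝ) : ℝ :=
  1 / riccatiA p lam |y| * (1 - κ * |y| / (riccatiA p lam |y| + |κ| * |y|))

theorem riccatiKernel_pos {p lam : ℝ} (hp : 1 < p) (hl : 0 < lam) (κ y : ℝ) :
    0 < riccatiKernel p lam κ y := by
  have hA := riccatiA_pos hp hl (abs_nonneg y)
  have h1 : 0 ≤ |κ| * |y| := by positivity
  have h2 : κ * |y| ≤ |κ| * |y| := mul_le_mul_of_nonneg_right (le_abs_self _) (abs_nonneg _)
  unfold riccatiKernel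
  refine mul_pos (by positivity) ?_
  rw [sub_pos, div_lt_one (by positivity)]
  linarith

theorem riccatiKernel_add_neg {p lam : ℝ} (κ y : ℝ) :
    riccatiKernel p lam κ y + riccatiKernel p lam (-κ) y = 2 * (1 / riccatiA p lam |y|) := by
  unfold riccatiKernel
  rw [abs_neg]
  ring

theorem riccatiKernel_le {p lam : ℝ} (hp : 1 < p) (hl : 0 < lam) (κ y : ℝ) :
    riccatiKernel p lam κ y ≤ 2 * (1 / riccatiA p lam |y|) := by
  linarith [riccatiKernel_add_neg (p := p) (lam := lam) κ y, riccatiKernel_pos hp hl (-κ) y]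

theorem continuous_riccatiKernel {p lam : ℝ} (hp : 1 < p) (hl : 0 < lam) :
    Continuous fun x : ℝ × ℝ => riccatiKernel p lam x.1 x.2 := by
  have hA : Continuous fun x : ℝ × ℝ => riccatiA p lam |x.2| :=
    (continuous_riccatiA_abs hp).comp continuous_snd
  have hA0 : ∀ x : ℝ × ℝ, 0 < riccatiA p lam |x.2| := fun x => riccatiA_pos hp hl (abs_nonneg _)
  unfold riccatiKernel
  refine (continuous_const.div hA fun x => (hA0 x).ne').mul (continuous_const.sub
    (Continuous.div (by fun_prop) (hA.add (by fun_prop)) fun x => ?_))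
  have := hA0 x
  positivity

theorem antitone_riccatiKernel {p lam : ℝ} (hp : 1 < p) (hl : 0 < lam) (y : ℝ) :
    Antitone fun κ => riccatiKernel p lam κ y := by
  intro a b hab
  have hA := riccatiA_pos hp hl (abs_nonneg y)
  have hy := abs_nonneg y
  simp only [riccatiKernel]
  refine mul_le_mul_of_nonneg_left ?_ (by positivity)
  refine sub_le_sub_left ?_ _
  rw [div_le_div_iff₀ (by positivity) (by positivity)]
  have key : a * |b| ≤ b * |a| := by
    rcases abs_cases a with ⟨h1, h2⟩ | ⟨h1, h2⟩ <;> rcases abs_cases b with ⟨h3, h4⟩ | ⟨h3, h4⟩ <;>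
      rw [h1, h3] <;> nlinarith
  nlinarith [mul_le_mul_of_nonneg_right key (mul_nonneg hy hy), mul_le_mul_of_nonneg_right hab (mul_nonneg hy hA.le)]

theorem riccatiKernel_mul_le {p lam κ q y : ℝ} (hp : 1 < p) (hl : 0 < lam) (hq : q ≤ κ)
    (hy : 0 ≤ y) : (riccatiA p lam y + q * y) * riccatiKernel p lam κ y ≤ 1 := by
  have hA := riccatiA_pos hp hl hy
  rcases le_total (riccatiA p lam y + q * y) 0 with h | h
  · have := mul_nonpos_of_nonpos_of_nonneg h (riccatiKernel_pos hp hl κ y).le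
    linarith
  refine (mul_le_mul_of_nonneg_left (antitone_riccatiKernel hp hl y hq) h).trans ?_
  simp only [riccatiKernel]
  rw [abs_of_nonneg hy]
  set A := riccatiA p lam y
  rcases abs_cases q with ⟨h1, h2⟩ | ⟨h1, h2⟩
  · rw [h1]
    have : 0 < A + q * y := by positivity
    apply le_of_eq
    field_simp
    ring
  · rw [h1]
    have hqy : 0 ≤ -q * y := mul_nonneg (by linarith) hy
    have : 0 < A + -q * y := by positivity
    rw [show (A + q * y) * (1 / A * (1 - q * y / (A + -q * y))) =
      ((A + q * y) * (A + 2 * (-q * y))) / (A * (A + -q * y)) by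
        obtain ⟨X, hX⟩ : ∃ X, q * y = -X := ⟨-(q * y), by ring⟩
        have hne : A + X ≠ 0 := by linarith
        rw [neg_mul, hX, neg_neg]
        field_simp
        ring]
    rw [div_le_one (by positivity)]
    nlinarith

theorem riccatiKernel_mul_le_of_le_neg_one {p lam κ q y : ℝ} (hp : 1 < p) (hl : 0 < lam)
    (hq : q ≤ κ) (hq1 : q ≤ -1) (hy : 0 ≤ y) (h : 0 ≤ riccatiA p lam y + q * y) :
    (riccatiA p lam y + q * y) * riccatiKernel p lam κ y ≤ 1 - y ^ 2 / riccatiA p lam y ^ 2 := by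
  have hA := riccatiA_pos hp hl hy
  refine (mul_le_mul_of_nonneg_left (antitone_riccatiKernel hp hl y hq) h).trans ?_
  simp only [riccatiKernel]
  rw [abs_of_nonneg hy]
  set A := riccatiA p lam y
  rw [abs_of_neg (by linarith)]
  have hqy : 0 ≤ -q * y := mul_nonneg (by linarith) hy
  have : 0 < A + -q * y := by positivity
  rw [show (A + q * y) * (1 / A * (1 - q * y / (A + -q * y))) =
    1 - 2 * (-q * y) ^ 2 / (A * (A + -q * y)) by
      obtain ⟨X, hX⟩ : ∃ X, q * y = -X := ⟨-(q * y), by ring⟩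
      have hne : A + X ≠ 0 := by linarith
      rw [neg_mul, hX, neg_neg]
      field_simp
      ring]
  refine sub_le_sub_left ?_ _
  have hyy : y ≤ -q * y := by nlinarith
  rw [div_le_div_iff₀ (by positivity) (by positivity)]
  have h1 : y ^ 2 ≤ (-q * y) ^ 2 := by gcongr
  have h2 : A * (A + -q * y) ≤ 2 * A ^ 2 := by nlinarith
  calc y ^ 2 * (A * (A + -q * y)) ≤ (-q * y) ^ 2 * (2 * A ^ 2) := by gcongr
    _ = _ := by ring

theorem integrableOn_inv_riccatiA_abs {p lam : ℝ} (hp : 1 < p) (hl : 0 < lam) :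
    IntegrableOn (fun y : ℝ => 2 * (1 / riccatiA p lam |y|)) (Ioi 0) ∧
    ∫ y in Ioi (0 : ℝ), 2 * (1 / riccatiA p lam |y|) = piP p * lam ^ (-(1 / p)) := by
  obtain ⟨h1, h2⟩ := integrableOn_and_integral_inv_riccatiA hp hl
  have e : ∀ y ∈ Ioi (0 : ℝ), 1 / riccatiA p lam |y| = 1 / riccatiA p lam y := fun y hy => by
    rw [abs_of_pos hy]
  refine ⟨((integrableOn_congr_fun e measurableSet_Ioi).2 h1).const_mul 2, ?_⟩
  rw [integral_const_mul, setIntegral_congr_fun measurableSet_Ioi e, h2]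
  ring

theorem integrableOn_riccatiKernel {p lam : ℝ} (hp : 1 < p) (hl : 0 < lam) (κ : ℝ) :
    IntegrableOn (riccatiKernel p lam κ) (Ioi 0) := by
  refine (integrableOn_inv_riccatiA_abs hp hl).1.mono' ?_ ?_
  · exact ((continuous_riccatiKernel hp hl).comp (Continuous.prodMk_right κ)).aestronglyMeasurable
  · refine Eventually.of_forall fun y => ?_
    rw [Real.norm_of_nonneg (riccatiKernel_pos hp hl κ y).le]
    exact riccatiKernel_le hp hl κ y

theorem integral_riccatiKernel_add_neg {p lam : ℝ} (hp : 1 < p) (hl : 0 < lam) (κ : ℝ) :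
    (∫ y in Ioi (0 : ℝ), riccatiKernel p lam κ y) + ∫ y in Ioi (0 : ℝ), riccatiKernel p lam (-κ) y =
      piP p * lam ^ (-(1 / p)) := by
  rw [← integral_add (integrableOn_riccatiKernel hp hl κ) (integrableOn_riccatiKernel hp hl (-κ)),
    ← (integrableOn_inv_riccatiA_abs hp hl).2]
  simp_rw [riccatiKernel_add_neg]

theorem continuous_integral_riccatiKernel {p lam : ℝ} (hp : 1 < p) (hl : 0 < lam) :
    Continuous fun κ => ∫ y in Ioi (0 : ℝ), riccatiKernel p lam κ y := by
  refine continuous_of_dominated (bound := fun y => 2 * (1 / riccatiA p lam |y|)) ?_ ?_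
    (integrableOn_inv_riccatiA_abs hp hl).1 ?_
  · exact fun κ => (integrableOn_riccatiKernel hp hl κ).1
  · refine fun κ => Eventually.of_forall fun y => ?_
    rw [Real.norm_of_nonneg (riccatiKernel_pos hp hl κ y).le]
    exact riccatiKernel_le hp hl κ y
  · exact Eventually.of_forall fun y =>
      (continuous_riccatiKernel hp hl).comp (Continuous.prodMk_left y)

theorem integral_riccatiKernel_pos {p lam : ℝ} (hp : 1 < p) (hl : 0 < lam) (κ : ℝ) :
    0 < ∫ y in Ioi (0 : ℝ), riccatiKernel p lam κ y := by
  rw [setIntegral_pos_iff_support_of_nonneg_ae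
    (Eventually.of_forall fun y => (riccatiKernel_pos hp hl κ y).le)
    (integrableOn_riccatiKernel hp hl κ)]
  have : Function.support (riccatiKernel p lam κ) = univ := by
    ext y; simp [(riccatiKernel_pos hp hl κ y).ne']
  rw [this]; simp

theorem antitone_integral_riccatiKernel {p lam : ℝ} (hp : 1 < p) (hl : 0 < lam) :
    Antitone fun κ => ∫ y in Ioi (0 : ℝ), riccatiKernel p lam κ y := fun _ _ hab =>
  integral_mono (integrableOn_riccatiKernel hp hl _) (integrableOn_riccatiKernel hp hl _)
    fun y => antitone_riccatiKernel hp hl y hab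

/-- A compactly supported bump vanishing quadratically at the origin. -/
noncomputable def riccatiBump (y1 y : ℝ) : ℝ := y ^ 2 * max (y1 - |y|) 0

theorem continuous_riccatiBump (y1 : ℝ) : Continuous (riccatiBump y1) := by
  unfold riccatiBump; fun_prop

theorem riccatiBump_nonneg (y1 y : ℝ) : 0 ≤ riccatiBump y1 y := by
  unfold riccatiBump; positivity

theorem riccatiBump_eq_zero {y1 y : ℝ} (h : y1 ≤ y) : riccatiBump y1 y = 0 := by
  have : max (y1 - |y|) 0 = 0 := max_eq_right (by linarith [le_abs_self y])
  simp [riccatiBump, this]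

theorem riccatiBump_le {y1 y : ℝ} (h1 : 0 ≤ y1) : riccatiBump y1 y ≤ y ^ 2 * y1 := by
  unfold riccatiBump
  gcongr
  exact max_le (by linarith [abs_nonneg y]) h1

theorem integrableOn_riccatiBump (y1 : ℝ) : IntegrableOn (riccatiBump y1) (Ioi 0) := by
  refine ((continuous_riccatiBump y1).integrable_of_hasCompactSupport ?_).integrableOn
  refine HasCompactSupport.intro (isCompact_Icc (a := -y1) (b := y1)) fun y hy => ?_
  rw [riccatiBump]
  have : max (y1 - |y|) 0 = 0 := by
    apply max_eq_right
    by_contra hcon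
    push Not at hcon
    exact hy (abs_le.1 (by linarith))
  rw [this, mul_zero]

theorem integral_riccatiBump_pos {y1 : ℝ} (h : 0 < y1) :
    0 < ∫ y in Ioi (0 : ℝ), riccatiBump y1 y := by
  rw [setIntegral_pos_iff_support_of_nonneg_ae
    (Eventually.of_forall fun y => riccatiBump_nonneg y1 y) (integrableOn_riccatiBump y1)]
  have : Ioo 0 y1 ⊆ Function.support (riccatiBump y1) ∩ Ioi 0 := fun y hy => by
    refine ⟨?_, hy.1⟩
    have h1 : 0 < y1 - |y| := by rw [abs_of_pos hy.1]; linarith [hy.2]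
    have h2 := hy.1
    have : 0 < riccatiBump y1 y := by
      rw [riccatiBump, max_eq_left h1.le]; positivity
    exact this.ne'
  refine lt_of_lt_of_le ?_ (measure_mono this)
  simp [h]

theorem ConcaveOn.hasDerivWithinAt_Ioi {x0 x1 s : ℝ} {ψ : ℝ → ℝ} (h : ConcaveOn ℝ (Ioo x0 x1) ψ)
    (hs : s ∈ Ioo x0 x1) : HasDerivWithinAt ψ (derivWithin ψ (Ioi s) s) (Ioi s) s := by
  have := (h.neg.hasDerivWithinAt_rightDeriv_of_mem_interior (x := s) (by rwa [interior_Ioo])).neg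
  simp only [neg_neg] at this
  exact this.differentiableWithinAt.hasDerivWithinAt

theorem derivWithin_Ioi_le_of_antitoneOn {x0 x1 z κ s : ℝ} {ψ : ℝ → ℝ}
    (h : ConcaveOn ℝ (Ioo x0 x1) ψ) (hs : s ∈ Ioo x0 x1) (hz : z < s)
    (ha : AntitoneOn (fun t => ψ t - κ * t) (Ioo z x1)) : derivWithin ψ (Ioi s) s ≤ κ := by
  have h1 := h.hasDerivWithinAt_Ioi hs
  rw [hasDerivWithinAt_iff_tendsto_slope' (by simp)] at h1
  refine le_of_tendsto h1 ?_
  filter_upwards [Ioo_mem_nhdsGT hs.2] with t ht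
  have := ha ⟨hz, hs.2⟩ ⟨hz.trans ht.1, ht.2⟩ ht.1.le
  rw [slope_def_field, div_le_iff₀ (by linarith [ht.1])]
  simp only at this
  linarith

/-- Dirichlet–Neumann inequality on the right of a zero, for a log-concave weight. -/
theorem dirichlet_neumann_right {p lam κ ε y1 ρ x0 x1 z : ℝ} {ψ v v' : ℝ → ℝ} (hp : 1 < p)
    (hl : 0 < lam) (hψ : ConcaveOn ℝ (Ioo x0 x1) ψ)
    (hfi : IntegrableOn (fun s => Real.exp (ψ s)) (Ioo x0 x1))
    (hz : z ∈ Ioo x0 x1) (hy1 : 0 < y1) (hε : 0 ≤ ε)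
    (hlen : x1 - z = (∫ y in Ioi (0 : ℝ), riccatiKernel p lam κ y) +
      ε * ∫ y in Ioi (0 : ℝ), riccatiBump y1 y)
    (hanti : AntitoneOn (fun t => ψ t - κ * t) (Ioo z x1))
    (hterm : ε = 0 ∨ (AntitoneOn (fun t => ψ t + t) (Ioo (x1 - ρ) x1) ∧
      y1 * (2 / lam + ε * y1 ^ 3) < ρ ∧ ε * y1 * riccatiA p lam y1 ^ 3 ≤ 1))
    (hv : ∀ s, HasDerivAt v (v' s) s) (hv' : Continuous v') :
    lam * ∫ s in Ioo z x1, Real.exp (ψ s) * |v s - v z| ^ p ≤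
      ∫ s in Ioo z x1, Real.exp (ψ s) * |v' s| ^ p := by
  have hp0 : 0 < p - 1 := by linarith
  have hsub : Ioo z x1 ⊆ Ioo x0 x1 := Ioo_subset_Ioo_left hz.1.le
  have hkc : Continuous fun y => riccatiKernel p lam κ y + ε * riccatiBump y1 y :=
    ((continuous_riccatiKernel hp hl).comp (Continuous.prodMk_right κ)).add
      (continuous_const.mul (continuous_riccatiBump y1))
  refine dirichlet_neumann_of_riccati (k := fun y => riccatiKernel p lam κ y + ε * riccatiBump y1 y)
    (q := fun s => derivWithin ψ (Ioi s) s) (C := 2 / (p - 1) + ε * (y1 ^ 3 * y1 ^ (p / (p - 1)))) hp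
    hkc ?_ ((integrableOn_riccatiKernel hp hl κ).add ((integrableOn_riccatiBump y1).const_mul ε))
    ?_ ?_ ?_ (fun s _ => (Real.exp_pos _).le) (hfi.mono_set hsub) ?_ ?_ hv hv'
  · intro y
    have := riccatiKernel_pos hp hl κ y
    have := riccatiBump_nonneg y1 y
    positivity
  · intro y hy
    have hyp : 0 < y ^ (p / (p - 1)) := by positivity
    rw [add_mul]
    refine add_le_add ?_ ?_
    · have h1 := riccatiKernel_le hp hl κ y
      rw [abs_of_pos hy] at h1
      have hA := riccatiA_pos hp hl hy.le
      calc _ ≤ 2 * (1 / riccatiA p lam y) * y ^ (p / (p - 1)) := by gcongr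
        _ ≤ 2 / (p - 1) := by
          rw [mul_one_div, div_mul_eq_mul_div, div_le_div_iff₀ hA hp0, riccatiA]
          nlinarith
    · rw [mul_assoc]
      refine mul_le_mul_of_nonneg_left ?_ hε
      rcases le_total y1 y with h | h
      · rw [riccatiBump_eq_zero h, zero_mul]; positivity
      · have : riccatiBump y1 y ≤ y1 ^ 3 := (riccatiBump_le hy1.le).trans (by
          calc y ^ 2 * y1 ≤ y1 ^ 2 * y1 := by gcongr
            _ = _ := by ring)
        gcongr
  · rw [integral_add (integrableOn_riccatiKernel hp hl κ)
      ((integrableOn_riccatiBump y1).const_mul ε), integral_const_mul, hlen]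
  · refine Real.continuous_exp.comp_continuousOn ?_
    exact (hψ.continuousOn isOpen_Ioo).mono fun s hs => ⟨hz.1.trans_le hs.1, hs.2⟩
  · exact fun s hs => (hψ.hasDerivWithinAt_Ioi (hsub hs)).exp
  · intro s hs y hy hys
    have hq := derivWithin_Ioi_le_of_antitoneOn hψ (hsub hs) hs.1 hanti
    have hbase := riccatiKernel_mul_le (y := y) hp hl hq hy
    set q := derivWithin ψ (Ioi s) s
    rcases hterm with h0 | ⟨ht1, ht2, ht3⟩
    · rw [h0, zero_mul, add_zero]; exact hbase
    rcases le_or_gt y1 y with hyy | hyy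
    · rw [riccatiBump_eq_zero hyy, mul_zero, add_zero]; exact hbase
    have hA := riccatiA_pos hp hl hy
    rcases le_total (riccatiA p lam y + q * y) 0 with h | h
    · have hb := riccatiBump_nonneg y1 y
      have hb2 := riccatiKernel_pos hp hl κ y
      have := mul_nonpos_of_nonpos_of_nonneg h (show 0 ≤ riccatiKernel p lam κ y + ε * riccatiBump y1 y by positivity)
      linarith
    have hbnd : ∀ x ∈ uIoc 0 y, ‖riccatiKernel p lam κ x + ε * riccatiBump y1 x‖ ≤
        2 / lam + ε * y1 ^ 3 := by
      intro x hx
      rw [uIoc_of_le hy] at hx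
      have hb2 := riccatiKernel_pos hp hl κ x
      have hb := riccatiBump_nonneg y1 x
      rw [Real.norm_of_nonneg (by positivity)]
      have hx1 : x ≤ y1 := hx.2.trans hyy.le
      have hx0 := hx.1
      refine add_le_add ?_ (mul_le_mul_of_nonneg_left ((riccatiBump_le hy1.le).trans (by
          calc x ^ 2 * y1 ≤ y1 ^ 2 * y1 := by gcongr
            _ = _ := by ring)) hε)
      refine (riccatiKernel_le hp hl κ x).trans ?_
      rw [mul_one_div]
      gcongr
      exact lam_le_riccatiA hp (abs_nonneg _)
    have hI := intervalIntegral.norm_integral_le_of_norm_le_const hbnd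
    rw [hys, Real.norm_of_nonneg (by linarith [hs.2]), sub_zero, abs_of_nonneg hy] at hI
    have hsρ : x1 - ρ < s := by
      have : (2 / lam + ε * y1 ^ 3) * y ≤ (2 / lam + ε * y1 ^ 3) * y1 := by gcongr
      linarith
    have hq1 : q ≤ -1 := by
      refine derivWithin_Ioi_le_of_antitoneOn hψ (hsub hs) hsρ ?_
      simpa using ht1
    have hfin := riccatiKernel_mul_le_of_le_neg_one hp hl hq hq1 hy h
    have hA1 : riccatiA p lam y ≤ riccatiA p lam y1 := by
      unfold riccatiA
      gcongr
    have hqy : q * y ≤ 0 := mul_nonpos_of_nonpos_of_nonneg (by linarith) hy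
    have hb : (riccatiA p lam y + q * y) * (ε * riccatiBump y1 y) ≤ y ^ 2 / riccatiA p lam y ^ 2 := by
      have := riccatiBump_nonneg y1 y
      have hA2 := hA.trans_le hA1
      rw [le_div_iff₀ (by positivity)]
      calc (riccatiA p lam y + q * y) * (ε * riccatiBump y1 y) * riccatiA p lam y ^ 2
          ≤ riccatiA p lam y1 * (ε * (y ^ 2 * y1)) * riccatiA p lam y1 ^ 2 := by
            gcongr
            · linarith
            · exact riccatiBump_le hy1.le
        _ = y ^ 2 * (ε * y1 * riccatiA p lam y1 ^ 3) := by ring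
        _ ≤ y ^ 2 * 1 := by gcongr
        _ = y ^ 2 := mul_one _
    rw [mul_add]
    linarith

theorem ConcaveOn.slope_le_slope_of_lt {S : Set ℝ} {h : ℝ → ℝ} (hc : ConcaveOn ℝ S h) {a b s t : ℝ}
    (ha : a ∈ S) (ht : t ∈ S) (hab : a < b) (hbs : b < s) (hst : s < t) :
    (h t - h s) / (t - s) ≤ (h b - h a) / (b - a) := by
  have hb : b ∈ S := hc.1.ordConnected.out ha ht ⟨hab.le, (hbs.trans hst).le⟩
  have hs : s ∈ S := hc.1.ordConnected.out ha ht ⟨(hab.trans hbs).le, hst.le⟩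
  exact (hc.slope_anti_adjacent hb ht hbs hst).trans (hc.slope_anti_adjacent ha hs hab hbs)

theorem exists_balanced_slope {x0 x1 : ℝ} {ψ Z : ℝ → ℝ} (hψ : ConcaveOn ℝ (Ioo x0 x1) ψ)
    (hZc : Continuous Z) (hZm : Monotone Z) (hZ : ∀ κ, Z κ ∈ Ioo x0 x1) :
    ∃ κ, AntitoneOn (fun t => ψ t - κ * t) (Ioo (Z κ) x1) ∧
      MonotoneOn (fun t => ψ t - κ * t) (Ioo x0 (Z κ)) := by
  set R : Set ℝ := {κ | ∀ s t, s < t → t < x1 → Z κ < s → ψ t - κ * t ≤ ψ s - κ * s} with hR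
  set L : Set ℝ := {κ | ∀ s t, s < t → x0 < s → t < Z κ → ψ s - κ * s ≤ ψ t - κ * t} with hL
  have hRc : IsClosed R := by
    simp only [hR, ofPred_forall]
    refine isClosed_iInter fun s => isClosed_iInter fun t => isClosed_iInter fun _ =>
      isClosed_iInter fun _ => ?_
    simp only [imp_iff_not_or, not_lt]
    exact (isClosed_le continuous_const hZc).union (isClosed_le
      (f := fun κ : ℝ => ψ t - κ * t) (g := fun κ : ℝ => ψ s - κ * s) (by fun_prop) (by fun_prop))
  have hLc : IsClosed L := by
    simp only [hL, ofPred_forall]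
    refine isClosed_iInter fun s => isClosed_iInter fun t => isClosed_iInter fun _ =>
      isClosed_iInter fun _ => ?_
    simp only [imp_iff_not_or, not_lt]
    exact (isClosed_le hZc continuous_const).union (isClosed_le
      (f := fun κ : ℝ => ψ s - κ * s) (g := fun κ : ℝ => ψ t - κ * t) (by fun_prop) (by fun_prop))
  have hcov : (univ : Set ℝ) ⊆ R ∪ L := by
    intro κ _
    by_contra hcon
    simp only [mem_union, not_or, hR, hL, mem_ofPred_eq] at hcon
    push Not at hcon
    obtain ⟨⟨s, t, hst, ht, hs, h1⟩, ⟨a, b, hab, ha, hb, h2⟩⟩ := hcon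
    have := hψ.slope_le_slope_of_lt (a := a) (b := b) (s := s) (t := t)
      ⟨ha, hab.trans (hb.trans (hZ κ).2)⟩ ⟨(hZ κ).1.trans (hs.trans hst), ht⟩ hab (hb.trans hs) hst
    rw [div_le_div_iff₀ (by linarith) (by linarith)] at this
    nlinarith [mul_pos (sub_pos.2 hst) (sub_pos.2 hab)]
  have hRn : ((univ : Set ℝ) ∩ R).Nonempty := by
    obtain ⟨a, ha0, haZ⟩ := exists_between (hZ 0).1
    obtain ⟨b, hab, hbZ⟩ := exists_between haZ
    refine ⟨max 0 ((ψ b - ψ a) / (b - a)), mem_univ _, fun s t hst ht hs => ?_⟩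
    have hs0 : Z 0 < s := (hZm (le_max_left _ _)).trans_lt hs
    have := (hψ.slope_le_slope_of_lt (a := a) (b := b) (s := s) (t := t)
      ⟨ha0, haZ.trans (hZ 0).2⟩ ⟨(hZ 0).1.trans (hs0.trans hst), ht⟩ hab
        (hbZ.trans hs0) hst).trans (le_max_right 0 _)
    rw [div_le_iff₀ (by linarith)] at this
    linarith
  have hLn : ((univ : Set ℝ) ∩ L).Nonempty := by
    obtain ⟨a, haZ, ha0⟩ := exists_between (hZ 0).2
    obtain ⟨b, hab, hb0⟩ := exists_between ha0
    refine ⟨min 0 ((ψ b - ψ a) / (b - a)), mem_univ _, fun s t hst hs ht => ?_⟩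
    have ht0 : t < Z 0 := ht.trans_le (hZm (min_le_left _ _))
    have := (min_le_right 0 _).trans (hψ.slope_le_slope_of_lt (a := s) (b := t) (s := a) (t := b)
      ⟨hs, hst.trans (ht0.trans (hZ 0).2)⟩ ⟨(hZ 0).1.trans (haZ.trans hab), hb0⟩ hst
        (ht0.trans haZ) hab)
    rw [le_div_iff₀ (by linarith)] at this
    linarith
  obtain ⟨κ, _, h1, h2⟩ := isPreconnected_closed_iff.1 isPreconnected_univ R L hRc hLc hcov hRn hLn
  refine ⟨κ, fun s hs t ht hst => ?_, fun s hs t ht hst => ?_⟩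
  · rcases hst.eq_or_lt with rfl | hst
    · exact le_rfl
    · exact h1 s t hst ht.2 hs.1
  · rcases hst.eq_or_lt with rfl | hst
    · exact le_rfl
    · exact h2 s t hst hs.1 ht.2

theorem integral_Ioo_comp_neg (F : ℝ → ℝ) (a b : ℝ) :
    ∫ s in Ioo (-b) (-a), F (-s) = ∫ s in Ioo a b, F s := by
  have := (Measure.measurePreserving_neg (volume : Measure ℝ)).setIntegral_preimage_emb
    (MeasurableEquiv.neg ℝ).measurableEmbedding F (Ioo a b)
  rw [← this]
  congr 2
  ext x
  simp only [mem_Ioo, mem_preimage]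
  constructor <;> rintro ⟨h1, h2⟩ <;> constructor <;> linarith

theorem integrableOn_Ioo_comp_neg {F : ℝ → ℝ} {a b : ℝ} (h : IntegrableOn F (Ioo a b)) :
    IntegrableOn (fun s => F (-s)) (Ioo (-b) (-a)) := by
  have := (Measure.measurePreserving_neg (volume : Measure ℝ)).integrableOn_comp_preimage
    (MeasurableEquiv.neg ℝ).measurableEmbedding (f := F) (s := Ioo a b)
  have e : Neg.neg ⁻¹' Ioo a b = Ioo (-b) (-a) := by
    ext x
    simp only [mem_Ioo, mem_preimage]
    constructor <;> rintro ⟨h1, h2⟩ <;> constructor <;> linarith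
  rw [e] at this
  exact this.2 h

theorem ConcaveOn.comp_neg_Ioo {x0 x1 : ℝ} {ψ : ℝ → ℝ} (h : ConcaveOn ℝ (Ioo x0 x1) ψ) :
    ConcaveOn ℝ (Ioo (-x1) (-x0)) fun s => ψ (-s) := by
  have e : ⇑(-LinearMap.id : ℝ →ₗ[ℝ] ℝ) ⁻¹' Ioo x0 x1 = Ioo (-x1) (-x0) := by
    ext x
    simp only [mem_Ioo, mem_preimage, LinearMap.neg_apply, LinearMap.id_apply]
    constructor <;> rintro ⟨h1, h2⟩ <;> constructor <;> linarith
  rw [← e]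
  exact h.comp_linearMap (-LinearMap.id)

/-- Weighted one-dimensional Poincaré inequality on an interval whose length is adapted to `lam`,
with a length surplus when the weight decays exponentially near the right end point. -/
theorem poincare_Ioo_of_length {p lam ε y1 ρ x0 x1 : ℝ} {ψ v v' : ℝ → ℝ} (hp : 1 < p)
    (hl : 0 < lam) (hψ : ConcaveOn ℝ (Ioo x0 x1) ψ)
    (hfi : IntegrableOn (fun s => Real.exp (ψ s)) (Ioo x0 x1))
    (hy1 : 0 < y1) (hε : 0 ≤ ε)
    (hlen : x1 - x0 = piP p * lam ^ (-(1 / p)) + ε * ∫ y in Ioi (0 : ℝ), riccatiBump y1 y)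
    (hterm : ε = 0 ∨ (AntitoneOn (fun t => ψ t + t) (Ioo (x1 - ρ) x1) ∧
      y1 * (2 / lam + ε * y1 ^ 3) < ρ ∧ ε * y1 * riccatiA p lam y1 ^ 3 ≤ 1))
    (hv : ∀ s, HasDerivAt v (v' s) s) (hv' : Continuous v') :
    ∃ z ∈ Ioo x0 x1, lam * ∫ s in Ioo x0 x1, Real.exp (ψ s) * |v s - v z| ^ p ≤
      ∫ s in Ioo x0 x1, Real.exp (ψ s) * |v' s| ^ p := by
  have hb := integral_riccatiBump_pos hy1
  obtain ⟨κ, h1, h2⟩ := exists_balanced_slope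
    (Z := fun κ => x0 + ∫ y in Ioi (0 : ℝ), riccatiKernel p lam (-κ) y) hψ
    (continuous_const.add ((continuous_integral_riccatiKernel hp hl).comp continuous_neg))
    (fun a b hab => by
      have := antitone_integral_riccatiKernel hp hl (neg_le_neg hab)
      simpa using this)
    (fun κ => by
      have k1 := integral_riccatiKernel_pos hp hl κ
      have k2 := integral_riccatiKernel_pos hp hl (-κ)
      have k3 := integral_riccatiKernel_add_neg hp hl κ
      have k4 : 0 ≤ ε * ∫ y in Ioi (0 : ℝ), riccatiBump y1 y := by positivity
      exact ⟨by linarith, by linarith⟩)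
  set z := x0 + ∫ y in Ioi (0 : ℝ), riccatiKernel p lam (-κ) y with hz
  have k1 := integral_riccatiKernel_pos hp hl κ
  have k2 := integral_riccatiKernel_pos hp hl (-κ)
  have k3 := integral_riccatiKernel_add_neg hp hl κ
  have k4 : 0 ≤ ε * ∫ y in Ioi (0 : ℝ), riccatiBump y1 y := by positivity
  have hzm : z ∈ Ioo x0 x1 := ⟨by linarith, by linarith⟩
  refine ⟨z, hzm, ?_⟩
  have hr := dirichlet_neumann_right hp hl hψ hfi hzm hy1 hε (by linarith) h1 hterm hv hv'
  have hl' := dirichlet_neumann_right (x0 := -x1) (x1 := -x0) (z := -z) (κ := -κ) (ε := 0)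
    (y1 := y1) (ρ := ρ) (v := fun s => v (-s)) (v' := fun s => -v' (-s)) hp hl hψ.comp_neg_Ioo
    (integrableOn_Ioo_comp_neg hfi) ⟨by linarith [hzm.2], by linarith [hzm.1]⟩ hy1 le_rfl
    (by rw [hz]; ring) (by
      intro a ha b hb hab
      have := h2 (a := -b) (b := -a) ⟨by linarith [hb.2], by linarith [hb.1]⟩
        ⟨by linarith [ha.2], by linarith [ha.1]⟩ (by linarith)
      simp only at this ⊢
      linarith) (Or.inl rfl) (by
      intro s
      have := (hv (-s)).comp s (hasDerivAt_neg s)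
      rwa [mul_neg_one] at this) (hv'.comp continuous_neg).neg
  rw [integral_Ioo_comp_neg (fun s => Real.exp (ψ s) * |v s - v (- -z)| ^ p) x0 z] at hl'
  simp only [abs_neg, neg_neg] at hl'
  rw [integral_Ioo_comp_neg (fun s => Real.exp (ψ s) * |v' s| ^ p) x0 z] at hl'
  have hvc : Continuous v := continuous_iff_continuousAt.2 fun x => (hv x).continuousAt
  have hi1 : ∀ h : ℝ → ℝ, Continuous h →
      IntegrableOn (fun s => Real.exp (ψ s) * |h s| ^ p) (Ioo x0 x1) := by
    intro h hh
    have hc : Continuous fun s => |h s| ^ p :=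
      hh.abs.rpow_const fun _ => Or.inr (by linarith)
    obtain ⟨B, hB⟩ := (isCompact_Icc (a := x0) (b := x1)).exists_bound_of_continuousOn hc.continuousOn
    refine hfi.mul_bdd (c := B) hc.aestronglyMeasurable ?_
    filter_upwards [self_mem_ae_restrict measurableSet_Ioo] with x hx
    exact hB x (Ioo_subset_Icc_self hx)
  have hsplit : ∀ F : ℝ → ℝ, IntegrableOn F (Ioo x0 x1) →
      ∫ s in Ioo x0 x1, F s = (∫ s in Ioo x0 z, F s) + ∫ s in Ioo z x1, F s := by
    intro F hF
    rw [← integral_Ioc_eq_integral_Ioo (x := x0) (y := z), ← setIntegral_union ?_ measurableSet_Ioo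
      (hF.mono_set ?_) (hF.mono_set ?_), Ioc_union_Ioo_eq_Ioo hzm.1.le hzm.2]
    · exact Set.disjoint_left.2 fun x hx hx' => absurd hx.2 (not_le.2 hx'.1)
    · exact Ioc_subset_Ioo_right hzm.2
    · exact Ioo_subset_Ioo_left hzm.1.le
  rw [hsplit _ (hi1 _ hv'), hsplit _ (hi1 (fun s => v s - v z) (hvc.sub continuous_const)), mul_add]
  linarith

theorem piP_pos {p : ℝ} (hp : 1 < p) : 0 < piP p := by
  have hs : 0 < Real.sin (Real.pi / p) := Real.sin_pos_of_pos_of_lt_pi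
    (div_pos Real.pi_pos (by linarith)) (div_lt_self Real.pi_pos hp)
  have : 0 < p - 1 := by linarith
  have := Real.pi_pos
  unfold piP
  positivity

theorem piP_mul_rpow {p ℓ : ℝ} (hp : 1 < p) (hℓ : 0 < ℓ) :
    piP p * ((piP p / ℓ) ^ p) ^ (-(1 / p)) = ℓ := by
  have h := piP_pos hp
  rw [← Real.rpow_mul (by positivity), show p * -(1 / p) = -1 by field_simp, Real.rpow_neg_one]
  field_simp

theorem poincare_Ioo {p x0 x1 : ℝ} {ψ v v' : ℝ → ℝ} (hp : 1 < p) (hx : x0 < x1)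
    (hψ : ConcaveOn ℝ (Ioo x0 x1) ψ)
    (hfi : IntegrableOn (fun s => Real.exp (ψ s)) (Ioo x0 x1))
    (hv : ∀ s, HasDerivAt v (v' s) s) (hv' : Continuous v') :
    ∃ z ∈ Ioo x0 x1, (piP p / (x1 - x0)) ^ p *
      ∫ s in Ioo x0 x1, Real.exp (ψ s) * |v s - v z| ^ p ≤
      ∫ s in Ioo x0 x1, Real.exp (ψ s) * |v' s| ^ p := by
  have h := piP_pos hp
  have hl : 0 < x1 - x0 := by linarith
  exact poincare_Ioo_of_length (ε := 0) (y1 := 1) (ρ := 0) hp (by positivity) hψ hfi one_pos le_rfl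
    (by rw [piP_mul_rpow hp hl]; ring) (Or.inl rfl) hv hv'

theorem exists_surplus {p ρ : ℝ} (hp : 1 < p) (hρ : 0 < ρ) :
    ∃ τ : ℝ, 0 < τ ∧ τ ≤ 1 / 4 ∧ ∀ (x0 x1 : ℝ) (ψ v v' : ℝ → ℝ), 1 / 2 ≤ x1 - x0 → x1 - x0 ≤ 2 →
      ConcaveOn ℝ (Ioo x0 x1) ψ → IntegrableOn (fun s => Real.exp (ψ s)) (Ioo x0 x1) →
      (AntitoneOn (fun t => ψ t + t) (Ioo (x1 - ρ) x1) ∨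
        MonotoneOn (fun t => ψ t - t) (Ioo x0 (x0 + ρ))) →
      (∀ s, HasDerivAt v (v' s) s) → Continuous v' →
      ∃ z ∈ Ioo x0 x1, (piP p / (x1 - x0 - τ)) ^ p *
        ∫ s in Ioo x0 x1, Real.exp (ψ s) * |v s - v z| ^ p ≤
        ∫ s in Ioo x0 x1, Real.exp (ψ s) * |v' s| ^ p := by
  have hπ := piP_pos hp
  have hp0 : 0 < p - 1 := by linarith
  set l0 := (piP p / 2) ^ p with hl0
  set l1 := (piP p / (1 / 4)) ^ p with hl1
  have hl0p : 0 < l0 := by positivity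
  have hl1p : 0 < l1 := by positivity
  set y1 := min 1 (ρ / (2 * (2 / l0 + 1))) with hy1
  have hy1p : 0 < y1 := by positivity
  have hy1le : y1 ≤ 1 := min_le_left _ _
  have hy1ρ : y1 * (2 / l0 + 1) < ρ := by
    have : y1 ≤ ρ / (2 * (2 / l0 + 1)) := min_le_right _ _
    calc y1 * (2 / l0 + 1) ≤ ρ / (2 * (2 / l0 + 1)) * (2 / l0 + 1) := by gcongr
      _ = ρ / 2 := by field_simp
      _ < ρ := by linarith
  set b := ∫ y in Ioi (0 : ℝ), riccatiBump y1 y with hb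
  have hbp : 0 < b := integral_riccatiBump_pos hy1p
  have hA1 := riccatiA_pos hp hl1p hy1p.le
  set ε := min 1 (min (1 / (4 * b)) (1 / (y1 * riccatiA p l1 y1 ^ 3))) with hε
  have hεp : 0 < ε := by positivity
  have hε1 : ε ≤ 1 := min_le_left _ _
  have hεb : ε * b ≤ 1 / 4 := by
    have : ε ≤ 1 / (4 * b) := (min_le_right _ _).trans (min_le_left _ _)
    calc ε * b ≤ 1 / (4 * b) * b := by gcongr
      _ = 1 / 4 := by field_simp
  have hεA : ε * y1 * riccatiA p l1 y1 ^ 3 ≤ 1 := by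
    have : ε ≤ 1 / (y1 * riccatiA p l1 y1 ^ 3) := (min_le_right _ _).trans (min_le_right _ _)
    rw [le_div_iff₀ (by positivity)] at this
    linarith
  have hright : ∀ (x0 x1 : ℝ) (ψ v v' : ℝ → ℝ), 1 / 2 ≤ x1 - x0 → x1 - x0 ≤ 2 →
      ConcaveOn ℝ (Ioo x0 x1) ψ → IntegrableOn (fun s => Real.exp (ψ s)) (Ioo x0 x1) →
      AntitoneOn (fun t => ψ t + t) (Ioo (x1 - ρ) x1) →
      (∀ s, HasDerivAt v (v' s) s) → Continuous v' →
      ∃ z ∈ Ioo x0 x1, (piP p / (x1 - x0 - ε * b)) ^ p *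
        ∫ s in Ioo x0 x1, Real.exp (ψ s) * |v s - v z| ^ p ≤
        ∫ s in Ioo x0 x1, Real.exp (ψ s) * |v' s| ^ p := by
    intro x0 x1 ψ v v' h1 h2 hψ hfi ha hv hv'
    have hm : 1 / 4 ≤ x1 - x0 - ε * b := by linarith
    have hm2 : x1 - x0 - ε * b ≤ 2 := by nlinarith
    have hm0 : 0 < x1 - x0 - ε * b := by linarith
    set lam := (piP p / (x1 - x0 - ε * b)) ^ p with hlam
    have hla : l0 ≤ lam := by rw [hl0, hlam]; gcongr
    have hlb : lam ≤ l1 := by rw [hl1, hlam]; gcongr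
    have hlp : 0 < lam := by positivity
    refine poincare_Ioo_of_length (ε := ε) (y1 := y1) (ρ := ρ) hp hlp hψ hfi hy1p hεp.le
      (by rw [hlam, piP_mul_rpow hp hm0]; ring) (Or.inr ⟨ha, ?_, ?_⟩) hv hv'
    · refine lt_of_le_of_lt ?_ hy1ρ
      have : ε * y1 ^ 3 ≤ 1 := mul_le_one₀ hε1 (by positivity) (pow_le_one₀ hy1p.le hy1le)
      gcongr
    · refine le_trans ?_ hεA
      have hA := riccatiA_pos hp hlp hy1p.le
      have : riccatiA p lam y1 ≤ riccatiA p l1 y1 := by unfold riccatiA; gcongr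
      gcongr
  refine ⟨ε * b, by positivity, hεb, ?_⟩
  intro x0 x1 ψ v v' h1 h2 hψ hfi hor hv hv'
  rcases hor with ha | ha
  · exact hright x0 x1 ψ v v' h1 h2 hψ hfi ha hv hv'
  · obtain ⟨z, hz, hle⟩ := hright (-x1) (-x0) (fun s => ψ (-s)) (fun s => v (-s))
      (fun s => -v' (-s)) (by linarith) (by linarith) hψ.comp_neg_Ioo
      (integrableOn_Ioo_comp_neg hfi) (by
        intro a haa c hc hac
        have := ha (a := -c) (b := -a) ⟨by linarith [hc.2], by linarith [hc.1]⟩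
          ⟨by linarith [haa.2], by linarith [haa.1]⟩ (by linarith)
        simp only at this ⊢
        linarith) (by
        intro s
        have := (hv (-s)).comp s (hasDerivAt_neg s)
        rwa [mul_neg_one] at this) (hv'.comp continuous_neg).neg
    refine ⟨-z, ⟨by linarith [hz.2], by linarith [hz.1]⟩, ?_⟩
    simp only [abs_neg] at hle
    rw [integral_Ioo_comp_neg (fun s => Real.exp (ψ s) * |v s - v (-z)| ^ p) x0 x1,
      integral_Ioo_comp_neg (fun s => Real.exp (ψ s) * |v' s| ^ p) x0 x1,
      show -x0 - -x1 - ε * b = x1 - x0 - ε * b by ring] at hle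
    exact hle

theorem abs_rpow_le_add_integral {p a b : ℝ} {v v' : ℝ → ℝ} (hp : 1 < p)
    (hv : ∀ s, HasDerivAt v (v' s) s) (hv' : Continuous v') {s t : ℝ} (hs : s ∈ Icc a b)
    (ht : t ∈ Icc a b) :
    |v s| ^ p ≤ |v t| ^ p + ∫ r in Ioo a b, ((p - 1) * |v r| ^ p + |v' r| ^ p) := by
  have hvc : Continuous v := continuous_iff_continuousAt.2 fun x => (hv x).continuousAt
  have hp0 : 0 < p - 1 := by linarith
  have hpow : ∀ h : ℝ → ℝ, Continuous h → Continuous fun r => |h r| ^ p := fun h hh =>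
    hh.abs.rpow_const fun _ => Or.inr (by linarith)
  set D : ℝ → ℝ := fun r => p * |v r| ^ (p - 2) * v r * v' r with hD
  set B : ℝ → ℝ := fun r => (p - 1) * |v r| ^ p + |v' r| ^ p with hB
  have hBc : Continuous B := (continuous_const.mul (hpow v hvc)).add (hpow v' hv')
  have hd : ∀ r, HasDerivAt (fun r => |v r| ^ p) (D r) r := fun r =>
    (hasDerivAt_abs_rpow (v r) hp).comp r (hv r)
  have hDB : ∀ r, |D r| ≤ B r := by
    intro r
    have h1 := young_mul hp (abs_nonneg (v' r)) (Real.rpow_nonneg (abs_nonneg (v r)) (p - 1))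
    rw [← Real.rpow_mul (abs_nonneg _), mul_div_cancel₀ _ hp0.ne'] at h1
    have h2 : |D r| = p * (|v' r| * |v r| ^ (p - 1)) := by
      simp only [hD]
      rw [abs_mul, abs_mul, abs_mul, abs_of_pos (show 0 < p by linarith),
        abs_of_nonneg (Real.rpow_nonneg (abs_nonneg (v r)) (p - 2))]
      by_cases h0 : v r = 0
      · simp [h0, Real.zero_rpow hp0.ne']
      · rw [show p - 1 = (p - 2) + 1 by ring, Real.rpow_add_one (abs_pos.2 h0).ne']
        ring
    rw [h2]
    simp only [hB]
    linarith
  have hBi : ∀ x y, IntervalIntegrable B volume x y := fun x y => hBc.intervalIntegrable x y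
  have key : ∀ x y, x ≤ y → |(|v y| ^ p - |v x| ^ p)| ≤ ∫ r in x..y, B r := by
    intro x y hxy
    have h1 : |v y| ^ p - |v x| ^ p ≤ ∫ r in x..y, B r :=
      intervalIntegral.sub_le_integral_of_hasDeriv_right_of_le hxy (hpow v hvc).continuousOn
        (fun r _ => (hd r).hasDerivWithinAt) hBc.continuousOn.integrableOn_Icc
        fun r _ => (le_abs_self _).trans (hDB r)
    have h2 : -|v y| ^ p - -|v x| ^ p ≤ ∫ r in x..y, B r :=
      intervalIntegral.sub_le_integral_of_hasDeriv_right_of_le hxy (hpow v hvc).neg.continuousOn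
        (fun r _ => (hd r).neg.hasDerivWithinAt) hBc.continuousOn.integrableOn_Icc
        fun r _ => (neg_le_abs _).trans (hDB r)
    exact abs_le.2 ⟨by linarith, h1⟩
  have hmono : ∀ x ∈ Icc a b, ∀ y ∈ Icc a b, x ≤ y →
      ∫ r in x..y, B r ≤ ∫ r in Ioo a b, B r := by
    intro x hx y hy hxy
    rw [intervalIntegral.integral_of_le hxy, integral_Ioc_eq_integral_Ioo]
    refine setIntegral_mono_set (hBc.continuousOn.integrableOn_Icc.mono_set Ioo_subset_Icc_self)
      (Eventually.of_forall fun r => (abs_nonneg _).trans (hDB r))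
      (Ioo_subset_Ioo hx.1 hy.2).eventuallyLE
  rcases le_total s t with h | h
  · have h1 := (abs_le.1 (key s t h)).1
    have h2 := hmono s hs t ht h
    linarith
  · have h1 := (abs_le.1 (key t s h)).2
    have h2 := hmono t ht s hs h
    linarith

/-- Pointwise control of a weighted function by its integral over an adjacent interval. -/
theorem weight_mul_abs_rpow_le {p a d W : ℝ} {w v v' : ℝ → ℝ} (hp : 1 < p) (hd : 0 < d)
    (hd1 : d ≤ 1) (hW : 0 ≤ W) (hw : ∀ t ∈ Ioo a (a + d), W ≤ w t)
    (hwi : IntegrableOn w (Ioo a (a + d)))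
    (hv : ∀ s, HasDerivAt v (v' s) s) (hv' : Continuous v') {s : ℝ} (hs : s ∈ Icc a (a + d)) :
    W * |v s| ^ p ≤ p / d * ∫ t in Ioo a (a + d), w t * (|v t| ^ p + |v' t| ^ p) := by
  have hvc : Continuous v := continuous_iff_continuousAt.2 fun x => (hv x).continuousAt
  have hpow : ∀ h : ℝ → ℝ, Continuous h → Continuous fun r => |h r| ^ p := fun h hh =>
    hh.abs.rpow_const fun _ => Or.inr (by linarith)
  have hic : ∀ h : ℝ → ℝ, Continuous h → IntegrableOn h (Ioo a (a + d)) := fun h hh =>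
    hh.continuousOn.integrableOn_Icc.mono_set Ioo_subset_Icc_self
  set I1 := ∫ t in Ioo a (a + d), |v t| ^ p with hI1
  set I2 := ∫ t in Ioo a (a + d), |v' t| ^ p with hI2
  have hI1n : 0 ≤ I1 := setIntegral_nonneg measurableSet_Ioo fun _ _ => by positivity
  have hI2n : 0 ≤ I2 := setIntegral_nonneg measurableSet_Ioo fun _ _ => by positivity
  have h1 : d * |v s| ^ p ≤ I1 + d * ((p - 1) * I1 + I2) := by
    have hI : ∫ t in Ioo a (a + d), |v s| ^ p ≤
        ∫ t in Ioo a (a + d), (|v t| ^ p + ((p - 1) * I1 + I2)) := by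
      refine setIntegral_mono_on (hic _ continuous_const) (hic _ ((hpow v hvc).add continuous_const))
        measurableSet_Ioo fun t ht => ?_
      have := abs_rpow_le_add_integral hp hv hv' hs (Ioo_subset_Icc_self ht)
      rwa [integral_add ((hic _ (hpow v hvc)).const_mul (p - 1)) (hic _ (hpow v' hv')),
        integral_const_mul] at this
    rw [integral_add (hic _ (hpow v hvc)) (hic _ continuous_const)] at hI
    simpa [hd.le] using hI
  have h2 : |v s| ^ p ≤ p / d * (I1 + I2) := by
    rw [div_mul_eq_mul_div, le_div_iff₀ hd]
    nlinarith [mul_nonneg hI1n (sub_nonneg.2 hd1), mul_nonneg hI2n (sub_nonneg.2 hd1),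
      mul_nonneg hI2n hd.le]
  have h3 : W * (I1 + I2) ≤ ∫ t in Ioo a (a + d), w t * (|v t| ^ p + |v' t| ^ p) := by
    rw [hI1, hI2, ← integral_add (hic _ (hpow v hvc)) (hic _ (hpow v' hv')), ← integral_const_mul]
    have hc : Continuous fun t => |v t| ^ p + |v' t| ^ p := (hpow v hvc).add (hpow v' hv')
    obtain ⟨B, hB⟩ := (isCompact_Icc (a := a) (b := a + d)).exists_bound_of_continuousOn
      hc.continuousOn
    refine setIntegral_mono_on ((hic _ hc).const_mul W) (hwi.mul_bdd (c := B)
      hc.aestronglyMeasurable ?_) measurableSet_Ioo fun t ht => ?_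
    · filter_upwards [self_mem_ae_restrict measurableSet_Ioo] with x hx
      exact hB x (Ioo_subset_Icc_self hx)
    · exact mul_le_mul_of_nonneg_right (hw t ht) (by positivity)
  calc W * |v s| ^ p ≤ W * (p / d * (I1 + I2)) := by gcongr
    _ = p / d * (W * (I1 + I2)) := by ring
    _ ≤ _ := by
      have : 0 ≤ p / d := by positivity
      gcongr

/-- A bounded open convex planar set with a positive weight whose `m`-th root is concave. -/
structure WeightedConvex (m : ℕ) (C : Set (ℝ × ℝ)) (φ : ℝ × ℝ → ℝ) : Prop where
  m_pos : 0 < m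
  isOpen : IsOpen C
  convex : Convex ℝ C
  isBounded : Bornology.IsBounded C
  pos : ∀ z ∈ C, 0 < φ z
  concave : ConcaveOn ℝ C fun z => φ z ^ (1 / (m : ℝ))

namespace WeightedConvex

variable {m : ℕ} {C : Set (ℝ × ℝ)} {φ : ℝ × ℝ → ℝ}

theorem mono (h : WeightedConvex m C φ) {D : Set (ℝ × ℝ)} (hD : IsOpen D) (hc : Convex ℝ D)
    (hs : D ⊆ C) : WeightedConvex m D φ :=
  ⟨h.m_pos, hD, hc, h.isBounded.subset hs, fun z hz => h.pos z (hs hz), h.concave.subset hs hc⟩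

theorem root_pow (h : WeightedConvex m C φ) {z : ℝ × ℝ} (hz : z ∈ C) :
    (φ z ^ (1 / (m : ℝ))) ^ m = φ z := by
  rw [one_div]
  exact Real.rpow_inv_natCast_pow (h.pos z hz).le h.m_pos.ne'

theorem continuousOn (h : WeightedConvex m C φ) : ContinuousOn φ C :=
  ((h.concave.continuousOn h.isOpen).pow m).congr fun _ hz => (h.root_pow hz).symm

theorem half_pow_le (h : WeightedConvex m C φ) {z w : ℝ × ℝ} (hz : z ∈ C) (hw : w ∈ C) {a b : ℝ}
    (ha : 1 / 2 ≤ a) (hb : 0 ≤ b) (hab : a + b = 1) :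
    φ z ≤ 2 ^ m * φ (a • z + b • w) := by
  have hm := h.convex hz hw (by linarith) hb hab
  have h1 := h.concave.2 hz hw (by linarith) hb hab
  have h2 : 0 ≤ φ w ^ (1 / (m : ℝ)) := Real.rpow_nonneg (h.pos w hw).le _
  have h3 : 0 ≤ φ z ^ (1 / (m : ℝ)) := Real.rpow_nonneg (h.pos z hz).le _
  simp only [smul_eq_mul] at h1
  rw [← h.root_pow hz, ← h.root_pow hm, ← mul_pow]
  refine pow_le_pow_left₀ h3 ?_ m
  nlinarith [mul_nonneg hb h2]

theorem geom_le (h : WeightedConvex m C φ) {z w : ℝ × ℝ} (hz : z ∈ C) (hw : w ∈ C) {a b : ℝ}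
    (ha : 0 ≤ a) (hb : 0 ≤ b) (hab : a + b = 1) :
    φ z ^ a * φ w ^ b ≤ φ (a • z + b • w) := by
  have hm := h.convex hz hw ha hb hab
  have h1 := h.concave.2 hz hw ha hb hab
  have h2 : 0 ≤ φ w ^ (1 / (m : ℝ)) := Real.rpow_nonneg (h.pos w hw).le _
  have h3 : 0 ≤ φ z ^ (1 / (m : ℝ)) := Real.rpow_nonneg (h.pos z hz).le _
  have h4 := (Real.geom_mean_le_arith_mean2_weighted ha hb h3 h2 hab).trans h1
  have h5 := pow_le_pow_left₀ (by positivity) h4 m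
  rw [h.root_pow hm, mul_pow, ← Real.rpow_mul_natCast h3, mul_comm a, Real.rpow_natCast_mul h3,
    ← Real.rpow_mul_natCast h2, mul_comm b, Real.rpow_natCast_mul h2, h.root_pow hz,
    h.root_pow hw] at h5
  exact h5

theorem exists_bound (h : WeightedConvex m C φ) : ∃ B, 0 < B ∧ ∀ z ∈ C, φ z ≤ B := by
  rcases C.eq_empty_or_nonempty with rfl | ⟨z0, hz0⟩
  · exact ⟨1, one_pos, by simp⟩
  obtain ⟨δ, hδ, hball⟩ := Metric.isOpen_iff.1 h.isOpen z0 hz0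
  obtain ⟨R, hR0, hR⟩ := h.isBounded.subset_ball_lt 0 z0
  set κ := δ / (2 * R) with hκ
  have hκ0 : 0 < κ := by positivity
  have hκ1 : 0 < 1 + κ := by linarith
  refine ⟨(φ z0 ^ (1 / (m : ℝ)) * ((1 + κ) / κ)) ^ m, ?_, fun z hz => ?_⟩
  · have := Real.rpow_pos_of_pos (h.pos z0 hz0) (1 / (m : ℝ))
    positivity
  have hw : z0 - κ • (z - z0) ∈ C := by
    apply hball
    rw [Metric.mem_ball, dist_eq_norm, show z0 - κ • (z - z0) - z0 = -(κ • (z - z0)) by abel,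
      norm_neg, norm_smul, Real.norm_of_nonneg hκ0.le, ← dist_eq_norm]
    have h1 := Metric.mem_ball.1 (hR hz)
    calc κ * dist z z0 ≤ κ * R := by gcongr
      _ = δ / 2 := by rw [hκ]; field_simp
      _ < δ := by linarith
  have h1 := h.concave.2 hw hz (show 0 ≤ 1 / (1 + κ) by positivity)
    (show 0 ≤ κ / (1 + κ) by positivity) (by field_simp)
  rw [show (1 / (1 + κ)) • (z0 - κ • (z - z0)) + (κ / (1 + κ)) • z = z0 by
    ext <;> simp <;> field_simp <;> ring] at h1
  have h2 : 0 ≤ φ (z0 - κ • (z - z0)) ^ (1 / (m : ℝ)) := Real.rpow_nonneg (h.pos _ hw).le _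
  have h3 : 0 ≤ φ z ^ (1 / (m : ℝ)) := Real.rpow_nonneg (h.pos _ hz).le _
  rw [← h.root_pow hz]
  refine pow_le_pow_left₀ h3 ?_ m
  simp only [smul_eq_mul] at h1
  have h4 : κ / (1 + κ) * φ z ^ (1 / (m : ℝ)) ≤ φ z0 ^ (1 / (m : ℝ)) :=
    le_trans (by have := mul_nonneg (show 0 ≤ 1 / (1 + κ) by positivity) h2; linarith) h1
  rw [← mul_div_assoc, le_div_iff₀ hκ0]
  rw [div_mul_eq_mul_div, div_le_iff₀ hκ1] at h4
  linarith

theorem volume_lt_top (h : WeightedConvex m C φ) : volume C < ⊤ := h.isBounded.measure_lt_top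

theorem integrableOn_mul (h : WeightedConvex m C φ) {k : ℝ × ℝ → ℝ} (hk : Continuous k) :
    IntegrableOn (fun z => φ z * k z) C := by
  obtain ⟨B, hB0, hB⟩ := h.exists_bound
  obtain ⟨K, hK⟩ := (h.isBounded.isCompact_closure).exists_bound_of_continuousOn hk.continuousOn
  refine IntegrableOn.of_bound h.volume_lt_top
    ((h.continuousOn.mul hk.continuousOn).aestronglyMeasurable h.isOpen.measurableSet) (B * K) ?_
  filter_upwards [self_mem_ae_restrict h.isOpen.measurableSet] with z hz
  rw [norm_mul, Real.norm_of_nonneg (h.pos z hz).le]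
  exact mul_le_mul (hB z hz) (hK z (subset_closure hz)) (norm_nonneg _) hB0.le

theorem integrableOn (h : WeightedConvex m C φ) : IntegrableOn φ C := by
  simpa using h.integrableOn_mul (k := fun _ => 1) continuous_const

end WeightedConvex

/-- Slices of a bounded open convex planar set project onto an open interval. -/
theorem exists_fst_image_eq_Ioo {C : Set (ℝ × ℝ)} (ho : IsOpen C) (hc : Convex ℝ C)
    (hb : Bornology.IsBounded C) (hne : C.Nonempty) :
    ∃ x0 x1 : ℝ, x0 < x1 ∧ Prod.fst '' C = Ioo x0 x1 := by
  set S := Prod.fst '' C with hS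
  have hSo : IsOpen S := isOpenMap_fst _ ho
  have hSc : Convex ℝ S := hc.linear_image (LinearMap.fst ℝ ℝ ℝ)
  have hSb : Bornology.IsBounded S := hb.image_fst
  have hSn : S.Nonempty := hne.image _
  have hsub := IsConnected.Ioo_csInf_csSup_subset ⟨hSn, hSc.isPreconnected⟩ hSb.bddBelow hSb.bddAbove
  have hsup : S ⊆ Ioo (sInf S) (sSup S) := by
    have h1 : S ⊆ Icc (sInf S) (sSup S) := subset_Icc_csInf_csSup hSb.bddBelow hSb.bddAbove
    rw [← interior_Icc]
    exact hSo.subset_interior_iff.2 h1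
  obtain ⟨x, hx⟩ := hSn
  exact ⟨sInf S, sSup S, (hsup hx).1.trans (hsup hx).2, hsup.antisymm hsub⟩

theorem volume_add_le_of_ordConnected {A B S : Set ℝ} {a b : ℝ} (ha : 0 ≤ a) (hb : 0 ≤ b)
    (hS : S.OrdConnected) (hAn : A.Nonempty)
    (hBn : B.Nonempty) (hAb : Bornology.IsBounded A) (hBb : Bornology.IsBounded B)
    (h : ∀ x ∈ A, ∀ y ∈ B, a * x + b * y ∈ S) :
    ENNReal.ofReal a * volume A + ENNReal.ofReal b * volume B ≤ volume S := by
  have hAv : volume A ≤ ENNReal.ofReal (sSup A - sInf A) := by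
    rw [← Real.volume_Icc]
    exact measure_mono (subset_Icc_csInf_csSup hAb.bddBelow hAb.bddAbove)
  have hBv : volume B ≤ ENNReal.ofReal (sSup B - sInf B) := by
    rw [← Real.volume_Icc]
    exact measure_mono (subset_Icc_csInf_csSup hBb.bddBelow hBb.bddAbove)
  have hA0 : 0 ≤ sSup A - sInf A := by
    have := Real.sInf_le_sSup A hAb.bddBelow hAb.bddAbove
    linarith
  have hB0 : 0 ≤ sSup B - sInf B := by
    have := Real.sInf_le_sSup B hBb.bddBelow hBb.bddAbove
    linarith
  have hsub : Ioo (a * sInf A + b * sInf B) (a * sSup A + b * sSup B) ⊆ S := by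
    rintro x ⟨hx1, hx2⟩
    have e1 : ∃ δ > 0, a * (sInf A + δ) + b * (sInf B + δ) < x := by
      refine ⟨(x - (a * sInf A + b * sInf B)) / (2 * (a + b + 1)), by
        apply div_pos <;> linarith, ?_⟩
      have : (a + b) * ((x - (a * sInf A + b * sInf B)) / (2 * (a + b + 1))) <
          x - (a * sInf A + b * sInf B) := by
        rw [mul_div_assoc', div_lt_iff₀ (by linarith)]
        nlinarith
      nlinarith
    have e2 : ∃ δ > 0, x < a * (sSup A - δ) + b * (sSup B - δ) := by
      refine ⟨((a * sSup A + b * sSup B) - x) / (2 * (a + b + 1)), by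
        apply div_pos <;> linarith, ?_⟩
      have : (a + b) * (((a * sSup A + b * sSup B) - x) / (2 * (a + b + 1))) <
          (a * sSup A + b * sSup B) - x := by
        rw [mul_div_assoc', div_lt_iff₀ (by linarith)]
        nlinarith
      nlinarith
    obtain ⟨δ, hδ, h1⟩ := e1
    obtain ⟨δ', hδ', h2⟩ := e2
    obtain ⟨u, hu, hu'⟩ := exists_lt_of_csInf_lt hAn (show sInf A < sInf A + δ by linarith)
    obtain ⟨v, hv, hv'⟩ := exists_lt_of_csInf_lt hBn (show sInf B < sInf B + δ by linarith)
    obtain ⟨s, hs, hs'⟩ := exists_lt_of_lt_csSup hAn (show sSup A - δ' < sSup A by linarith)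
    obtain ⟨t, ht, ht'⟩ := exists_lt_of_lt_csSup hBn (show sSup B - δ' < sSup B by linarith)
    refine hS.out (h u hu v hv) (h s hs t ht) ⟨?_, ?_⟩
    · nlinarith [mul_le_mul_of_nonneg_left hu'.le ha, mul_le_mul_of_nonneg_left hv'.le hb]
    · nlinarith [mul_le_mul_of_nonneg_left hs'.le ha, mul_le_mul_of_nonneg_left ht'.le hb]
  calc ENNReal.ofReal a * volume A + ENNReal.ofReal b * volume B
      ≤ ENNReal.ofReal a * ENNReal.ofReal (sSup A - sInf A) +
        ENNReal.ofReal b * ENNReal.ofReal (sSup B - sInf B) := by gcongr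
    _ = ENNReal.ofReal (a * sSup A + b * sSup B - (a * sInf A + b * sInf B)) := by
      rw [← ENNReal.ofReal_mul ha, ← ENNReal.ofReal_mul hb,
        ← ENNReal.ofReal_add (by positivity) (by positivity)]
      congr 1
      ring
    _ = volume (Ioo (a * sInf A + b * sInf B) (a * sSup A + b * sSup B)) := by
      rw [Real.volume_Ioo]
    _ ≤ volume S := measure_mono hsub

/-- Vertical slice of a planar set. -/
def slice (C : Set (ℝ × ℝ)) (x : ℝ) : Set ℝ := {y | (x, y) ∈ C}

/-- Integral of a weight along vertical slices. -/
noncomputable def marginal (C : Set (ℝ × ℝ)) (φ : ℝ × ℝ → ℝ) (x : ℝ) : ℝ :=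
  ∫ y in slice C x, φ (x, y)

theorem isOpen_slice {C : Set (ℝ × ℝ)} (h : IsOpen C) (x : ℝ) : IsOpen (slice C x) :=
  h.preimage (by fun_prop : Continuous fun y : ℝ => (x, y))

theorem slice_nonempty_iff {C : Set (ℝ × ℝ)} {x : ℝ} :
    (slice C x).Nonempty ↔ x ∈ Prod.fst '' C := by
  constructor
  · rintro ⟨y, hy⟩
    exact ⟨(x, y), hy, rfl⟩
  · rintro ⟨⟨x', y⟩, hy, rfl⟩
    exact ⟨y, hy⟩

theorem slice_eq_empty {C : Set (ℝ × ℝ)} {x : ℝ} (h : x ∉ Prod.fst '' C) : slice C x = ∅ :=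
  not_nonempty_iff_eq_empty.1 fun h' => h (slice_nonempty_iff.1 h')

theorem isBounded_slice {C : Set (ℝ × ℝ)} (h : Bornology.IsBounded C) (x : ℝ) :
    Bornology.IsBounded (slice C x) :=
  h.image_snd.subset fun y hy => ⟨(x, y), hy, rfl⟩

theorem convex_combo_mem_slice {C : Set (ℝ × ℝ)} (h : Convex ℝ C) {x x' y y' a b : ℝ}
    (hy : y ∈ slice C x) (hy' : y' ∈ slice C x') (ha : 0 ≤ a) (hb : 0 ≤ b) (hab : a + b = 1) :
    a * y + b * y' ∈ slice C (a * x + b * x') := h hy hy' ha hb hab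

theorem exists_combo_of_mem_Icc {y y' z : ℝ} (hz : z ∈ Icc y y') :
    ∃ a b : ℝ, 0 ≤ a ∧ 0 ≤ b ∧ a + b = 1 ∧ a * y + b * y' = z := by
  rw [← segment_eq_Icc (hz.1.trans hz.2)] at hz
  obtain ⟨a, b, ha, hb, hab, h⟩ := hz
  exact ⟨a, b, ha, hb, hab, h⟩

theorem ordConnected_slice {C : Set (ℝ × ℝ)} (h : Convex ℝ C) (x : ℝ) :
    (slice C x).OrdConnected := by
  refine ⟨fun y hy y' hy' z hz => ?_⟩
  obtain ⟨a, b, ha, hb, hab, rfl⟩ := exists_combo_of_mem_Icc hz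
  have := convex_combo_mem_slice h hy hy' ha hb hab
  rwa [← add_mul, hab, one_mul] at this

theorem measurableSet_slice {C : Set (ℝ × ℝ)} (hC : MeasurableSet C) (x : ℝ) :
    MeasurableSet (slice C x) :=
  hC.preimage (by fun_prop : Measurable fun y : ℝ => (x, y))

theorem setIntegral_eq_integral_slice {C : Set (ℝ × ℝ)} (hC : MeasurableSet C) {F : ℝ × ℝ → ℝ}
    (hF : IntegrableOn F C) :
    ∫ z in C, F z = ∫ x, ∫ y in slice C x, F (x, y) := by
  rw [← integral_indicator hC, Measure.volume_eq_prod,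
    integral_prod _ ((integrable_indicator_iff hC).2 hF)]
  congr 1
  ext x
  rw [← integral_indicator (measurableSet_slice hC x)]
  rfl

theorem setIntegral_eq_integral_slice_Ioo {C : Set (ℝ × ℝ)} (hC : MeasurableSet C)
    {F : ℝ × ℝ → ℝ} (hF : IntegrableOn F C) {x0 x1 : ℝ} (hx : Prod.fst '' C = Ioo x0 x1) :
    ∫ z in C, F z = ∫ x in Ioo x0 x1, ∫ y in slice C x, F (x, y) := by
  rw [setIntegral_eq_integral_slice hC hF, setIntegral_eq_integral_of_forall_compl_eq_zero]
  intro x hx'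
  rw [slice_eq_empty (by rwa [hx])]
  simp

theorem integrable_integral_slice {C : Set (ℝ × ℝ)} (hC : MeasurableSet C)
    {F : ℝ × ℝ → ℝ} (hF : IntegrableOn F C) :
    Integrable fun x => ∫ y in slice C x, F (x, y) := by
  have h1 : Integrable (C.indicator F) ((volume : Measure ℝ).prod volume) :=
    (integrable_indicator_iff hC).2 hF
  refine h1.integral_prod_left.congr (Eventually.of_forall fun x => ?_)
  simp only
  rw [← integral_indicator (measurableSet_slice hC x)]
  rfl

namespace WeightedConvex

variable {m : ℕ} {C : Set (ℝ × ℝ)} {φ : ℝ × ℝ → ℝ}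

theorem measurableSet_slice (h : WeightedConvex m C φ) (x : ℝ) : MeasurableSet (slice C x) :=
  (isOpen_slice h.isOpen x).measurableSet

theorem volume_slice_lt_top (h : WeightedConvex m C φ) (x : ℝ) : volume (slice C x) < ⊤ :=
  (isBounded_slice h.isBounded x).measure_lt_top

theorem continuousOn_slice (h : WeightedConvex m C φ) (x : ℝ) :
    ContinuousOn (fun y => φ (x, y)) (slice C x) :=
  h.continuousOn.comp (by fun_prop) fun _ hy => hy

theorem integrableOn_slice_mul (h : WeightedConvex m C φ) {k : ℝ → ℝ} (hk : Continuous k)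
    (x : ℝ) : IntegrableOn (fun y => φ (x, y) * k y) (slice C x) := by
  obtain ⟨B, hB0, hB⟩ := h.exists_bound
  obtain ⟨K, hK⟩ := ((isBounded_slice h.isBounded x).isCompact_closure).exists_bound_of_continuousOn
    hk.continuousOn
  refine IntegrableOn.of_bound (h.volume_slice_lt_top x)
    (((h.continuousOn_slice x).mul hk.continuousOn).aestronglyMeasurable
      (h.measurableSet_slice x)) (B * K) ?_
  filter_upwards [self_mem_ae_restrict (h.measurableSet_slice x)] with y hy
  rw [norm_mul, Real.norm_of_nonneg (h.pos _ hy).le]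
  exact mul_le_mul (hB _ hy) (hK y (subset_closure hy)) (norm_nonneg _) hB0.le

theorem integrableOn_slice (h : WeightedConvex m C φ) (x : ℝ) :
    IntegrableOn (fun y => φ (x, y)) (slice C x) := by
  simpa using h.integrableOn_slice_mul (k := fun _ => 1) continuous_const x

theorem marginal_pos (h : WeightedConvex m C φ) {x : ℝ} (hx : x ∈ Prod.fst '' C) :
    0 < marginal C φ x := by
  rw [marginal, setIntegral_pos_iff_support_of_nonneg_ae]
  · have hs : slice C x ⊆ Function.support fun y => φ (x, y) := fun y hy =>
      (h.pos _ hy).ne'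
    rw [inter_eq_self_of_subset_right hs]
    exact (isOpen_slice h.isOpen x).measure_pos _ (slice_nonempty_iff.2 hx)
  · filter_upwards [self_mem_ae_restrict (h.measurableSet_slice x)] with y hy
    exact (h.pos _ hy).le
  · exact h.integrableOn_slice x

theorem ordConnected_superlevel (h : WeightedConvex m C φ) (x c : ℝ) :
    ({y | c < φ (x, y)} ∩ slice C x).OrdConnected := by
  refine ⟨fun y hy y' hy' z hz => ?_⟩
  have hz' := (ordConnected_slice h.convex x).out hy.2 hy'.2 hz
  refine ⟨?_, hz'⟩
  obtain ⟨a, b, ha, hb, hab, rfl⟩ := exists_combo_of_mem_Icc hz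
  have h1 := h.geom_le hy.2 hy'.2 ha hb hab
  simp only [Prod.smul_mk, Prod.mk_add_mk, smul_eq_mul, ← add_mul, hab, one_mul] at h1
  refine lt_of_lt_of_le ?_ h1
  have h2 : 0 < min (φ (x, y)) (φ (x, y')) := lt_min (h.pos _ hy.2) (h.pos _ hy'.2)
  calc c < min (φ (x, y)) (φ (x, y')) := lt_min hy.1 hy'.1
    _ = min (φ (x, y)) (φ (x, y')) ^ a * min (φ (x, y)) (φ (x, y')) ^ b := by
      rw [← Real.rpow_add h2, hab, Real.rpow_one]
    _ ≤ _ := by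
      exact mul_le_mul (Real.rpow_le_rpow h2.le (min_le_left _ _) ha)
        (Real.rpow_le_rpow h2.le (min_le_right _ _) hb) (Real.rpow_nonneg h2.le _)
        (Real.rpow_nonneg (h.pos _ hy.2).le _)

theorem lintegral_slice_div (h : WeightedConvex m C φ) {G : ℝ} (hG : 0 < G) (x : ℝ) :
    ENNReal.ofReal (marginal C φ x / G) =
      ∫⁻ t in Ioi 0, volume ({y | t * G < φ (x, y)} ∩ slice C x) := by
  have hnn : 0 ≤ᵐ[volume.restrict (slice C x)] fun y => φ (x, y) / G := by
    filter_upwards [self_mem_ae_restrict (h.measurableSet_slice x)] with y hy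
    exact div_nonneg (h.pos _ hy).le hG.le
  have hi := (h.integrableOn_slice x).div_const G
  rw [marginal, ← integral_div, ofReal_integral_eq_lintegral_ofReal hi hnn,
    lintegral_eq_lintegral_meas_lt _ hnn hi.aemeasurable]
  refine lintegral_congr fun t => ?_
  rw [Measure.restrict_apply' (h.measurableSet_slice x)]
  simp only [lt_div_iff₀ hG]

theorem marginal_geom_le (h : WeightedConvex m C φ) {x x' : ℝ} (hx : x ∈ Prod.fst '' C)
    (hx' : x' ∈ Prod.fst '' C) {a b : ℝ} (ha : 0 < a) (hb : 0 < b) (hab : a + b = 1) :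
    marginal C φ x ^ a * marginal C φ x' ^ b ≤ marginal C φ (a * x + b * x') := by
  obtain ⟨B, hB0, hB⟩ := h.exists_bound
  have hsup : ∀ t ∈ Prod.fst '' C, ∃ G, 0 < G ∧ (∀ y ∈ slice C t, φ (t, y) ≤ G) ∧
      ∀ c < G, ∃ y ∈ slice C t, c < φ (t, y) := by
    intro t ht
    have hne := slice_nonempty_iff.2 ht
    have hbdd : BddAbove ((fun y => φ (t, y)) '' slice C t) :=
      ⟨B, by rintro _ ⟨y, hy, rfl⟩; exact hB _ hy⟩
    refine ⟨sSup ((fun y => φ (t, y)) '' slice C t), ?_, ?_, ?_⟩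
    · obtain ⟨y, hy⟩ := hne
      exact (h.pos _ hy).trans_le (le_csSup hbdd ⟨y, hy, rfl⟩)
    · exact fun y hy => le_csSup hbdd ⟨y, hy, rfl⟩
    · intro c hc
      obtain ⟨_, ⟨y, hy, rfl⟩, hlt⟩ := exists_lt_of_lt_csSup (hne.image _) hc
      exact ⟨y, hy, hlt⟩
  obtain ⟨G, hG, hGle, hGlt⟩ := hsup x hx
  obtain ⟨G', hG', hGle', hGlt'⟩ := hsup x' hx'
  set Q := G ^ a * G' ^ b with hQ
  have hQ0 : 0 < Q := by positivity
  have hf := h.marginal_pos hx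
  have hf' := h.marginal_pos hx'
  have key : ENNReal.ofReal a * ENNReal.ofReal (marginal C φ x / G) +
      ENNReal.ofReal b * ENNReal.ofReal (marginal C φ x' / G') ≤
      ENNReal.ofReal (marginal C φ (a * x + b * x') / Q) := by
    rw [h.lintegral_slice_div hG, h.lintegral_slice_div hG', h.lintegral_slice_div hQ0]
    refine (add_le_add (lintegral_const_mul_le _ _) (lintegral_const_mul_le _ _)).trans
      ((le_lintegral_add _ _).trans (setLIntegral_mono' measurableSet_Ioi fun t ht => ?_))
    have ht0 : 0 < t := ht
    rcases lt_or_ge t 1 with ht1 | ht1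
    · refine volume_add_le_of_ordConnected ha.le hb.le (h.ordConnected_superlevel _ _) ?_ ?_
        ((isBounded_slice h.isBounded x).subset inter_subset_right)
        ((isBounded_slice h.isBounded x').subset inter_subset_right) ?_
      · obtain ⟨y, hy, hlt⟩ := hGlt (t * G) (by nlinarith)
        exact ⟨y, hlt, hy⟩
      · obtain ⟨y, hy, hlt⟩ := hGlt' (t * G') (by nlinarith)
        exact ⟨y, hlt, hy⟩
      · rintro y ⟨hy1, hy⟩ y' ⟨hy1', hy'⟩
        refine ⟨?_, convex_combo_mem_slice h.convex hy hy' ha.le hb.le hab⟩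
        have h1 := h.geom_le hy hy' ha.le hb.le hab
        simp only [Prod.smul_mk, Prod.mk_add_mk, smul_eq_mul] at h1
        refine lt_of_lt_of_le ?_ h1
        calc t * Q = (t * G) ^ a * (t * G') ^ b := by
              rw [Real.mul_rpow ht0.le hG.le, Real.mul_rpow ht0.le hG'.le, hQ]
              have : t ^ a * t ^ b = t := by rw [← Real.rpow_add ht0, hab, Real.rpow_one]
              calc t * (G ^ a * G' ^ b) = (t ^ a * t ^ b) * (G ^ a * G' ^ b) := by rw [this]
                _ = _ := by ring
          _ < _ := by
              have e1 : (t * G) ^ a < φ (x, y) ^ a := Real.rpow_lt_rpow (by positivity) hy1 ha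
              have e2 : (t * G') ^ b < φ (x', y') ^ b := Real.rpow_lt_rpow (by positivity) hy1' hb
              exact mul_lt_mul'' e1 e2 (by positivity) (by positivity)
    · have e1 : {y | t * G < φ (x, y)} ∩ slice C x = ∅ := by
        ext y
        simp only [mem_inter_iff, mem_ofPred_eq, mem_empty_iff_false, iff_false, not_and]
        intro h1 h2
        have := hGle y h2
        nlinarith
      have e2 : {y | t * G' < φ (x', y)} ∩ slice C x' = ∅ := by
        ext y
        simp only [mem_inter_iff, mem_ofPred_eq, mem_empty_iff_false, iff_false, not_and]
        intro h1 h2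
        have := hGle' y h2
        nlinarith
      simp [e1, e2]
  rw [← ENNReal.ofReal_mul ha.le, ← ENNReal.ofReal_mul hb.le,
    ← ENNReal.ofReal_add (by positivity) (by positivity)] at key
  have hpos : 0 < a * (marginal C φ x / G) + b * (marginal C φ x' / G') := by positivity
  have key' := (ENNReal.ofReal_le_ofReal_iff'.1 key).resolve_right (by linarith)
  have h3 := (Real.geom_mean_le_arith_mean2_weighted ha.le hb.le (div_pos hf hG).le
    (div_pos hf' hG').le hab).trans key'
  rw [Real.div_rpow hf.le hG.le, Real.div_rpow hf'.le hG'.le, div_mul_div_comm, ← hQ,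
    div_le_div_iff_of_pos_right hQ0] at h3
  exact h3

theorem concaveOn_log_marginal (h : WeightedConvex m C φ) {x0 x1 : ℝ}
    (hx : Prod.fst '' C = Ioo x0 x1) :
    ConcaveOn ℝ (Ioo x0 x1) fun x => Real.log (marginal C φ x) := by
  refine concaveOn_iff_forall_pos.2 ⟨convex_Ioo x0 x1, fun x hxm x' hxm' a b ha hb hab => ?_⟩
  rw [← hx] at hxm hxm'
  have hf := h.marginal_pos hxm
  have hf' := h.marginal_pos hxm'
  simp only [smul_eq_mul]
  rw [← Real.log_rpow hf, ← Real.log_rpow hf', ← Real.log_mul (by positivity) (by positivity)]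
  exact Real.log_le_log (by positivity) (h.marginal_geom_le hxm hxm' ha hb hab)

theorem integrable_marginal (h : WeightedConvex m C φ) : Integrable (marginal C φ) :=
  integrable_integral_slice h.isOpen.measurableSet h.integrableOn

end WeightedConvex

theorem continuous_abs_rpow_mul {p : ℝ} (hp : 1 < p) :
    Continuous fun t : ℝ => |t| ^ (p - 2) * t := by
  have h1 : ContDiff ℝ 1 fun t : ℝ => ‖t‖ ^ p := contDiff_norm_rpow hp
  have h2 := h1.continuous_deriv le_rfl
  have h3 : (deriv fun t : ℝ => ‖t‖ ^ p) = fun t => p * |t| ^ (p - 2) * t := by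
    ext t
    exact (hasDerivAt_abs_rpow t hp).deriv
  rw [h3] at h2
  have h4 := h2.const_smul p⁻¹
  refine h4.congr fun t => ?_
  rw [Pi.smul_apply, smul_eq_mul]
  field_simp

/-- Tangent line inequality for `|·|^p`. -/
theorem abs_rpow_tangent_le {p : ℝ} (hp : 1 < p) (a b : ℝ) :
    |a| ^ p + p * (|a| ^ (p - 2) * a) * (b - a) ≤ |b| ^ p := by
  have hp0 : 0 < p - 1 := by linarith
  have h1 := young_mul hp (abs_nonneg b) (Real.rpow_nonneg (abs_nonneg a) (p - 1))
  rw [← Real.rpow_mul (abs_nonneg _), mul_div_cancel₀ _ hp0.ne'] at h1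
  have h2 : |a| ^ (p - 2) * a * a = |a| ^ p := by
    by_cases h0 : a = 0
    · simp [h0, Real.zero_rpow (show p ≠ 0 by linarith)]
    · rw [mul_assoc, ← abs_mul_abs_self a, ← mul_assoc, ← Real.rpow_add_one (abs_pos.2 h0).ne',
        ← Real.rpow_add_one (abs_pos.2 h0).ne']
      congr 1
      ring
  have h3 : |a| ^ (p - 2) * a * b ≤ |b| * |a| ^ (p - 1) := by
    by_cases h0 : a = 0
    · simp [h0, Real.zero_rpow hp0.ne']
    · rw [show p - 1 = (p - 2) + 1 by ring, Real.rpow_add_one (abs_pos.2 h0).ne']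
      have h4 : a * b ≤ |a| * |b| := by rw [← abs_mul]; exact le_abs_self _
      have h5 : 0 ≤ |a| ^ (p - 2) := by positivity
      nlinarith [mul_le_mul_of_nonneg_left h4 h5]
  nlinarith [mul_le_mul_of_nonneg_left h3 (show 0 ≤ p by linarith)]

namespace WeightedConvex

variable {m : ℕ} {C : Set (ℝ × ℝ)} {φ : ℝ × ℝ → ℝ}

theorem integral_le_shift (h : WeightedConvex m C φ) {p : ℝ} (hp : 1 < p) {u : ℝ × ℝ → ℝ}
    (hu : Continuous u) (h0 : ∫ z in C, φ z * |u z| ^ (p - 2) * u z = 0) (c : ℝ) :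
    ∫ z in C, φ z * |u z| ^ p ≤ ∫ z in C, φ z * |u z - c| ^ p := by
  have hpow : ∀ k : ℝ × ℝ → ℝ, Continuous k → Continuous fun r => |k r| ^ p := fun k hk =>
    hk.abs.rpow_const fun _ => Or.inr (by linarith)
  have hi1 := h.integrableOn_mul (hpow u hu)
  have hi2 := h.integrableOn_mul (hpow (fun z => u z - c) (hu.sub continuous_const))
  have hi3 : IntegrableOn (fun z => φ z * (|u z| ^ (p - 2) * u z)) C :=
    h.integrableOn_mul ((continuous_abs_rpow_mul hp).comp hu)
  have h1 : ∫ z in C, (φ z * |u z| ^ p - p * c * (φ z * (|u z| ^ (p - 2) * u z))) ≤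
      ∫ z in C, φ z * |u z - c| ^ p := by
    refine setIntegral_mono_on (hi1.sub (hi3.const_mul (p * c))) hi2 h.isOpen.measurableSet
      fun z hz => ?_
    have := mul_le_mul_of_nonneg_left (abs_rpow_tangent_le hp (u z) (u z - c)) (h.pos z hz).le
    linarith
  rw [integral_sub hi1 (hi3.const_mul (p * c)), integral_const_mul] at h1
  simp only [← mul_assoc] at h1
  rw [h0] at h1
  simpa using h1

theorem integral_mul_comp_fst (h : WeightedConvex m C φ) {x0 x1 : ℝ}
    (hx : Prod.fst '' C = Ioo x0 x1) {k : ℝ → ℝ} (hk : Continuous k) :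
    ∫ z in C, φ z * k z.1 = ∫ x in Ioo x0 x1, marginal C φ x * k x := by
  rw [setIntegral_eq_integral_slice_Ioo h.isOpen.measurableSet
    (h.integrableOn_mul (k := fun z => k z.1) (hk.comp continuous_fst)) hx]
  simp only [integral_mul_const, marginal]

theorem setIntegral_nonneg (h : WeightedConvex m C φ) {k : ℝ × ℝ → ℝ} (hk : ∀ z, 0 ≤ k z) :
    0 ≤ ∫ z in C, φ z * k z :=
  MeasureTheory.setIntegral_nonneg h.isOpen.measurableSet fun z hz =>
    mul_nonneg (h.pos z hz).le (hk z)

theorem setIntegral_weight_nonneg (h : WeightedConvex m C φ) : 0 ≤ ∫ z in C, φ z :=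
  MeasureTheory.setIntegral_nonneg h.isOpen.measurableSet fun z hz => (h.pos z hz).le

/-- Integrated form of a pointwise inequality with an additive error. -/
theorem integral_le_add (h : WeightedConvex m C φ) {k l : ℝ × ℝ → ℝ} (hk : Continuous k)
    (hl : Continuous l) {ω a : ℝ} (hkl : ∀ z ∈ C, k z ≤ a * l z + ω) :
    ∫ z in C, φ z * k z ≤ a * (∫ z in C, φ z * l z) + ω * ∫ z in C, φ z := by
  have h1 : ∫ z in C, φ z * k z ≤ ∫ z in C, (a * (φ z * l z) + ω * φ z) := by
    refine setIntegral_mono_on (h.integrableOn_mul hk)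
      (((h.integrableOn_mul hl).const_mul a).add (h.integrableOn.const_mul ω))
      h.isOpen.measurableSet fun z hz => ?_
    have := mul_le_mul_of_nonneg_left (hkl z hz) (h.pos z hz).le
    linarith
  rwa [integral_add ((h.integrableOn_mul hl).const_mul a) (h.integrableOn.const_mul ω),
    integral_const_mul, integral_const_mul] at h1

end WeightedConvex

/-- For a concave function, failure of a steep decrease at the right end propagates. -/
theorem ConcaveOn.monotone_of_not_antitoneOn {x0 x1 r : ℝ} {k : ℝ → ℝ}
    (hk : ConcaveOn ℝ (Ioo x0 x1) k) (hr : 0 < r) (h : ¬ AntitoneOn k (Ioo (x1 - r) x1))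
    {a b : ℝ} (ha : x0 < a) (hab : a ≤ b) (hb : b < x1 - r) : k a ≤ k b := by
  simp only [AntitoneOn] at h
  push Not at h
  obtain ⟨s, hs, t, ht, hst, hlt⟩ := h
  rcases hab.eq_or_lt with rfl | hab
  · exact le_rfl
  rcases hst.eq_or_lt with rfl | hst
  · exact absurd hlt (lt_irrefl _)
  have h1 := hk.slope_le_slope_of_lt ⟨ha, by linarith⟩ ⟨by linarith [ht.1], ht.2⟩ hab
    (show b < s by linarith [hs.1]) hst
  have h2 : 0 < (k t - k s) / (t - s) := div_pos (by linarith) (by linarith)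
  have h3 : 0 < k b - k a := by
    have := h2.trans_le h1
    rwa [div_pos_iff_of_pos_right (by linarith)] at this
  linarith

theorem ConcaveOn.antitone_of_not_monotoneOn {x0 x1 r : ℝ} {k : ℝ → ℝ}
    (hk : ConcaveOn ℝ (Ioo x0 x1) k) (hr : 0 < r) (h : ¬ MonotoneOn k (Ioo x0 (x0 + r)))
    {a b : ℝ} (ha : x0 + r < a) (hab : a ≤ b) (hb : b < x1) : k b ≤ k a := by
  simp only [MonotoneOn] at h
  push Not at h
  obtain ⟨s, hs, t, ht, hst, hlt⟩ := h
  rcases hab.eq_or_lt with rfl | hab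
  · exact le_rfl
  rcases hst.eq_or_lt with rfl | hst
  · exact absurd hlt (lt_irrefl _)
  have h1 := hk.slope_le_slope_of_lt ⟨hs.1, by linarith [hs.2]⟩ ⟨by linarith, hb⟩ hst
    (show t < a by linarith [ht.2]) hab
  have h2 : (k t - k s) / (t - s) < 0 := div_neg_of_neg_of_pos (by linarith) (by linarith)
  have h3 : k b - k a < 0 := by
    have := h1.trans_lt h2
    rwa [div_lt_iff₀ (by linarith), zero_mul] at this
  linarith

/-- A convex cell on which `u` is, up to errors `ω`, a function `v` of the abscissa, with
derivative controlled by `S` times the gradient bound `G`. -/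
structure ThinCell (p S ω : ℝ) (m : ℕ) (C : Set (ℝ × ℝ)) (φ u G : ℝ × ℝ → ℝ) (x0 x1 : ℝ)
    (v v' : ℝ → ℝ) : Prop extends WeightedConvex m C φ where
  one_lt : 1 < p
  lt : x0 < x1
  len_le : x1 - x0 ≤ 2
  fst_image : Prod.fst '' C = Ioo x0 x1
  cont_u : Continuous u
  cont_G : Continuous G
  G_nonneg : ∀ z, 0 ≤ G z
  hasDerivAt : ∀ s, HasDerivAt v (v' s) s
  cont_deriv : Continuous v'
  abs_le : ∀ z ∈ C, |v z.1| ^ p ≤ |u z| ^ p + ω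
  le_abs : ∀ z ∈ C, |u z| ^ p ≤ |v z.1| ^ p + ω
  sub_le : ∀ z ∈ C, ∀ x ∈ Ioo x0 x1, |u z - v x| ^ p ≤ |v z.1 - v x| ^ p + ω
  deriv_le : ∀ z ∈ C, |v' z.1| ^ p ≤ S ^ p * G z ^ p + ω
  orth : ∫ z in C, φ z * |u z| ^ (p - 2) * u z = 0
  one_le : 1 ≤ S
  le_two : S ≤ 2
  err_nonneg : 0 ≤ ω

namespace ThinCell

variable {p S ω : ℝ} {m : ℕ} {C : Set (ℝ × ℝ)} {φ u G : ℝ × ℝ → ℝ} {x0 x1 : ℝ} {v v' : ℝ → ℝ}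

theorem continuous_v (h : ThinCell p S ω m C φ u G x0 x1 v v') : Continuous v :=
  continuous_iff_continuousAt.2 fun x => (h.hasDerivAt x).continuousAt

theorem continuous_abs_rpow (h : ThinCell p S ω m C φ u G x0 x1 v v') {X : Type*}
    [TopologicalSpace X] {k : X → ℝ} (hk : Continuous k) : Continuous fun r => |k r| ^ p :=
  hk.abs.rpow_const fun _ => Or.inr (by linarith [h.one_lt])

theorem continuous_G_rpow (h : ThinCell p S ω m C φ u G x0 x1 v v') :
    Continuous fun z => G z ^ p :=
  h.cont_G.rpow_const fun _ => Or.inr (by linarith [h.one_lt])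

theorem integral_deriv_le (h : ThinCell p S ω m C φ u G x0 x1 v v') :
    ∫ x in Ioo x0 x1, marginal C φ x * |v' x| ^ p ≤
      S ^ p * (∫ z in C, φ z * G z ^ p) + ω * ∫ z in C, φ z := by
  rw [← h.integral_mul_comp_fst h.fst_image (h.continuous_abs_rpow h.cont_deriv)]
  exact h.integral_le_add ((h.continuous_abs_rpow h.cont_deriv).comp continuous_fst)
    h.continuous_G_rpow h.deriv_le

theorem integral_abs_le (h : ThinCell p S ω m C φ u G x0 x1 v v') :
    ∫ x in Ioo x0 x1, marginal C φ x * |v x| ^ p ≤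
      (∫ z in C, φ z * |u z| ^ p) + ω * ∫ z in C, φ z := by
  rw [← h.integral_mul_comp_fst h.fst_image (h.continuous_abs_rpow h.continuous_v)]
  have := h.integral_le_add (a := 1) (ω := ω)
    ((h.continuous_abs_rpow h.continuous_v).comp continuous_fst)
    (h.continuous_abs_rpow h.cont_u) fun z hz => by simpa using h.abs_le z hz
  simpa using this

/-- A one-dimensional spectral inequality for the marginal transfers to the cell. -/
theorem spectral (h : ThinCell p S ω m C φ u G x0 x1 v v') {r q z : ℝ} (hr : 0 < r)
    (hr2 : r ≤ 2) (hq : r * S ≤ q) (hz : z ∈ Ioo x0 x1)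
    (hs : (piP p / r) ^ p * ∫ x in Ioo x0 x1, marginal C φ x * |v x - v z| ^ p ≤
      ∫ x in Ioo x0 x1, marginal C φ x * |v' x| ^ p) :
    piP p ^ p * (∫ z in C, φ z * |u z| ^ p) ≤ q ^ p * (∫ z in C, φ z * G z ^ p) +
      (piP p ^ p + 2 ^ p) * (ω * ∫ z in C, φ z) := by
  have hp := h.one_lt
  have hπ := piP_pos hp
  have hS := h.one_le
  set A := ∫ z in C, φ z with hA
  set E := ∫ z in C, φ z * G z ^ p with hE
  set M := ∫ z in C, φ z * |u z| ^ p with hM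
  set I := ∫ x in Ioo x0 x1, marginal C φ x * |v x - v z| ^ p with hI
  have hA0 : 0 ≤ A := h.setIntegral_weight_nonneg
  have hE0 : 0 ≤ E := h.setIntegral_nonneg fun z => Real.rpow_nonneg (h.G_nonneg z) _
  have hM1 : M ≤ I + ω * A := by
    refine (h.integral_le_shift hp h.cont_u h.orth (v z)).trans ?_
    rw [hI, ← h.integral_mul_comp_fst (k := fun x => |v x - v z| ^ p) h.fst_image
      (h.continuous_abs_rpow (h.continuous_v.sub continuous_const))]
    have := h.integral_le_add (a := 1) (ω := ω)
      (h.continuous_abs_rpow (h.cont_u.sub (continuous_const (y := v z))))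
      ((h.continuous_abs_rpow (h.continuous_v.sub (continuous_const (y := v z)))).comp
        continuous_fst) fun w hw => by simpa using h.sub_le w hw z hz
    simpa using this
  have h1 : (piP p / r) ^ p * I ≤ S ^ p * E + ω * A := hs.trans h.integral_deriv_le
  rw [Real.div_rpow hπ.le hr.le, div_mul_eq_mul_div, div_le_iff₀ (by positivity)] at h1
  have h2 : r ^ p ≤ 2 ^ p := Real.rpow_le_rpow hr.le hr2 (by linarith)
  have h3 : S ^ p * r ^ p ≤ q ^ p := by
    rw [← Real.mul_rpow (by linarith) hr.le, mul_comm]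
    exact Real.rpow_le_rpow (by positivity) hq (by linarith)
  have hωA : 0 ≤ ω * A := mul_nonneg h.err_nonneg hA0
  have hπp : 0 ≤ piP p ^ p := by positivity
  nlinarith [mul_le_mul_of_nonneg_left hM1 hπp, mul_le_mul_of_nonneg_right h3 hE0,
    mul_le_mul_of_nonneg_right h2 hωA]

theorem exp_log_marginal (h : ThinCell p S ω m C φ u G x0 x1 v v') {x : ℝ}
    (hx : x ∈ Ioo x0 x1) : Real.exp (Real.log (marginal C φ x)) = marginal C φ x :=
  Real.exp_log (h.marginal_pos (by rwa [h.fst_image]))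

theorem integral_exp_log (h : ThinCell p S ω m C φ u G x0 x1 v v') (k : ℝ → ℝ) :
    ∫ x in Ioo x0 x1, Real.exp (Real.log (marginal C φ x)) * k x =
      ∫ x in Ioo x0 x1, marginal C φ x * k x :=
  setIntegral_congr_fun measurableSet_Ioo fun x hx => by
    simp only [h.exp_log_marginal hx]

theorem integrableOn_exp_log (h : ThinCell p S ω m C φ u G x0 x1 v v') :
    IntegrableOn (fun x => Real.exp (Real.log (marginal C φ x))) (Ioo x0 x1) :=
  (integrableOn_congr_fun (fun _ hx => h.exp_log_marginal hx) measurableSet_Ioo).2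
    h.integrable_marginal.integrableOn

theorem poincare (h : ThinCell p S ω m C φ u G x0 x1 v v') {q : ℝ} (hq : (x1 - x0) * S ≤ q) :
    piP p ^ p * (∫ z in C, φ z * |u z| ^ p) ≤ q ^ p * (∫ z in C, φ z * G z ^ p) +
      (piP p ^ p + 2 ^ p) * (ω * ∫ z in C, φ z) := by
  obtain ⟨z, hz, hs⟩ := poincare_Ioo h.one_lt h.lt (h.concaveOn_log_marginal h.fst_image)
    h.integrableOn_exp_log h.hasDerivAt h.cont_deriv
  rw [h.integral_exp_log, h.integral_exp_log] at hs
  exact h.spectral (sub_pos.2 h.lt) h.len_le hq hz hs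

theorem rpow_le_self_of_le_one {p q : ℝ} (hp : 1 < p) (h0 : 0 ≤ q) (h1 : q ≤ 1) : q ^ p ≤ q := by
  simpa using Real.rpow_le_rpow_of_exponent_ge' h0 h1 zero_le_one hp.le

/-- Either a cell has a spectral surplus, or it is nearly as long as possible and its marginal
does not decay quickly towards either end. -/
theorem alternative {p ρ : ℝ} (hp : 1 < p) (hρ : 0 < ρ) :
    ∃ c0 : ℝ, 0 < c0 ∧ c0 ≤ 1 / 8 ∧ ∀ {S ω : ℝ} {m : ℕ} {C : Set (ℝ × ℝ)} {φ u G : ℝ × ℝ → ℝ}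
      {x0 x1 : ℝ} {v v' : ℝ → ℝ}, ThinCell p S ω m C φ u G x0 x1 v v' →
      ∀ ξ : ℝ, 0 < ξ → ξ ≤ c0 → S ≤ 3 / 2 → (x1 - x0) * S ≤ 1 + ξ →
      piP p ^ p * (∫ z in C, φ z * |u z| ^ p) ≤ (1 - ξ) * (∫ z in C, φ z * G z ^ p) +
        (piP p ^ p + 2 ^ p) * (ω * ∫ z in C, φ z) ∨
      (1 - ξ ≤ (x1 - x0) * S ∧
        (∀ a b, x0 < a → a ≤ b → b < x1 - ρ →
          marginal C φ a ≤ Real.exp 2 * marginal C φ b) ∧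
        (∀ a b, x0 + ρ < a → a ≤ b → b < x1 →
          marginal C φ b ≤ Real.exp 2 * marginal C φ a)) := by
  obtain ⟨τ, hτ, hτ4, hsur⟩ := exists_surplus hp hρ
  refine ⟨τ / 2, by positivity, by linarith, ?_⟩
  intro S ω m C φ u G x0 x1 v v' h ξ hξ hξc hS32 hℓ
  have hE0 : 0 ≤ ∫ z in C, φ z * G z ^ p :=
    h.setIntegral_nonneg fun z => Real.rpow_nonneg (h.G_nonneg z) _
  have hS := h.one_le
  have hlt := h.lt
  have hlen := h.len_le
  have hcv := h.concaveOn_log_marginal h.fst_image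
  have hpw : (1 - ξ) ^ p * (∫ z in C, φ z * G z ^ p) ≤
      (1 - ξ) * (∫ z in C, φ z * G z ^ p) :=
    mul_le_mul_of_nonneg_right (rpow_le_self_of_le_one hp (by linarith) (by linarith)) hE0
  rcases lt_or_ge ((x1 - x0) * S) (1 - ξ) with hlt' | hge
  · left
    linarith [h.poincare hlt'.le]
  have hhalf : 1 / 2 ≤ x1 - x0 := by nlinarith
  by_cases hterm : AntitoneOn (fun t => Real.log (marginal C φ t) + t) (Ioo (x1 - ρ) x1) ∨
        MonotoneOn (fun t => Real.log (marginal C φ t) - t) (Ioo x0 (x0 + ρ))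
  · left
    obtain ⟨z, hz, hs⟩ := hsur x0 x1 _ v v' hhalf h.len_le hcv h.integrableOn_exp_log hterm
      h.hasDerivAt h.cont_deriv
    rw [h.integral_exp_log, h.integral_exp_log] at hs
    have := h.spectral (q := 1 - ξ) (by linarith) (by linarith [h.len_le]) (by nlinarith) hz hs
    linarith
  · right
    push Not at hterm
    refine ⟨hge, fun a b ha hab hb => ?_, fun a b ha hab hb => ?_⟩
    · have h1 := (hcv.add (concaveOn_id (convex_Ioo x0 x1))).monotone_of_not_antitoneOn hρ
        hterm.1 ha hab hb
      have ha' := h.exp_log_marginal (x := a) ⟨ha, by linarith⟩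
      have hb' := h.exp_log_marginal (x := b) ⟨by linarith, by linarith⟩
      rw [← ha', ← hb', ← Real.exp_add]
      simp only [Pi.add_apply, id] at h1
      exact Real.exp_le_exp.2 (by linarith)
    · have h1 := (hcv.sub (convexOn_id (convex_Ioo x0 x1))).antitone_of_not_monotoneOn hρ
        hterm.2 ha hab hb
      have ha' := h.exp_log_marginal (x := a) ⟨by linarith, by linarith⟩
      have hb' := h.exp_log_marginal (x := b) ⟨by linarith, by linarith⟩
      rw [← ha', ← hb', ← Real.exp_add]
      simp only [Pi.sub_apply, id] at h1
      exact Real.exp_le_exp.2 (by linarith)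

/-- Mass bound over a range of abscissas from which the marginal does not drop much. -/
theorem mass_le (h : ThinCell p S ω m C φ u G x0 x1 v v') {j0 j1 κ : ℝ} (hκ : 0 < κ)
    (hj : j0 ≤ j1)
    (hJ : ∀ s ∈ Ioo j0 j1, s ∈ Ioo x0 x1 → ∃ a, s ∈ Icc a (a + 1 / 4) ∧
      Ioo a (a + 1 / 4) ⊆ Ioo x0 x1 ∧
      ∀ t ∈ Ioo a (a + 1 / 4), marginal C φ s ≤ κ * marginal C φ t) :
    ∫ z in C ∩ Prod.fst ⁻¹' Ioo j0 j1, φ z * |u z| ^ p ≤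
      (j1 - j0) * (4 * p * κ) * ((∫ z in C, φ z * |u z| ^ p) +
        2 ^ p * (∫ z in C, φ z * G z ^ p) + 2 * (ω * ∫ z in C, φ z)) + ω * ∫ z in C, φ z := by
  have hp := h.one_lt
  set f := marginal C φ with hf
  set J := Ioo j0 j1 ∩ Ioo x0 x1 with hJd
  have hfi : IntegrableOn f (Ioo x0 x1) := h.integrable_marginal.integrableOn
  have hfpos : ∀ x ∈ Ioo x0 x1, 0 < f x := fun x hx => h.marginal_pos (by rwa [h.fst_image])
  have hbd : ∀ k : ℝ → ℝ, Continuous k → IntegrableOn (fun x => f x * k x) (Ioo x0 x1) := by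
    intro k hk
    obtain ⟨B, hB⟩ := (isCompact_Icc (a := x0) (b := x1)).exists_bound_of_continuousOn
      hk.continuousOn
    refine hfi.mul_bdd (c := B) hk.aestronglyMeasurable ?_
    filter_upwards [self_mem_ae_restrict measurableSet_Ioo] with x hx
    exact hB x (Ioo_subset_Icc_self hx)
  have hvp := h.continuous_abs_rpow h.continuous_v
  have hvp' := h.continuous_abs_rpow h.cont_deriv
  set Q := ∫ t in Ioo x0 x1, f t * (|v t| ^ p + |v' t| ^ p) with hQ
  have hQ0 : 0 ≤ Q := MeasureTheory.setIntegral_nonneg measurableSet_Ioo fun x hx =>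
    mul_nonneg (hfpos x hx).le (by positivity)
  have hpt : ∀ s ∈ J, f s * |v s| ^ p ≤ 4 * p * κ * Q := by
    rintro s ⟨hs, hs'⟩
    obtain ⟨a, hsa, hsub, hle⟩ := hJ s hs hs'
    have h1 := weight_mul_abs_rpow_le (w := f) (W := κ⁻¹ * f s) hp
      (show (0 : ℝ) < 1 / 4 by norm_num) (by norm_num)
      (mul_nonneg (by positivity) (hfpos s hs').le)
      (fun t ht => by rw [inv_mul_le_iff₀ hκ]; exact hle t ht) (hfi.mono_set hsub) h.hasDerivAt
      h.cont_deriv hsa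
    have h2 : ∫ t in Ioo a (a + 1 / 4), f t * (|v t| ^ p + |v' t| ^ p) ≤ Q := by
      refine setIntegral_mono_set (hbd _ (hvp.add hvp')) ?_ hsub.eventuallyLE
      filter_upwards [self_mem_ae_restrict measurableSet_Ioo] with x hx
      exact mul_nonneg (hfpos x hx).le (by positivity)
    have h3 : κ⁻¹ * f s * |v s| ^ p ≤ 4 * p * Q := by
      refine h1.trans ?_
      rw [show p / (1 / 4) = 4 * p by ring]
      gcongr
    rw [mul_assoc, inv_mul_le_iff₀ hκ] at h3
    linarith
  have hJm : MeasurableSet J := measurableSet_Ioo.inter measurableSet_Ioo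
  have hJv : volume.real J ≤ j1 - j0 := by
    rw [← Real.volume_real_Ioo_of_le hj]
    exact measureReal_mono inter_subset_left (by simp)
  have hJ1 : ∫ x in J, f x * |v x| ^ p ≤ (j1 - j0) * (4 * p * κ) * Q := by
    have h1 : ∫ x in J, f x * |v x| ^ p ≤ ∫ x in J, 4 * p * κ * Q := by
      refine setIntegral_mono_on ((hbd _ hvp).mono_set inter_subset_right) ?_ hJm hpt
      exact integrableOn_const ((measure_mono inter_subset_left).trans_lt (by simp)).ne
    rw [setIntegral_const, smul_eq_mul] at h1
    have : 0 ≤ 4 * p * κ * Q := by positivity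
    nlinarith [mul_le_mul_of_nonneg_right hJv this]
  have hD : MeasurableSet (C ∩ Prod.fst ⁻¹' Ioo j0 j1) :=
    h.isOpen.measurableSet.inter (measurable_fst measurableSet_Ioo)
  have hwc : WeightedConvex m (C ∩ Prod.fst ⁻¹' Ioo j0 j1) φ :=
    h.mono (h.isOpen.inter (isOpen_Ioo.preimage continuous_fst))
      (h.convex.inter ((convex_Ioo j0 j1).linear_preimage (LinearMap.fst ℝ ℝ ℝ)))
      inter_subset_left
  have h2 : ∫ z in C ∩ Prod.fst ⁻¹' Ioo j0 j1, φ z * |v z.1| ^ p = ∫ x in J, f x * |v x| ^ p := by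
    rw [setIntegral_eq_integral_slice hD (hwc.integrableOn_mul (k := fun z => |v z.1| ^ p)
      (hvp.comp continuous_fst)), ← integral_indicator hJm]
    congr 1
    ext x
    by_cases hx : x ∈ Ioo j0 j1
    · have : slice (C ∩ Prod.fst ⁻¹' Ioo j0 j1) x = slice C x := by
        ext y
        exact ⟨fun hy => hy.1, fun hy => ⟨hy, hx⟩⟩
      simp only [this, integral_mul_const]
      by_cases hx' : x ∈ Ioo x0 x1
      · rw [indicator_of_mem (show x ∈ J from ⟨hx, hx'⟩)]
        rfl
      · rw [indicator_of_notMem (show x ∉ J from fun hh => hx' hh.2),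
          slice_eq_empty (by rwa [h.fst_image])]
        simp
    · have : slice (C ∩ Prod.fst ⁻¹' Ioo j0 j1) x = ∅ := by
        ext y
        exact ⟨fun hy => hx hy.2, fun hy => hy.elim⟩
      rw [this, indicator_of_notMem (show x ∉ J from fun hh => hx hh.1)]
      simp
  have h3 := hwc.integral_le_add (a := 1) (ω := ω) (h.continuous_abs_rpow h.cont_u)
    (hvp.comp continuous_fst) fun z hz => by simpa using h.le_abs z hz.1
  have h4 : ∫ z in C ∩ Prod.fst ⁻¹' Ioo j0 j1, φ z ≤ ∫ z in C, φ z := by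
    refine setIntegral_mono_set h.integrableOn ?_ inter_subset_left.eventuallyLE
    filter_upwards [self_mem_ae_restrict h.isOpen.measurableSet] with z hz
    exact (h.pos z hz).le
  have h5 : Q ≤ (∫ z in C, φ z * |u z| ^ p) + 2 ^ p * (∫ z in C, φ z * G z ^ p) +
      2 * (ω * ∫ z in C, φ z) := by
    have e : Q = (∫ x in Ioo x0 x1, f x * |v x| ^ p) + ∫ x in Ioo x0 x1, f x * |v' x| ^ p := by
      rw [← integral_add (hbd _ hvp) (hbd _ hvp')]
      simp only [hQ, mul_add]
    have h6 := h.integral_abs_le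
    have h7 := h.integral_deriv_le
    have hS : S ^ p ≤ 2 ^ p := Real.rpow_le_rpow (by linarith [h.one_le]) h.le_two (by linarith)
    have hE0 : 0 ≤ ∫ z in C, φ z * G z ^ p :=
      h.setIntegral_nonneg fun z => Real.rpow_nonneg (h.G_nonneg z) _
    nlinarith [mul_le_mul_of_nonneg_right hS hE0]
  simp only [one_mul, Function.comp] at h3
  rw [h2] at h3
  have h8 : 0 ≤ (j1 - j0) * (4 * p * κ) := mul_nonneg (by linarith) (by positivity)
  nlinarith [mul_le_mul_of_nonneg_left h5 h8, mul_le_mul_of_nonneg_left h4 h.err_nonneg]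

end ThinCell

/-- Length of the vertical slices. -/
noncomputable def chord (C : Set (ℝ × ℝ)) (x : ℝ) : ℝ := volume.real (slice C x)

theorem chord_nonneg (C : Set (ℝ × ℝ)) (x : ℝ) : 0 ≤ chord C x := measureReal_nonneg

theorem exists_slice_eq_Ioo {C : Set (ℝ × ℝ)} (ho : IsOpen C) (hc : Convex ℝ C)
    (hb : Bornology.IsBounded C) {x : ℝ} (hx : x ∈ Prod.fst '' C) :
    ∃ b t : ℝ, b < t ∧ slice C x = Ioo b t := by
  have hSo := isOpen_slice ho x
  have hSb := isBounded_slice hb x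
  have hSn := slice_nonempty_iff.2 hx
  have hsub := IsConnected.Ioo_csInf_csSup_subset
    ⟨hSn, (ordConnected_slice hc x).isPreconnected⟩ hSb.bddBelow hSb.bddAbove
  have hsup : slice C x ⊆ Ioo (sInf (slice C x)) (sSup (slice C x)) := by
    rw [← interior_Icc]
    exact hSo.subset_interior_iff.2 (subset_Icc_csInf_csSup hSb.bddBelow hSb.bddAbove)
  obtain ⟨y, hy⟩ := hSn
  exact ⟨_, _, (hsup hy).1.trans (hsup hy).2, hsup.antisymm hsub⟩

theorem chord_combo_le {C : Set (ℝ × ℝ)} (hc : Convex ℝ C)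
    (hb : Bornology.IsBounded C) {x x' a b : ℝ} (hx : x ∈ Prod.fst '' C)
    (hx' : x' ∈ Prod.fst '' C) (ha : 0 ≤ a) (hb0 : 0 ≤ b) (hab : a + b = 1) :
    a * chord C x + b * chord C x' ≤ chord C (a * x + b * x') := by
  have h1 := volume_add_le_of_ordConnected ha hb0 (ordConnected_slice hc (a * x + b * x'))
    (slice_nonempty_iff.2 hx) (slice_nonempty_iff.2 hx') (isBounded_slice hb x)
    (isBounded_slice hb x') fun y hy y' hy' => convex_combo_mem_slice hc hy hy' ha hb0 hab
  have ht : ∀ t, volume (slice C t) ≠ ⊤ := fun t => (isBounded_slice hb t).measure_lt_top.ne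
  have h2 := ENNReal.toReal_mono (ht _) h1
  rw [ENNReal.toReal_add (ENNReal.mul_ne_top ENNReal.ofReal_ne_top (ht _))
    (ENNReal.mul_ne_top ENNReal.ofReal_ne_top (ht _)), ENNReal.toReal_mul, ENNReal.toReal_mul,
    ENNReal.toReal_ofReal ha, ENNReal.toReal_ofReal hb0] at h2
  exact h2

namespace WeightedConvex

variable {m : ℕ} {C : Set (ℝ × ℝ)} {φ : ℝ × ℝ → ℝ}

/-- A slice cannot be much longer than another one if the marginal does not grow much. -/
theorem chord_le_of_marginal_le (h : WeightedConvex m C φ) {x a K : ℝ} (ha : a ∈ Prod.fst '' C)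
    (hK0 : 0 ≤ K) (hK : marginal C φ ((x + a) / 2) ≤ K * marginal C φ a) :
    chord C x ≤ 2 ^ (m + 1) * K * chord C a := by
  by_cases hx : x ∈ Prod.fst '' C
  swap
  · rw [chord, slice_eq_empty hx]
    have := chord_nonneg C a
    simp only [measureReal_empty]
    positivity
  have hvt : ∀ t, volume (slice C t) ≠ ⊤ := fun t => (h.volume_slice_lt_top t).ne
  have hapos : 0 < volume (slice C a) :=
    (isOpen_slice h.isOpen a).measure_pos _ (slice_nonempty_iff.2 ha)
  have hca : 0 < chord C a := ENNReal.toReal_pos hapos.ne' (hvt a)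
  obtain ⟨ys, hys, hav⟩ := exists_setAverage_le hapos.ne' (hvt a) (h.integrableOn_slice a)
  rw [setAverage_eq, smul_eq_mul, inv_mul_le_iff₀ (show 0 < volume.real (slice C a) from hca)] at hav
  set P := φ (a, ys) with hP
  have hP0 : 0 < P := h.pos _ hys
  set T : Set ℝ := {y | 2 * y - ys ∈ slice C x} with hT
  have hTm : MeasurableSet T :=
    ((isOpen_slice h.isOpen x).preimage (by fun_prop : Continuous fun y : ℝ => 2 * y - ys)
      ).measurableSet
  have hTo : T.OrdConnected :=
    (ordConnected_slice h.convex x).preimage_mono (f := fun y : ℝ => 2 * y - ys)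
      fun s t hst => by simp only; linarith
  have hsub : T ⊆ slice C ((x + a) / 2) := by
    intro y hy
    have := convex_combo_mem_slice h.convex hy hys (show (0 : ℝ) ≤ 1 / 2 by norm_num)
      (show (0 : ℝ) ≤ 1 / 2 by norm_num) (by norm_num)
    convert this using 1 <;> ring_nf
  have hlow : ∀ y ∈ T, P ≤ 2 ^ m * φ ((x + a) / 2, y) := by
    intro y hy
    have := h.half_pow_le (z := (a, ys)) (w := (x, 2 * y - ys)) hys hy
      (show (1 / 2 : ℝ) ≤ 1 / 2 by norm_num) (show (0 : ℝ) ≤ 1 / 2 by norm_num) (by norm_num)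
    rwa [show (1 / 2 : ℝ) • (a, ys) + (1 / 2 : ℝ) • (x, 2 * y - ys) = ((x + a) / 2, y) by
      simp only [Prod.smul_mk, Prod.mk_add_mk, smul_eq_mul, Prod.mk.injEq]
      constructor <;> ring] at this
  have hTt : volume T ≠ ⊤ := ((measure_mono hsub).trans_lt (h.volume_slice_lt_top _)).ne
  have hvT : 1 / 2 * chord C x ≤ volume.real T := by
    have h1 := volume_add_le_of_ordConnected (A := slice C x) (B := {ys})
      (show (0 : ℝ) ≤ 1 / 2 by norm_num) (show (0 : ℝ) ≤ 1 / 2 by norm_num) hTo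
      (slice_nonempty_iff.2 hx) (singleton_nonempty _) (isBounded_slice h.isBounded x)
      Bornology.isBounded_singleton (by
        rintro y hy _ rfl
        simp only [hT, mem_ofPred_eq]
        convert hy using 1
        ring)
    simp only [Real.volume_singleton, mul_zero, add_zero] at h1
    have h2 := ENNReal.toReal_mono hTt h1
    rwa [ENNReal.toReal_mul, ENNReal.toReal_ofReal (by norm_num)] at h2
  have h1 : volume.real T * P ≤ 2 ^ m * marginal C φ ((x + a) / 2) := by
    calc volume.real T * P = ∫ y in T, P := by rw [setIntegral_const, smul_eq_mul]
      _ ≤ ∫ y in T, 2 ^ m * φ ((x + a) / 2, y) :=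
          setIntegral_mono_on (integrableOn_const hTt)
            (((h.integrableOn_slice _).mono_set hsub).const_mul _) hTm hlow
      _ = 2 ^ m * ∫ y in T, φ ((x + a) / 2, y) := integral_const_mul _ _
      _ ≤ 2 ^ m * marginal C φ ((x + a) / 2) := by
          refine mul_le_mul_of_nonneg_left ?_ (by positivity)
          refine setIntegral_mono_set (h.integrableOn_slice _) ?_ hsub.eventuallyLE
          filter_upwards [self_mem_ae_restrict (h.measurableSet_slice _)] with y hy
          exact (h.pos _ hy).le
  have h2 : chord C x * P ≤ (2 ^ (m + 1) * K * chord C a) * P := by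
    calc chord C x * P ≤ 2 * (volume.real T * P) := by nlinarith
      _ ≤ 2 * (2 ^ m * (K * marginal C φ a)) := by
          have := mul_le_mul_of_nonneg_left hK (show (0 : ℝ) ≤ 2 ^ m by positivity)
          linarith
      _ ≤ 2 * (2 ^ m * (K * (chord C a * P))) := by
          gcongr
          exact hav
      _ = _ := by ring
  exact le_of_mul_le_mul_right h2 hP0

/-- Pointwise bound of the weighted function by its energy on the vertical slice. -/
theorem vertical_bound (h : WeightedConvex m C φ) {p : ℝ} (hp : 1 < p) {u G : ℝ × ℝ → ℝ}
    {u' : ℝ × ℝ → ℝ} (hu : ∀ x y, HasDerivAt (fun t => u (x, t)) (u' (x, y)) y)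
    (hu' : Continuous u') (hG : Continuous G) (hGu : ∀ z, |u' z| ≤ G z) {x y : ℝ}
    (hy : y ∈ slice C x) (h1 : chord C x ≤ 1) :
    φ (x, y) * |u (x, y)| ^ p ≤ 2 ^ m * (4 * p / chord C x) *
      ∫ t in slice C x, φ (x, t) * (|u (x, t)| ^ p + G (x, t) ^ p) := by
  have hx : x ∈ Prod.fst '' C := slice_nonempty_iff.1 ⟨y, hy⟩
  obtain ⟨b, t, hbt, hs⟩ := exists_slice_eq_Ioo h.isOpen h.convex h.isBounded hx
  have hch : chord C x = t - b := by rw [chord, hs, Real.volume_real_Ioo_of_le hbt.le]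
  set d := (t - b) / 4 with hd
  have hd0 : 0 < d := by rw [hd]; linarith
  have hyI : y ∈ Ioo b t := hs ▸ hy
  have hφ : 0 < φ (x, y) := h.pos _ hy
  have hkint := h.integrableOn_slice x
  have hvc : Continuous fun t => u (x, t) :=
    continuous_iff_continuousAt.2 fun s => (hu x s).continuousAt
  have hp0 : 0 ≤ p := by linarith
  have hup : Continuous fun t => |u (x, t)| ^ p :=
    hvc.abs.rpow_const fun _ => Or.inr hp0
  have hup' : Continuous fun t => |u' (x, t)| ^ p :=
    (hu'.comp (by fun_prop : Continuous fun t : ℝ => (x, t))).abs.rpow_const fun _ => Or.inr hp0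
  have hGp : Continuous fun t => G (x, t) ^ p :=
    (hG.comp (by fun_prop : Continuous fun t : ℝ => (x, t))).rpow_const fun _ => Or.inr hp0
  have key : ∀ a, y ∈ Icc a (a + d) → (∀ s ∈ Ioo a (a + d), 2 * s - y ∈ Ioo b t) →
      Ioo a (a + d) ⊆ Ioo b t →
      φ (x, y) * |u (x, y)| ^ p ≤ 2 ^ m * (4 * p / chord C x) *
        ∫ t in slice C x, φ (x, t) * (|u (x, t)| ^ p + G (x, t) ^ p) := by
    intro a hya hw hsub
    rw [← hs] at hsub hw
    have e1 := weight_mul_abs_rpow_le (a := a) (W := (2 ^ m)⁻¹ * φ (x, y))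
      (w := fun s => φ (x, s)) hp hd0 (by linarith) (by positivity)
      (fun s hs' => by
        rw [inv_mul_le_iff₀ (by positivity)]
        have := h.half_pow_le (z := (x, y)) (w := (x, 2 * s - y)) hy (hw s hs')
          (show (1 / 2 : ℝ) ≤ 1 / 2 by norm_num) (show (0 : ℝ) ≤ 1 / 2 by norm_num) (by norm_num)
        rwa [show (1 / 2 : ℝ) • (x, y) + (1 / 2 : ℝ) • (x, 2 * s - y) = (x, s) by
          simp only [Prod.smul_mk, Prod.mk_add_mk, smul_eq_mul, Prod.mk.injEq]
          constructor <;> ring] at this)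
      (hkint.mono_set hsub) (fun s => hu x s)
      (hu'.comp (by fun_prop : Continuous fun t : ℝ => (x, t))) hya
    have e2 : ∫ s in Ioo a (a + d), φ (x, s) * (|u (x, s)| ^ p + |u' (x, s)| ^ p) ≤
        ∫ t in slice C x, φ (x, t) * (|u (x, t)| ^ p + G (x, t) ^ p) := by
      have hi1 : IntegrableOn (fun s => φ (x, s) * (|u (x, s)| ^ p + |u' (x, s)| ^ p))
        (slice C x) := h.integrableOn_slice_mul (hup.add hup') x
      have hi2 : IntegrableOn (fun s => φ (x, s) * (|u (x, s)| ^ p + G (x, s) ^ p))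
        (slice C x) := h.integrableOn_slice_mul (hup.add hGp) x
      refine (setIntegral_mono_set hi1 ?_ hsub.eventuallyLE).trans
        (setIntegral_mono_on hi1 hi2 (h.measurableSet_slice x) fun s hs' => ?_)
      · filter_upwards [self_mem_ae_restrict (h.measurableSet_slice x)] with s hs'
        exact mul_nonneg (h.pos _ hs').le (by positivity)
      · refine mul_le_mul_of_nonneg_left ?_ (h.pos _ hs').le
        gcongr
        exact hGu _
    have e3 : (2 ^ m)⁻¹ * (φ (x, y) * |u (x, y)| ^ p) ≤ p / d *
        ∫ t in slice C x, φ (x, t) * (|u (x, t)| ^ p + G (x, t) ^ p) := by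
      rw [← mul_assoc]
      exact e1.trans (mul_le_mul_of_nonneg_left e2 (by positivity))
    rw [inv_mul_le_iff₀ (by positivity)] at e3
    rw [hch, show 4 * p / (t - b) = p / d by rw [hd]; field_simp, mul_assoc]
    exact e3
  rcases le_total (2 * d) (t - y) with hc | hc
  · refine key y ⟨le_rfl, by linarith⟩ (fun s hs' => ?_) fun s hs' => ?_
    · exact ⟨by linarith [hs'.1, hyI.1], by linarith [hs'.2]⟩
    · exact ⟨by linarith [hs'.1, hyI.1], by linarith [hs'.2]⟩
  · have h4 : 4 * d = t - b := by rw [hd]; ring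
    refine key (y - d) ⟨by linarith, by linarith⟩ (fun s hs' => ?_) fun s hs' => ?_
    · exact ⟨by linarith [hs'.1, hyI.1], by linarith [hs'.2, hyI.2]⟩
    · exact ⟨by linarith [hs'.1, hyI.1], by linarith [hs'.2, hyI.2]⟩

end WeightedConvex

/-- `u` is continuously differentiable with derivative `u'`, and `G` bounds the Euclidean norm of
the derivative. -/
structure GradBound (u : ℝ × ℝ → ℝ) (u' : ℝ × ℝ → ℝ × ℝ →L[ℝ] ℝ) (G : ℝ × ℝ → ℝ) : Prop where
  hasFDerivAt : ∀ z, HasFDerivAt u (u' z) z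
  cont_deriv : Continuous u'
  cont_G : Continuous G
  le : ∀ z (a b : ℝ), |u' z (a, b)| ≤ G z * √(a ^ 2 + b ^ 2)

namespace GradBound

variable {u : ℝ × ℝ → ℝ} {u' : ℝ × ℝ → ℝ × ℝ →L[ℝ] ℝ} {G : ℝ × ℝ → ℝ}

theorem nonneg (h : GradBound u u' G) (z : ℝ × ℝ) : 0 ≤ G z := by
  have := (abs_nonneg _).trans (h.le z 1 0)
  simpa using this

theorem cont (h : GradBound u u' G) : Continuous u :=
  continuous_iff_continuousAt.2 fun z => (h.hasFDerivAt z).continuousAt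

theorem hasDerivAt_snd (h : GradBound u u' G) (x y : ℝ) :
    HasDerivAt (fun t => u (x, t)) (u' (x, y) (0, 1)) y :=
  (h.hasFDerivAt (x, y)).comp_hasDerivAt y ((hasDerivAt_const y x).prodMk (hasDerivAt_id y))

theorem hasDerivAt_line (h : GradBound u u' G) (σ τ x : ℝ) :
    HasDerivAt (fun t => u (t, σ * t + τ)) (u' (x, σ * x + τ) (1, σ)) x := by
  have h1 : HasDerivAt (fun t : ℝ => σ * t + τ) σ x := by
    simpa using ((hasDerivAt_id x).const_mul σ).add_const τ
  exact (h.hasFDerivAt (x, σ * x + τ)).comp_hasDerivAt x ((hasDerivAt_id x).prodMk h1)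

/-- Cells of a bounded set contained in thin strips are thin cells, uniformly. -/
theorem exists_thinCell (h : GradBound u u' G) {p : ℝ} (hp : 1 < p) {m : ℕ} {Ω : Set (ℝ × ℝ)}
    {φ : ℝ × ℝ → ℝ} (hΩ : WeightedConvex m Ω φ) (hd : ∀ z ∈ Ω, ∀ w ∈ Ω, w.1 - z.1 ≤ 1)
    {ω : ℝ} (hω : 0 < ω) :
    ∃ ε0 > 0, ∀ (C : Set (ℝ × ℝ)) (σ τ : ℝ), C ⊆ Ω → IsOpen C → Convex ℝ C → C.Nonempty →
      σ ^ 2 ≤ 3 → (∀ z ∈ C, |z.2 - (σ * z.1 + τ)| ≤ ε0) →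
      (∫ z in C, φ z * |u z| ^ (p - 2) * u z = 0) → ∃ x0 x1, ThinCell p √(1 + σ ^ 2) ω m C φ u G
        x0 x1 (fun t => u (t, σ * t + τ)) (fun t => u' (t, σ * t + τ) (1, σ)) := by
  obtain ⟨R, hR⟩ := hΩ.isBounded.subset_closedBall 0
  set K : Set (ℝ × ℝ) := Metric.closedBall 0 (R + 1) with hK
  have hKc : IsCompact K := isCompact_closedBall _ _
  have hp0 : 0 ≤ p := by linarith
  have hc1 : Continuous fun z => |u z| ^ p := h.cont.abs.rpow_const fun _ => Or.inr hp0
  have hc2 : Continuous fun z : (ℝ × ℝ) × (ℝ × ℝ) => |u z.1 - u z.2| ^ p :=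
    ((h.cont.comp continuous_fst).sub (h.cont.comp continuous_snd)).abs.rpow_const
      fun _ => Or.inr hp0
  have hc3 : Continuous fun z => G z ^ p := h.cont_G.rpow_const fun _ => Or.inr hp0
  have u1 := Metric.uniformContinuousOn_iff.1 (hKc.uniformContinuousOn_of_continuous hc1.continuousOn)
  have u2 := Metric.uniformContinuousOn_iff.1
    ((hKc.prod hKc).uniformContinuousOn_of_continuous hc2.continuousOn)
  have u3 := Metric.uniformContinuousOn_iff.1 (hKc.uniformContinuousOn_of_continuous hc3.continuousOn)
  obtain ⟨d1, hd1, u1⟩ := u1 ω hω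
  obtain ⟨d2, hd2, u2⟩ := u2 ω hω
  have h2p : (0 : ℝ) < 2 ^ p := by positivity
  obtain ⟨d3, hd3, u3⟩ := u3 (ω / 2 ^ p) (by positivity)
  refine ⟨min 1 (min d1 (min d2 d3) / 2), by positivity, ?_⟩
  intro C σ τ hCΩ hCo hCc hCn hσ hstrip horth
  have hCW := hΩ.mono hCo hCc hCΩ
  obtain ⟨x0, x1, hx, himg⟩ := exists_fst_image_eq_Ioo hCo hCc hCW.isBounded hCn
  have hzK : ∀ z ∈ C, z ∈ K := fun z hz =>
    Metric.closedBall_subset_closedBall (by linarith) (hR (hCΩ hz))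
  have hdist : ∀ z ∈ C, dist (z.1, σ * z.1 + τ) z ≤ min 1 (min d1 (min d2 d3) / 2) := by
    intro z hz
    rw [Prod.dist_eq, dist_self, max_eq_right dist_nonneg, dist_comm, Real.dist_eq]
    exact hstrip z hz
  have hlK : ∀ z ∈ C, (z.1, σ * z.1 + τ) ∈ K := by
    intro z hz
    have h1 := (hdist z hz).trans (min_le_left _ _)
    have h2 := hR (hCΩ hz)
    rw [Metric.mem_closedBall] at h2 ⊢
    exact (dist_triangle _ z _).trans (by linarith)
  have hmin : 0 < min d1 (min d2 d3) := by positivity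
  have hlt : ∀ z ∈ C, dist (z.1, σ * z.1 + τ) z < min d1 (min d2 d3) := fun z hz =>
    ((hdist z hz).trans (min_le_right _ _)).trans_lt (by linarith)
  have hS1 : 1 ≤ √(1 + σ ^ 2) := Real.one_le_sqrt.2 (by nlinarith)
  have hS2 : √(1 + σ ^ 2) ≤ 2 := Real.sqrt_le_iff.2 ⟨by norm_num, by linarith⟩
  refine ⟨x0, x1, ⟨hCW, hp, hx, ?_, himg, h.cont, h.cont_G, h.nonneg, h.hasDerivAt_line σ τ, ?_,
    ?_, ?_, ?_, ?_, horth, hS1, hS2, hω.le⟩⟩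
  · by_contra! hlen
    have ha : x0 + 1 / 4 ∈ Ioo x0 x1 := ⟨by linarith, by linarith⟩
    have hb : x1 - 1 / 4 ∈ Ioo x0 x1 := ⟨by linarith, by linarith⟩
    rw [← himg] at ha hb
    obtain ⟨za, hza, ea⟩ := ha
    obtain ⟨zb, hzb, eb⟩ := hb
    have := hd za (hCΩ hza) zb (hCΩ hzb)
    rw [ea, eb] at this
    linarith
  · exact (h.cont_deriv.comp (by fun_prop)).clm_apply continuous_const
  · intro z hz
    have := u1 _ (hlK z hz) _ (hzK z hz) ((hlt z hz).trans_le (min_le_left _ _))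
    rw [Real.dist_eq] at this
    linarith [(abs_lt.1 this).2]
  · intro z hz
    have := u1 _ (hlK z hz) _ (hzK z hz) ((hlt z hz).trans_le (min_le_left _ _))
    rw [Real.dist_eq] at this
    linarith [(abs_lt.1 this).1]
  · intro z hz x hx'
    rw [← himg] at hx'
    obtain ⟨w, hw, rfl⟩ := hx'
    have := u2 (z, (w.1, σ * w.1 + τ)) ⟨hzK z hz, hlK w hw⟩
      ((z.1, σ * z.1 + τ), (w.1, σ * w.1 + τ)) ⟨hlK z hz, hlK w hw⟩ (by
        rw [Prod.dist_eq, dist_self, max_eq_left dist_nonneg, dist_comm]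
        exact (hlt z hz).trans_le ((min_le_right _ _).trans (min_le_left _ _)))
    rw [Real.dist_eq] at this
    linarith [(abs_lt.1 this).2]
  · intro z hz
    have h1 := u3 _ (hlK z hz) _ (hzK z hz)
      ((hlt z hz).trans_le ((min_le_right _ _).trans (min_le_right _ _)))
    rw [Real.dist_eq] at h1
    have h2 : G (z.1, σ * z.1 + τ) ^ p ≤ G z ^ p + ω / 2 ^ p := by linarith [(abs_lt.1 h1).2]
    have h3 := h.le (z.1, σ * z.1 + τ) 1 σ
    rw [one_pow] at h3
    have hSp : √(1 + σ ^ 2) ^ p ≤ 2 ^ p := Real.rpow_le_rpow (by positivity) hS2 hp0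
    calc |u' (z.1, σ * z.1 + τ) (1, σ)| ^ p
        ≤ (G (z.1, σ * z.1 + τ) * √(1 + σ ^ 2)) ^ p := Real.rpow_le_rpow (abs_nonneg _) h3 hp0
      _ = √(1 + σ ^ 2) ^ p * G (z.1, σ * z.1 + τ) ^ p := by
          rw [Real.mul_rpow (h.nonneg _) (by positivity), mul_comm]
      _ ≤ √(1 + σ ^ 2) ^ p * (G z ^ p + ω / 2 ^ p) := by gcongr
      _ ≤ √(1 + σ ^ 2) ^ p * G z ^ p + ω := by
          rw [mul_add]
          have : √(1 + σ ^ 2) ^ p * (ω / 2 ^ p) ≤ 2 ^ p * (ω / 2 ^ p) := by gcongr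
          rw [mul_div_cancel₀ _ h2p.ne'] at this
          linarith

end GradBound

/-- In the frame of a nearly maximal segment, the heights of the endpoints of a second nearly
maximal segment have a small product. -/
theorem mul_heights_le_of_frame {ℓ P Q c d ξ : ℝ} (hξ : 0 ≤ ξ) (hξ1 : ξ ≤ 1) (hℓ1 : 1 - ξ ≤ ℓ)
    (h1 : (ℓ - Q) ^ 2 + d ^ 2 ≤ 1) (h2 : (ℓ - P) ^ 2 + c ^ 2 ≤ 1)
    (h3 : (1 - ξ) ^ 2 ≤ (ℓ - P - Q) ^ 2 + (d - c) ^ 2) (h4 : 1 / 2 ≤ ℓ - P - Q) :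
    c * d ≤ 3 * ξ := by
  have hℓ2 : (1 - ξ) ^ 2 ≤ ℓ ^ 2 := pow_le_pow_left₀ (by linarith) hℓ1 2
  have hX : c * d ≤ 2 * ξ + P * Q := by linarith [sq_nonneg ξ]
  rcases le_or_gt (P * Q) 0 with hPQ | hPQ
  · linarith
  rcases pos_and_pos_or_neg_and_neg_of_mul_pos hPQ with ⟨hP, hQ⟩ | ⟨hP, hQ⟩
  · by_contra! hcon
    have hξs := sq_nonneg ξ
    have hP2 : P * (2 * ℓ - 2 * Q - P) ≤ 2 * ξ + c ^ 2 - 2 * (c * d) := by linarith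
    have hQ2 : Q * (2 * ℓ - 2 * P - Q) ≤ 2 * ξ + d ^ 2 - 2 * (c * d) := by linarith
    have hP3 : P * 1 ≤ P * (2 * ℓ - 2 * Q - P) :=
      mul_le_mul_of_nonneg_left (by linarith) hP.le
    have hQ3 : Q * 1 ≤ Q * (2 * ℓ - 2 * P - Q) :=
      mul_le_mul_of_nonneg_left (by linarith) hQ.le
    have hP3 : P ≤ c ^ 2 - c * d := by linarith
    have hQ3 : Q ≤ d ^ 2 - c * d := by linarith
    have h5 : P * Q ≤ (c ^ 2 - c * d) * (d ^ 2 - c * d) :=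
      mul_le_mul hP3 hQ3 hQ.le (hP.le.trans hP3)
    have hcd : 0 ≤ c * d := by linarith
    nlinarith [mul_nonneg hcd (sq_nonneg (c - d))]
  · have hle : ∀ s t : ℝ, s ^ 2 + t ^ 2 ≤ 1 → s ≤ 1 := fun s t h =>
      (abs_le.1 (abs_le_one_iff_mul_self_le_one.2 (by nlinarith))).2
    have e1 := hle _ _ h1
    have e2 := hle _ _ h2
    have e3 : -P * -Q ≤ ξ * 1 :=
      mul_le_mul (by linarith) (by linarith) (by linarith) hξ
    linarith

/-- Two nearly maximal segments in a set of diameter at most one cannot be nearly parallel and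
far from crossing. -/
theorem mul_cross_le {a1 a2 b1 b2 c1 c2 d1 d2 ξ : ℝ} (hξ : 0 ≤ ξ) (hξ1 : ξ < 1)
    (hab : (b1 - a1) ^ 2 + (b2 - a2) ^ 2 ≤ 1) (had : (d1 - a1) ^ 2 + (d2 - a2) ^ 2 ≤ 1)
    (hbc : (b1 - c1) ^ 2 + (b2 - c2) ^ 2 ≤ 1)
    (hab' : (1 - ξ) ^ 2 ≤ (b1 - a1) ^ 2 + (b2 - a2) ^ 2)
    (hcd' : (1 - ξ) ^ 2 ≤ (d1 - c1) ^ 2 + (d2 - c2) ^ 2)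
    (hdir : 1 / 2 ≤ (b1 - a1) * (d1 - c1) + (b2 - a2) * (d2 - c2)) :
    ((b1 - a1) * (c2 - a2) - (b2 - a2) * (c1 - a1)) *
      ((b1 - a1) * (d2 - a2) - (b2 - a2) * (d1 - a1)) ≤ 3 * ξ := by
  set N := (b1 - a1) ^ 2 + (b2 - a2) ^ 2 with hN
  set ℓ := √N with hℓ
  have hN0 : 0 < N := (pow_pos (by linarith) 2).trans_le hab'
  have hℓ0 : 0 < ℓ := Real.sqrt_pos.2 hN0
  have hℓN : ℓ ^ 2 = N := Real.sq_sqrt hN0.le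
  have hℓ1 : ℓ ≤ 1 := Real.sqrt_le_one.2 hab
  have hℓ2 : 1 - ξ ≤ ℓ := Real.le_sqrt_of_sq_le hab'
  set Tc := (b1 - a1) * (c2 - a2) - (b2 - a2) * (c1 - a1) with hTc
  set Td := (b1 - a1) * (d2 - a2) - (b2 - a2) * (d1 - a1) with hTd
  set sc := (b1 - a1) * (c1 - a1) + (b2 - a2) * (c2 - a2) with hsc
  set sd := (b1 - a1) * (d1 - a1) + (b2 - a2) * (d2 - a2) with hsd
  have key : Tc / ℓ * (Td / ℓ) ≤ 3 * ξ := by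
    refine mul_heights_le_of_frame (ℓ := ℓ) (P := sc / ℓ) (Q := ℓ - sd / ℓ) hξ hξ1.le hℓ2
      ?_ ?_ ?_ ?_
    · have : (ℓ - (ℓ - sd / ℓ)) ^ 2 + (Td / ℓ) ^ 2 = (d1 - a1) ^ 2 + (d2 - a2) ^ 2 := by
        rw [sub_sub_cancel, div_pow, div_pow, ← add_div, hℓN, div_eq_iff hN0.ne']
        rw [hN, hsd, hTd]; ring
      rw [this]; exact had
    · have : (ℓ - sc / ℓ) ^ 2 + (Tc / ℓ) ^ 2 = (b1 - c1) ^ 2 + (b2 - c2) ^ 2 := by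
        have e : ℓ - sc / ℓ = (N - sc) / ℓ := by rw [← hℓN]; field_simp
        rw [e, div_pow, div_pow, ← add_div, hℓN, div_eq_iff hN0.ne']
        rw [hN, hsc, hTc]; ring
      rw [this]; exact hbc
    · have : (ℓ - sc / ℓ - (ℓ - sd / ℓ)) ^ 2 + (Td / ℓ - Tc / ℓ) ^ 2 =
          (d1 - c1) ^ 2 + (d2 - c2) ^ 2 := by
        have e : ℓ - sc / ℓ - (ℓ - sd / ℓ) = (sd - sc) / ℓ := by ring
        rw [e, ← sub_div, div_pow, div_pow, ← add_div, hℓN, div_eq_iff hN0.ne']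
        rw [hN, hsc, hTc, hsd, hTd]; ring
      rw [this]; exact hcd'
    · have e : ℓ - sc / ℓ - (ℓ - sd / ℓ) = (sd - sc) / ℓ := by ring
      rw [e, le_div_iff₀ hℓ0]
      have : sd - sc = (b1 - a1) * (d1 - c1) + (b2 - a2) * (d2 - c2) := by rw [hsd, hsc]; ring
      rw [this]; linarith
  have e : Tc / ℓ * (Td / ℓ) = Tc * Td / N := by rw [← hℓN]; field_simp
  rw [e, div_le_iff₀ hN0] at key
  have : 3 * ξ * N ≤ 3 * ξ * 1 := mul_le_mul_of_nonneg_left hab (by linarith)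
  linarith

/-- The Euclidean distance of two points of a thin strip is almost given by the line. -/
theorem sq_mul_le_of_strip {z1 z2 w1 w2 σ τ ε : ℝ} (hz : |z2 - (σ * z1 + τ)| ≤ ε)
    (hw : |w2 - (σ * w1 + τ)| ≤ ε) (hσ : σ ^ 2 ≤ 1) (hk : |w1 - z1| ≤ 1) :
    (w1 - z1) ^ 2 * (1 + σ ^ 2) ≤ (w1 - z1) ^ 2 + (w2 - z2) ^ 2 + 4 * ε := by
  set k := w1 - z1 with hkd
  set e := (w2 - (σ * w1 + τ)) - (z2 - (σ * z1 + τ)) with he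
  have h1 : |e| ≤ 2 * ε := (abs_sub _ _).trans (by linarith)
  have h2 : w2 - z2 = σ * k + e := by rw [he, hkd]; ring
  have h3 : |σ * k| ≤ 1 := by
    rw [abs_mul]
    exact mul_le_one₀ (abs_le_one_iff_mul_self_le_one.2 (by nlinarith)) (abs_nonneg _) hk
  have h4 : |σ * k * e| ≤ 2 * ε := by
    rw [abs_mul]
    nlinarith [abs_nonneg e, abs_nonneg (σ * k)]
  rw [h2]
  nlinarith [(abs_le.1 h4).1, sq_nonneg e]

theorem cross_ge_of_strip {a1 a2 b1 b2 c1 c2 σ τ σ' τ' ε : ℝ} (ha : |a2 - (σ * a1 + τ)| ≤ ε)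
    (hb : |b2 - (σ * b1 + τ)| ≤ ε) (hc : |c2 - (σ' * c1 + τ')| ≤ ε) (hab : 3 / 4 ≤ b1 - a1)
    (hab1 : b1 - a1 ≤ 1) (hca : |c1 - a1| ≤ 1) (hg : 0 ≤ (σ' * c1 + τ') - (σ * c1 + τ)) :
    3 / 4 * ((σ' * c1 + τ') - (σ * c1 + τ)) - 4 * ε ≤
      (b1 - a1) * (c2 - a2) - (b2 - a2) * (c1 - a1) := by
  set g := (σ' * c1 + τ') - (σ * c1 + τ) with hgd
  set ea := a2 - (σ * a1 + τ) with hea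
  set eb := b2 - (σ * b1 + τ) with heb
  set ec := c2 - (σ' * c1 + τ') with hec
  have e1 : (b1 - a1) * (c2 - a2) - (b2 - a2) * (c1 - a1) =
      (b1 - a1) * g + (b1 - a1) * (ec - ea) - (eb - ea) * (c1 - a1) := by
    rw [hgd, hea, heb, hec]; ring
  have e2 : |(b1 - a1) * (ec - ea)| ≤ 2 * ε := by
    rw [abs_mul, abs_of_pos (by linarith : 0 < b1 - a1)]
    have : |ec - ea| ≤ 2 * ε := (abs_sub _ _).trans (by linarith)
    nlinarith [abs_nonneg (ec - ea)]
  have e3 : |(eb - ea) * (c1 - a1)| ≤ 2 * ε := by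
    rw [abs_mul]
    have : |eb - ea| ≤ 2 * ε := (abs_sub _ _).trans (by linarith)
    nlinarith [abs_nonneg (eb - ea), abs_nonneg (c1 - a1)]
  rw [e1]
  nlinarith [(abs_le.1 e2).1, (abs_le.1 e3).2]

theorem affine_ge_of_gap {κ t xL xR x ρ H ε : ℝ} (hρ : 0 < ρ) (hρ1 : ρ ≤ 1 / 16)
    (hε : ε ≤ ρ * H) (hε0 : 0 ≤ ε) (hLR : 1 / 2 ≤ xR - xL)
    (hL : 30 * (ρ * H) - 2 * ε ≤ κ * xL + t) (hL' : κ * xL + t ≤ H + 2 * ε)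
    (hR : 30 * (ρ * H) - 2 * ε ≤ κ * xR + t) (hR' : κ * xR + t ≤ H + 2 * ε)
    (hx : |x - xL| ≤ ρ ∨ |x - xR| ≤ ρ) : 20 * (ρ * H) ≤ κ * x + t := by
  have hρH : 0 ≤ ρ * H := hε0.trans hε
  have hH : 0 ≤ H := nonneg_of_mul_nonneg_right hρH hρ
  have hκ : |κ| * (1 / 2) ≤ H + 4 * ε := by
    calc |κ| * (1 / 2) ≤ |κ| * |xR - xL| :=
          mul_le_mul_of_nonneg_left (hLR.trans (le_abs_self _)) (abs_nonneg _)
      _ = |κ * (xR - xL)| := (abs_mul _ _).symm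
      _ ≤ H + 4 * ε := abs_le.2 ⟨by linarith, by linarith⟩
  have hb : ∀ y, |x - y| ≤ ρ → κ * y - 4 * (ρ * H) ≤ κ * x := by
    intro y hy
    have h1 : |κ * (x - y)| ≤ 4 * (ρ * H) := by
      rw [abs_mul]
      calc |κ| * |x - y| ≤ (2 * (H + 4 * ε)) * ρ :=
            mul_le_mul (by linarith) hy (abs_nonneg _) (by positivity)
        _ ≤ 4 * (ρ * H) := by
            have h2 : ρ * H ≤ 1 / 16 * H := mul_le_mul_of_nonneg_right hρ1 hH
            have h3 : ρ * (4 * ε) ≤ ρ * H := mul_le_mul_of_nonneg_left (by linarith) hρ.le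
            linarith
    linarith [(abs_le.1 h1).1, mul_sub κ x y]
  rcases hx with hx | hx
  · linarith [hb _ hx]
  · linarith [hb _ hx]

/-- Two thin strips, both containing nearly maximal segments, cannot be separated at both ends. -/
theorem false_of_gap {ρ H ξ ε xL xR σ τ σ' τ' : ℝ} {a b c d : ℝ × ℝ} (hρ : 0 < ρ)
    (hρ1 : ρ ≤ 1 / 16) (hH : 0 < H) (hε : ε ≤ ρ * H) (hε0 : 0 ≤ ε) (hε1 : ε ≤ 1 / 100)
    (hξ : 0 ≤ ξ) (hξ1 : ξ ≤ 1 / 8) (hξH : ξ ≤ (ρ * H) ^ 2)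
    (hσ : |σ| ≤ 1 / 8) (hσ' : |σ'| ≤ 1 / 8) (hLR : 1 / 2 ≤ xR - xL)
    (ha : |a.2 - (σ * a.1 + τ)| ≤ ε) (hb : |b.2 - (σ * b.1 + τ)| ≤ ε)
    (hc : |c.2 - (σ' * c.1 + τ')| ≤ ε) (hd : |d.2 - (σ' * d.1 + τ')| ≤ ε)
    (hL : 30 * (ρ * H) - 2 * ε ≤ (σ' * xL + τ') - (σ * xL + τ))
    (hL' : (σ' * xL + τ') - (σ * xL + τ) ≤ H + 2 * ε)
    (hR : 30 * (ρ * H) - 2 * ε ≤ (σ' * xR + τ') - (σ * xR + τ))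
    (hR' : (σ' * xR + τ') - (σ * xR + τ) ≤ H + 2 * ε)
    (hcL : |c.1 - xL| ≤ ρ) (hdR : |d.1 - xR| ≤ ρ)
    (hab : 3 / 4 ≤ b.1 - a.1) (hcd : 3 / 4 ≤ d.1 - c.1)
    (dab : (b.1 - a.1) ^ 2 + (b.2 - a.2) ^ 2 ≤ 1) (dad : (d.1 - a.1) ^ 2 + (d.2 - a.2) ^ 2 ≤ 1)
    (dbc : (b.1 - c.1) ^ 2 + (b.2 - c.2) ^ 2 ≤ 1) (dac : (c.1 - a.1) ^ 2 + (c.2 - a.2) ^ 2 ≤ 1)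
    (dcd : (d.1 - c.1) ^ 2 + (d.2 - c.2) ^ 2 ≤ 1)
    (lab : (1 - 2 * ξ) ^ 2 ≤ (b.1 - a.1) ^ 2 + (b.2 - a.2) ^ 2)
    (lcd : (1 - 2 * ξ) ^ 2 ≤ (d.1 - c.1) ^ 2 + (d.2 - c.2) ^ 2) : False := by
  have habs : ∀ s t : ℝ, s ^ 2 + t ^ 2 ≤ 1 → |s| ≤ 1 := fun s t h =>
    abs_le_one_iff_mul_self_le_one.2 (by nlinarith)
  have hρH : 0 < ρ * H := by positivity
  have hg : ∀ x, (|x - xL| ≤ ρ ∨ |x - xR| ≤ ρ) →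
      20 * (ρ * H) ≤ (σ' * x + τ') - (σ * x + τ) := by
    intro x hx
    have := affine_ge_of_gap (κ := σ' - σ) (t := τ' - τ) (x := x) hρ hρ1 hε hε0 hLR
      (by linarith) (by linarith) (by linarith) (by linarith) hx
    linarith
  have g1 := hg _ (Or.inl hcL)
  have g2 := hg _ (Or.inr hdR)
  have hab1 := (abs_le.1 (habs _ _ dab)).2
  have t1 := cross_ge_of_strip ha hb hc hab hab1 (habs _ _ dac) (by linarith)
  have t2 := cross_ge_of_strip ha hb hd hab hab1 (habs _ _ dad) (by linarith)
  have hsnd : ∀ {z w : ℝ × ℝ} {s t : ℝ}, |s| ≤ 1 / 8 → |z.2 - (s * z.1 + t)| ≤ ε →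
      |w.2 - (s * w.1 + t)| ≤ ε → |w.1 - z.1| ≤ 1 → |w.2 - z.2| ≤ 1 / 5 := by
    intro z w s t hs hz hw hk
    have e : |s * (w.1 - z.1)| ≤ 1 / 8 := by
      rw [abs_mul]
      exact (mul_le_mul hs hk (abs_nonneg _) (by norm_num)).trans (by norm_num)
    have := abs_le.1 hz
    have := abs_le.1 hw
    have := abs_le.1 e
    exact abs_le.2 ⟨by linarith, by linarith⟩
  have s1 := hsnd hσ ha hb (habs _ _ dab)
  have s2 := hsnd hσ' hc hd (habs _ _ dcd)
  have s3 : |(b.2 - a.2) * (d.2 - c.2)| ≤ 1 / 16 := by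
    rw [abs_mul]
    exact (mul_le_mul s1 s2 (abs_nonneg _) (by norm_num)).trans (by norm_num)
  have hdir : 1 / 2 ≤ (b.1 - a.1) * (d.1 - c.1) + (b.2 - a.2) * (d.2 - c.2) := by
    have s4 : (3 / 4 : ℝ) * (3 / 4) ≤ (b.1 - a.1) * (d.1 - c.1) :=
      mul_le_mul hab hcd (by norm_num) (by linarith)
    linarith [(abs_le.1 s3).1]
  have key := mul_cross_le (ξ := 2 * ξ) (by linarith) (by linarith) dab dad dbc lab lcd hdir
  have hT : (11 * (ρ * H)) * (11 * (ρ * H)) ≤ 3 * (2 * ξ) :=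
    (mul_le_mul (by linarith) (by linarith) (by positivity) (by linarith)).trans key
  have := pow_pos hρH 2
  linarith

/-- Disjoint convex sets keep their vertical order. -/
theorem lt_of_disjoint_convex {C C' : Set (ℝ × ℝ)} (hc : Convex ℝ C) (hc' : Convex ℝ C')
    (hd : Disjoint C C') {x x' y y' z z' : ℝ} (hy : (x, y) ∈ C) (hz : (x', z) ∈ C)
    (hy' : (x, y') ∈ C') (hz' : (x', z') ∈ C') (h : y < y') : z < z' := by
  by_contra! hzz
  have hD : 0 < (y' - y) + (z - z') := by linarith
  set l := (y' - y) / ((y' - y) + (z - z')) with hl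
  have hl0 : 0 ≤ l := div_nonneg (by linarith) hD.le
  have hl1 : l ≤ 1 := (div_le_one hD).2 (by linarith)
  have e : l * ((y' - y) + (z - z')) = y' - y := div_mul_cancel₀ _ hD.ne'
  have m1 := convex_combo_mem_slice hc hy hz (sub_nonneg.2 hl1) hl0 (by ring)
  have m2 := convex_combo_mem_slice hc' hy' hz' (sub_nonneg.2 hl1) hl0 (by ring)
  have e2 : (1 - l) * y + l * z = (1 - l) * y' + l * z' := by linarith
  rw [e2] at m1
  exact disjoint_left.1 hd m1 m2

section Pairs

variable {ι : Type*} {g : Set ι} {C : ι → Set (ℝ × ℝ)} {x x' : ℝ}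

theorem exists_lower (hc : ∀ i ∈ g, Convex ℝ (C i)) (hd : g.PairwiseDisjoint C)
    (hx : ∀ i ∈ g, ∃ y, (x, y) ∈ C i) (hx' : ∀ i ∈ g, ∃ y, (x', y) ∈ C i) {i k : ι} (hi : i ∈ g)
    (hk : k ∈ g) {y z : ℝ} (hy : (x, y) ∈ C i) (hz : (x', z) ∈ C k) :
    ∃ a ∈ g, ∃ s t, (x, s) ∈ C a ∧ (x', t) ∈ C a ∧ s ≤ y ∧ t ≤ z := by
  obtain ⟨t, ht⟩ := hx' i hi
  obtain ⟨s, hs⟩ := hx k hk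
  by_cases hik : i = k
  · subst hik
    exact ⟨i, hi, y, z, hy, hz, le_rfl, le_rfl⟩
  rcases le_or_gt t z with h | h
  · exact ⟨i, hi, y, t, hy, ht, le_rfl, h⟩
  · exact ⟨k, hk, s, z, hs, hz,
      (lt_of_disjoint_convex (hc k hk) (hc i hi) (hd hk hi (Ne.symm hik)) hz hs ht hy h).le, le_rfl⟩

theorem exists_upper (hc : ∀ i ∈ g, Convex ℝ (C i)) (hd : g.PairwiseDisjoint C)
    (hx : ∀ i ∈ g, ∃ y, (x, y) ∈ C i) (hx' : ∀ i ∈ g, ∃ y, (x', y) ∈ C i) {i k : ι} (hi : i ∈ g)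
    (hk : k ∈ g) {y z : ℝ} (hy : (x, y) ∈ C i) (hz : (x', z) ∈ C k) :
    ∃ a ∈ g, ∃ s t, (x, s) ∈ C a ∧ (x', t) ∈ C a ∧ y ≤ s ∧ z ≤ t := by
  obtain ⟨t, ht⟩ := hx' i hi
  obtain ⟨s, hs⟩ := hx k hk
  by_cases hik : i = k
  · subst hik
    exact ⟨i, hi, y, z, hy, hz, le_rfl, le_rfl⟩
  rcases le_or_gt z t with h | h
  · exact ⟨i, hi, y, t, hy, ht, le_rfl, h⟩
  · exact ⟨k, hk, s, z, hs, hz,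
      (lt_of_disjoint_convex (hc i hi) (hc k hk) (hd hi hk hik) ht hy hz hs h).le, le_rfl⟩

end Pairs

/-- If the slices of disjoint cells have large total length, two of their points are far apart. -/
theorem exists_far_of_lt_sum_chord {ι : Type*} {g : Finset ι} {C : ι → Set (ℝ × ℝ)}
    (ho : ∀ i ∈ g, IsOpen (C i)) (hb : ∀ i ∈ g, Bornology.IsBounded (C i))
    (hd : (g : Set ι).PairwiseDisjoint C) {x B : ℝ} (hB : 0 ≤ B)
    (h : B < ∑ i ∈ g, chord (C i) x) :
    ∃ i ∈ g, ∃ j ∈ g, ∃ y y', (x, y) ∈ C i ∧ (x, y') ∈ C j ∧ B < y' - y := by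
  by_contra! hcon
  have hU : volume.real (⋃ i ∈ g, slice (C i) x) = ∑ i ∈ g, chord (C i) x := by
    refine measureReal_biUnion_finset (fun i hi j hj hij => ?_) (fun i hi =>
      (isOpen_slice (ho i hi) x).measurableSet) fun i hi =>
        (isBounded_slice (hb i hi) x).measure_lt_top.ne
    exact (hd hi hj hij).preimage _
  have hle : volume (⋃ i ∈ g, slice (C i) x) ≤ ENNReal.ofReal B := by
    refine (Real.volume_le_diam _).trans ?_
    refine Metric.ediam_le fun y hy y' hy' => ?_
    simp only [mem_iUnion] at hy hy'
    obtain ⟨i, hi, hyi⟩ := hy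
    obtain ⟨j, hj, hyj⟩ := hy'
    rw [edist_dist, Real.dist_eq]
    exact ENNReal.ofReal_le_ofReal (abs_le.2 ⟨by linarith [hcon i hi j hj y y' hyi hyj],
      hcon j hj i hi y' y hyj hyi⟩)
  have := ENNReal.toReal_mono ENNReal.ofReal_ne_top hle
  rw [ENNReal.toReal_ofReal hB] at this
  change volume.real _ ≤ B at this
  linarith

/-- A cell in a thin strip which is nearly as long as possible, spans the interval `(X0, X1)` up to
small pieces at the ends, and whose marginal does not decay quickly towards either end. -/
structure LongCell (ρ ξ ε X0 X1 : ℝ) (m : ℕ) (C : Set (ℝ × ℝ)) (φ : ℝ × ℝ → ℝ) (σ τ x0 x1 : ℝ) :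
    Prop extends WeightedConvex m C φ where
  strip : ∀ z ∈ C, |z.2 - (σ * z.1 + τ)| ≤ ε
  fst_image : Prod.fst '' C = Ioo x0 x1
  slope_le : |σ| ≤ 1 / 8
  long : 1 - ξ ≤ (x1 - x0) * √(1 + σ ^ 2)
  left_ge : X0 ≤ x0
  left_le : x0 ≤ X0 + ρ / 4
  right_ge : X1 - ρ / 4 ≤ x1
  right_le : x1 ≤ X1
  marginal_left : ∀ a b, x0 < a → a ≤ b → b < x1 - ρ / 2 →
    marginal C φ a ≤ Real.exp 2 * marginal C φ b
  marginal_right : ∀ a b, x0 + ρ / 2 < a → a ≤ b → b < x1 →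
    marginal C φ b ≤ Real.exp 2 * marginal C φ a

theorem sub_le_chord {Ω : Set (ℝ × ℝ)} (hc : Convex ℝ Ω) (hb : Bornology.IsBounded Ω)
    {x y y' : ℝ} (hy : (x, y) ∈ Ω) (hy' : (x, y') ∈ Ω) : y' - y ≤ chord Ω x := by
  rcases le_total y' y with h | h
  · exact (sub_nonpos.2 h).trans (chord_nonneg _ _)
  · rw [← Real.volume_real_Icc_of_le h]
    exact measureReal_mono ((ordConnected_slice hc x).out hy hy')
      (isBounded_slice hb x).measure_lt_top.ne

namespace LongCell

variable {ρ ξ ε X0 X1 : ℝ} {m : ℕ} {φ : ℝ × ℝ → ℝ}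

theorem len_ge {C : Set (ℝ × ℝ)} {σ τ x0 x1 : ℝ}
    (h : LongCell ρ ξ ε X0 X1 m C φ σ τ x0 x1) (hξ1 : ξ ≤ 1 / 16) : 9 / 10 ≤ x1 - x0 := by
  have h1 := h.long
  have hs : √(1 + σ ^ 2) ≤ 65 / 64 := by
    refine Real.sqrt_le_iff.2 ⟨by norm_num, ?_⟩
    have := (abs_le.1 h.slope_le)
    nlinarith
  have hs0 : 0 < √(1 + σ ^ 2) := by positivity
  by_contra! hlt
  have h2 : (x1 - x0) * √(1 + σ ^ 2) ≤ 9 / 10 * √(1 + σ ^ 2) :=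
    mul_le_mul_of_nonneg_right hlt.le hs0.le
  linarith

/-- A long cell contains a nearly maximal segment. -/
theorem exists_segment {Ω C : Set (ℝ × ℝ)} {σ τ x0 x1 : ℝ}
    (h : LongCell ρ ξ ε X0 X1 m C φ σ τ x0 x1) (hξ : 0 < ξ) (hξ1 : ξ ≤ 1 / 16) (hξρ : ξ ≤ ρ) (hεξ : ε ≤ ξ / 8) (hC : C ⊆ Ω)
    (hdiam : ∀ z ∈ Ω, ∀ w ∈ Ω, (w.1 - z.1) ^ 2 + (w.2 - z.2) ^ 2 ≤ 1) :
    ∃ a ∈ C, ∃ b ∈ C, 3 / 4 ≤ b.1 - a.1 ∧ |a.1 - (X0 + ρ)| ≤ ρ ∧ |b.1 - (X1 - ρ)| ≤ ρ ∧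
      (1 - 2 * ξ) ^ 2 ≤ (b.1 - a.1) ^ 2 + (b.2 - a.2) ^ 2 := by
  have hlen := h.len_ge hξ1
  have ha : x0 + ξ / 16 ∈ Prod.fst '' C := by
    rw [h.fst_image]; exact ⟨by linarith, by linarith⟩
  have hb : x1 - ξ / 16 ∈ Prod.fst '' C := by
    rw [h.fst_image]; exact ⟨by linarith, by linarith⟩
  obtain ⟨a, haC, ea⟩ := ha
  obtain ⟨b, hbC, eb⟩ := hb
  have g1 := h.left_ge
  have g2 := h.left_le
  have g3 := h.right_ge
  have g4 := h.right_le
  have hk : b.1 - a.1 = x1 - x0 - ξ / 8 := by rw [ea, eb]; ring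
  refine ⟨a, haC, b, hbC, by linarith, abs_le.2 ⟨by linarith, by linarith⟩,
    abs_le.2 ⟨by linarith, by linarith⟩, ?_⟩
  have hd := hdiam a (hC haC) b (hC hbC)
  have hk1 : |b.1 - a.1| ≤ 1 := abs_le_one_iff_mul_self_le_one.2 (by nlinarith)
  have hσ := abs_le.1 h.slope_le
  have hs := sq_mul_le_of_strip (h.strip a haC) (h.strip b hbC) (by nlinarith) hk1
  have hsq : √(1 + σ ^ 2) ^ 2 = 1 + σ ^ 2 := Real.sq_sqrt (by positivity)
  have hs2 : √(1 + σ ^ 2) ≤ 2 := Real.sqrt_le_iff.2 ⟨by norm_num, by nlinarith⟩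
  have h1 : 1 - 5 / 4 * ξ ≤ (b.1 - a.1) * √(1 + σ ^ 2) := by
    rw [hk, sub_mul]
    have : ξ / 8 * √(1 + σ ^ 2) ≤ ξ / 8 * 2 := mul_le_mul_of_nonneg_left hs2 (by linarith)
    linarith [h.long]
  have h2 := pow_le_pow_left₀ (by linarith) h1 2
  rw [mul_pow, hsq] at h2
  nlinarith

/-- Disjoint long cells are concentrated near a single line. -/
theorem sum_chord_le {ι : Type*} {g : Finset ι} {C : ι → Set (ℝ × ℝ)} {σ τ x0 x1 : ι → ℝ}
    {Ω : Set (ℝ × ℝ)} (hΩc : Convex ℝ Ω) (hΩb : Bornology.IsBounded Ω)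
    (hdiam : ∀ z ∈ Ω, ∀ w ∈ Ω, (w.1 - z.1) ^ 2 + (w.2 - z.2) ^ 2 ≤ 1)
    (h : ∀ i ∈ g, LongCell ρ ξ ε X0 X1 m (C i) φ (σ i) (τ i) (x0 i) (x1 i))
    (hC : ∀ i ∈ g, C i ⊆ Ω) (hd : (g : Set ι).PairwiseDisjoint C) {H : ℝ} (hH : 0 < H)
    (hΩH : ∀ x, chord Ω x ≤ H) (hρ : 0 < ρ) (hρ1 : ρ ≤ 1 / 16) (hξ : 0 < ξ) (hξ1 : ξ ≤ 1 / 16)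
    (hξρ : ξ ≤ ρ) (hξH : ξ ≤ (ρ * H) ^ 2) (hε0 : 0 ≤ ε) (hεξ : ε ≤ ξ / 8) (hεH : ε ≤ ρ * H)
    {x : ℝ} (hx : x ∈ Icc (X0 + ρ) (X1 - ρ)) :
    ∑ i ∈ g, chord (C i) x ≤ 2 ^ (m + 1) * Real.exp 2 * (30 * (ρ * H)) := by
  set xL := X0 + ρ with hxL
  set xR := X1 - ρ with hxR
  have hρH : 0 < ρ * H := by positivity
  have hmem : ∀ i ∈ g, ∀ s ∈ Icc xL xR, s ∈ Prod.fst '' C i := by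
    intro i hi s hs
    rw [(h i hi).fst_image]
    exact ⟨by linarith [hs.1, (h i hi).left_le], by linarith [hs.2, (h i hi).right_ge]⟩
  have hxLR : xL ≤ xR := hx.1.trans hx.2
  have hL : ∑ i ∈ g, chord (C i) x ≤ 2 ^ (m + 1) * Real.exp 2 * ∑ i ∈ g, chord (C i) xL := by
    rw [Finset.mul_sum]
    refine Finset.sum_le_sum fun i hi => ?_
    refine (h i hi).chord_le_of_marginal_le (hmem i hi _ ⟨le_rfl, hxLR⟩) (Real.exp_pos _).le
      ((h i hi).marginal_right _ _ ?_ ?_ ?_)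
    · linarith [(h i hi).left_le]
    · linarith [hx.1]
    · linarith [hx.2, (h i hi).right_ge]
  have hR : ∑ i ∈ g, chord (C i) x ≤ 2 ^ (m + 1) * Real.exp 2 * ∑ i ∈ g, chord (C i) xR := by
    rw [Finset.mul_sum]
    refine Finset.sum_le_sum fun i hi => ?_
    refine (h i hi).chord_le_of_marginal_le (hmem i hi _ ⟨hxLR, le_rfl⟩) (Real.exp_pos _).le
      ((h i hi).marginal_left _ _ ?_ ?_ ?_)
    · linarith [(h i hi).left_le, hx.1]
    · linarith [hx.2]
    · linarith [(h i hi).right_ge]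
  by_contra! hcon
  have hpos : (0 : ℝ) < 2 ^ (m + 1) * Real.exp 2 := by positivity
  have hL' : 30 * (ρ * H) < ∑ i ∈ g, chord (C i) xL :=
    lt_of_mul_lt_mul_left (hcon.trans_le hL) hpos.le
  have hR' : 30 * (ρ * H) < ∑ i ∈ g, chord (C i) xR :=
    lt_of_mul_lt_mul_left (hcon.trans_le hR) hpos.le
  have ho : ∀ i ∈ g, IsOpen (C i) := fun i hi => (h i hi).isOpen
  have hb : ∀ i ∈ g, Bornology.IsBounded (C i) := fun i hi => (h i hi).isBounded
  obtain ⟨i, hi, j, hj, y, y', hyi, hyj, hyy⟩ :=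
    exists_far_of_lt_sum_chord ho hb hd (by positivity) hL'
  obtain ⟨k, hk, l, hl, z, z', hzk, hzl, hzz⟩ :=
    exists_far_of_lt_sum_chord ho hb hd (by positivity) hR'
  have hc : ∀ i ∈ (g : Set ι), Convex ℝ (C i) := fun i hi => (h i hi).convex
  have hpt : ∀ s ∈ Icc xL xR, ∀ i ∈ (g : Set ι), ∃ y, (s, y) ∈ C i := fun s hs i hi =>
    slice_nonempty_iff.2 (hmem i hi s hs)
  obtain ⟨a, ha, ya, za, hya, hza, hya', hza'⟩ := exists_lower hc hd (hpt xL ⟨le_rfl, hxLR⟩)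
    (hpt xR ⟨hxLR, le_rfl⟩) hi hk hyi hzk
  obtain ⟨b, hb', yb, zb, hyb, hzb, hyb', hzb'⟩ := exists_upper hc hd (hpt xL ⟨le_rfl, hxLR⟩)
    (hpt xR ⟨hxLR, le_rfl⟩) hj hl hyj hzl
  obtain ⟨P, hP, Q, hQ, hPQ, -, -, lPQ⟩ := (h a ha).exists_segment hξ hξ1 hξρ hεξ (hC a ha) hdiam
  obtain ⟨R, hR, T, hT, hRT, hRL, hTR, lRT⟩ :=
    (h b hb').exists_segment hξ hξ1 hξρ hεξ (hC b hb') hdiam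
  have hLy := (sub_le_chord hΩc hΩb (hC a ha hya) (hC b hb' hyb)).trans (hΩH _)
  have hRz := (sub_le_chord hΩc hΩb (hC a ha hza) (hC b hb' hzb)).trans (hΩH _)
  have s1 := abs_le.1 ((h a ha).strip _ hya)
  have s2 := abs_le.1 ((h b hb').strip _ hyb)
  have s3 := abs_le.1 ((h a ha).strip _ hza)
  have s4 := abs_le.1 ((h b hb').strip _ hzb)
  have hlen : 1 / 2 ≤ xR - xL := by
    linarith [(h a ha).len_ge hξ1, (h a ha).left_ge, (h a ha).right_le]
  exact false_of_gap hρ hρ1 hH hεH hε0 (by linarith) hξ.le (by linarith) hξH (h a ha).slope_le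
    (h b hb').slope_le hlen ((h a ha).strip P hP) ((h a ha).strip Q hQ) ((h b hb').strip R hR)
    ((h b hb').strip T hT) (by linarith [s1.1, s1.2, s2.1, s2.2])
    (by linarith [s1.1, s1.2, s2.1, s2.2]) (by linarith [s3.1, s3.2, s4.1, s4.2])
    (by linarith [s3.1, s3.2, s4.1, s4.2]) hRL hTR hPQ hRT
    (hdiam P (hC a ha hP) Q (hC a ha hQ)) (hdiam P (hC a ha hP) T (hC b hb' hT))
    (hdiam R (hC b hb' hR) Q (hC a ha hQ)) (hdiam P (hC a ha hP) R (hC b hb' hR))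
    (hdiam R (hC b hb' hR) T (hC b hb' hT)) lPQ lRT

end LongCell

/-- Total mass of disjoint cells over an interval, when the cells have small total slices. -/
theorem WeightedConvex.sum_mass_le {m : ℕ} {Ω : Set (ℝ × ℝ)} {φ : ℝ × ℝ → ℝ}
    (hΩ : WeightedConvex m Ω φ) {p : ℝ} (hp : 1 < p) {u G : ℝ × ℝ → ℝ}
    {u' : ℝ × ℝ → ℝ × ℝ →L[ℝ] ℝ} (hu : GradBound u u' G) {ι : Type*} {g : Finset ι}
    {C : ι → Set (ℝ × ℝ)} (ho : ∀ i ∈ g, IsOpen (C i)) (hC : ∀ i ∈ g, C i ⊆ Ω) {J : Set ℝ}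
    (hJm : MeasurableSet J) {κ B : ℝ} (hκ : 0 < κ) (hκJ : ∀ x ∈ J, κ ≤ chord Ω x)
    (h1 : ∀ x, chord Ω x ≤ 1) (hB0 : 0 ≤ B) (hB : ∀ x ∈ J, ∑ i ∈ g, chord (C i) x ≤ B) :
    ∑ i ∈ g, ∫ z in C i ∩ Prod.fst ⁻¹' J, φ z * |u z| ^ p ≤
      B * (2 ^ m * (4 * p / κ)) *
        ((∫ z in Ω, φ z * |u z| ^ p) + ∫ z in Ω, φ z * G z ^ p) := by
  have hp0 : 0 ≤ p := by linarith
  have hcu : Continuous fun z => |u z| ^ p := hu.cont.abs.rpow_const fun _ => Or.inr hp0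
  have hcG : Continuous fun z => G z ^ p := hu.cont_G.rpow_const fun _ => Or.inr hp0
  have hi := hΩ.integrableOn_mul hcu
  have hiG : IntegrableOn (fun z => φ z * (|u z| ^ p + G z ^ p)) Ω :=
    hΩ.integrableOn_mul (hcu.add hcG)
  set D : ι → Set (ℝ × ℝ) := fun i => C i ∩ Prod.fst ⁻¹' J with hD
  have hDm : ∀ i ∈ g, MeasurableSet (D i) := fun i hi =>
    (ho i hi).measurableSet.inter (measurable_fst hJm)
  have hDi : ∀ i ∈ g, IntegrableOn (fun z => φ z * |u z| ^ p) (D i) := fun i hi' =>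
    hi.mono_set (inter_subset_left.trans (hC i hi'))
  set I : ℝ → ℝ := fun x => ∫ y in slice Ω x, φ (x, y) * (|u (x, y)| ^ p + G (x, y) ^ p) with hI
  have hI0 : ∀ x, 0 ≤ I x := fun x =>
    MeasureTheory.setIntegral_nonneg (hΩ.measurableSet_slice x) fun y hy =>
      mul_nonneg (hΩ.pos _ hy).le
        (add_nonneg (by positivity) (Real.rpow_nonneg (hu.nonneg _) _))
  have hIi : Integrable I := integrable_integral_slice hΩ.isOpen.measurableSet hiG
  have hK0 : 0 ≤ 2 ^ m * (4 * p / κ) := by positivity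
  have hterm : ∀ x ∈ J, ∀ i ∈ g, ∫ y in slice (C i) x, φ (x, y) * |u (x, y)| ^ p ≤
      chord (C i) x * (2 ^ m * (4 * p / κ) * I x) := by
    intro x hx i hi'
    have hsub : slice (C i) x ⊆ slice Ω x := fun y hy => hC i hi' hy
    have hfin : volume (slice (C i) x) ≠ ⊤ :=
      ((measure_mono hsub).trans_lt (hΩ.volume_slice_lt_top x)).ne
    have hkint : IntegrableOn (fun y => φ (x, y) * |u (x, y)| ^ p) (slice (C i) x) :=
      (hΩ.integrableOn_slice_mul (k := fun y => |u (x, y)| ^ p)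
        (hcu.comp (by fun_prop : Continuous fun y : ℝ => (x, y))) x).mono_set hsub
    rw [chord, ← smul_eq_mul, ← setIntegral_const]
    refine setIntegral_mono_on hkint (integrableOn_const hfin)
      (isOpen_slice (ho i hi') x).measurableSet fun y hy => ?_
    refine (hΩ.vertical_bound hp hu.hasDerivAt_snd (u' := fun z => u' z (0, 1))
      (hu.cont_deriv.clm_apply continuous_const) hu.cont_G
      (fun z => by simpa using hu.le z 0 1) (hsub hy) (h1 x)).trans ?_
    refine mul_le_mul_of_nonneg_right ?_ (hI0 x)
    gcongr
    exact hκJ x hx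
  calc ∑ i ∈ g, ∫ z in D i, φ z * |u z| ^ p
      = ∑ i ∈ g, ∫ x, ∫ y in slice (D i) x, φ (x, y) * |u (x, y)| ^ p :=
        Finset.sum_congr rfl fun i hi' => setIntegral_eq_integral_slice (hDm i hi') (hDi i hi')
    _ = ∫ x, ∑ i ∈ g, ∫ y in slice (D i) x, φ (x, y) * |u (x, y)| ^ p :=
        (integral_finsetSum _ fun i hi' =>
          integrable_integral_slice (hDm i hi') (hDi i hi')).symm
    _ ≤ ∫ x, B * (2 ^ m * (4 * p / κ)) * I x := by
        refine integral_mono (integrable_finsetSum _ fun i hi' =>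
          integrable_integral_slice (hDm i hi') (hDi i hi')) (hIi.const_mul _) fun x => ?_
        simp only
        by_cases hx : x ∈ J
        · have e : ∀ i, slice (D i) x = slice (C i) x := fun i => by
            ext y; simp [slice, hD, hx]
          simp only [e]
          calc ∑ i ∈ g, ∫ y in slice (C i) x, φ (x, y) * |u (x, y)| ^ p
              ≤ ∑ i ∈ g, chord (C i) x * (2 ^ m * (4 * p / κ) * I x) :=
                Finset.sum_le_sum (hterm x hx)
            _ = (∑ i ∈ g, chord (C i) x) * (2 ^ m * (4 * p / κ) * I x) :=
                (Finset.sum_mul _ _ _).symm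
            _ ≤ B * (2 ^ m * (4 * p / κ) * I x) :=
                mul_le_mul_of_nonneg_right (hB x hx) (mul_nonneg hK0 (hI0 x))
            _ = _ := by ring
        · have e : ∀ i, slice (D i) x = ∅ := fun i => by
            ext y; simp [slice, hD, hx]
          simp only [e, setIntegral_empty, Finset.sum_const_zero]
          exact mul_nonneg (mul_nonneg hB0 hK0) (hI0 x)
    _ = _ := by
        rw [integral_const_mul, hI, ← setIntegral_eq_integral_slice hΩ.isOpen.measurableSet hiG]
        simp only [mul_add (φ _)]
        rw [integral_add hi (hΩ.integrableOn_mul hcG)]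

/-- Splitting of the mass of a cell into the two ends and the middle. -/
theorem WeightedConvex.mass_split {m : ℕ} {C : Set (ℝ × ℝ)} {φ : ℝ × ℝ → ℝ}
    (h : WeightedConvex m C φ) {k : ℝ × ℝ → ℝ} (hk : Continuous k) (hk0 : ∀ z, 0 ≤ k z)
    {X0 X1 r : ℝ} (hX : Prod.fst '' C ⊆ Ioo X0 X1) :
    ∫ z in C, φ z * k z ≤ (∫ z in C ∩ Prod.fst ⁻¹' Ioo X0 (X0 + r), φ z * k z) +
      (∫ z in C ∩ Prod.fst ⁻¹' Ioo (X1 - r) X1, φ z * k z) +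
      ∫ z in C ∩ Prod.fst ⁻¹' Icc (X0 + r) (X1 - r), φ z * k z := by
  have hi := h.integrableOn_mul hk
  have hnn : ∀ S ⊆ C, 0 ≤ᵐ[volume.restrict S] fun z => φ z * k z := fun S hS => by
    refine ae_restrict_of_ae_restrict_of_subset hS ?_
    filter_upwards [self_mem_ae_restrict h.isOpen.measurableSet] with z hz
    exact mul_nonneg (h.pos z hz).le (hk0 z)
  have hA : MeasurableSet (Prod.fst ⁻¹' Ioo X0 (X0 + r) : Set (ℝ × ℝ)) :=
    measurable_fst measurableSet_Ioo
  have hB : MeasurableSet (Prod.fst ⁻¹' Ioo (X1 - r) X1 : Set (ℝ × ℝ)) :=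
    measurable_fst measurableSet_Ioo
  rw [← integral_inter_add_sdiff hA hi,
    ← integral_inter_add_sdiff hB (hi.mono_set sdiff_subset), ← add_assoc]
  refine add_le_add (add_le_add le_rfl ?_) ?_
  · exact setIntegral_mono_set (hi.mono_set inter_subset_left) (hnn _ inter_subset_left)
      (LE.le.eventuallyLE (inter_subset_inter_left _ sdiff_subset))
  · refine setIntegral_mono_set (hi.mono_set inter_subset_left) (hnn _ inter_subset_left)
      (LE.le.eventuallyLE ?_)
    rintro z ⟨⟨hz, h1⟩, h2⟩
    have hz' := hX ⟨z, hz, rfl⟩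
    simp only [mem_preimage, mem_Ioo, not_and, not_lt] at h1 h2
    exact ⟨hz, h1 hz'.1, by by_contra! hcon; exact absurd (h2 hcon) (not_le.2 hz'.2)⟩

/-- The mass of a long cell with controlled energy sits away from the ends. -/
theorem LongCell.mass_le_two_mul {ρ ξ ε X0 X1 : ℝ} {m : ℕ} {C : Set (ℝ × ℝ)} {φ : ℝ × ℝ → ℝ}
    {σ τ x0 x1 : ℝ} (hL : LongCell ρ ξ ε X0 X1 m C φ σ τ x0 x1) {p S ω : ℝ} {u G : ℝ × ℝ → ℝ}
    {v v' : ℝ → ℝ} (h : ThinCell p S ω m C φ u G x0 x1 v v') {r Λ : ℝ} (hr : 0 < r)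
    (hr1 : r ≤ 1 / 16) (hρ1 : ρ ≤ 1 / 16) (hξ1 : ξ ≤ 1 / 16) (hΛ : 0 ≤ Λ)
    (hrΛ : r * (4 * p * Real.exp 2) * (1 + 2 ^ p * Λ) ≤ 1 / 4)
    (hE : ∫ z in C, φ z * G z ^ p ≤ Λ * ∫ z in C, φ z * |u z| ^ p) :
    ∫ z in C, φ z * |u z| ^ p ≤
      2 * (∫ z in C ∩ Prod.fst ⁻¹' Icc (X0 + r) (X1 - r), φ z * |u z| ^ p) +
        6 * (ω * ∫ z in C, φ z) := by
  have hp := h.one_lt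
  have hlen := hL.len_ge hξ1
  have g1 := hL.left_ge
  have g2 := hL.left_le
  have g3 := hL.right_ge
  have g4 := hL.right_le
  have hρ0 : 0 ≤ ρ := by linarith
  have hleft := h.mass_le (j0 := X0) (j1 := X0 + r) (Real.exp_pos 2) (by linarith) (by
    intro s hs hsx
    refine ⟨s, ⟨le_rfl, by linarith⟩, fun t ht => ⟨hsx.1.trans ht.1, ?_⟩, fun t ht =>
      hL.marginal_left s t hsx.1 ht.1.le ?_⟩
    · linarith [ht.2, hs.2]
    · linarith [ht.2, hs.2])
  have hright := h.mass_le (j0 := X1 - r) (j1 := X1) (Real.exp_pos 2) (by linarith) (by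
    intro s hs hsx
    refine ⟨s - 1 / 4, ⟨by linarith, by linarith⟩, fun t ht => ⟨?_, ?_⟩, fun t ht =>
      hL.marginal_right t s ?_ ?_ hsx.2⟩
    · linarith [ht.1, hs.1]
    · linarith [ht.2, hsx.2]
    · linarith [ht.1, hs.1]
    · linarith [ht.2])
  have hsplit := hL.mass_split (k := fun z => |u z| ^ p) (h.continuous_abs_rpow h.cont_u)
    (fun z => by positivity) (X0 := X0) (X1 := X1) (r := r) (by
      rw [hL.fst_image]; exact Ioo_subset_Ioo g1 g4)
  set A := ∫ z in C, φ z
  set E := ∫ z in C, φ z * G z ^ p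
  set M := ∫ z in C, φ z * |u z| ^ p with hM
  have hA0 : 0 ≤ ω * A := mul_nonneg h.err_nonneg h.setIntegral_weight_nonneg
  have hM0 : 0 ≤ M := h.setIntegral_nonneg fun z => by positivity
  have h2p : (0 : ℝ) ≤ 2 ^ p := by positivity
  set a := r * (4 * p * Real.exp 2) with ha
  have ha0 : 0 ≤ a := by positivity
  have e1 : a * (M + 2 ^ p * E + 2 * (ω * A)) ≤ 1 / 4 * M + 1 / 2 * (ω * A) := by
    have e2 : M + 2 ^ p * E ≤ (1 + 2 ^ p * Λ) * M := by
      have := mul_le_mul_of_nonneg_left hE h2p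
      linarith
    have e3 : a ≤ 1 / 4 := by
      have : a * 1 ≤ a * (1 + 2 ^ p * Λ) :=
        mul_le_mul_of_nonneg_left (by linarith [mul_nonneg h2p hΛ]) ha0
      linarith
    have e4 := mul_le_mul_of_nonneg_left e2 ha0
    have e5 := mul_le_mul_of_nonneg_right hrΛ hM0
    have e6 := mul_le_mul_of_nonneg_right e3 hA0
    linarith
  rw [show X0 + r - X0 = r by ring, ← ha] at hleft
  rw [show X1 - (X1 - r) = r by ring, ← ha] at hright
  linarith

theorem chord_le_one {Ω : Set (ℝ × ℝ)} (ho : IsOpen Ω) (hc : Convex ℝ Ω)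
    (hb : Bornology.IsBounded Ω)
    (hdiam : ∀ z ∈ Ω, ∀ w ∈ Ω, (w.1 - z.1) ^ 2 + (w.2 - z.2) ^ 2 ≤ 1) (x : ℝ) :
    chord Ω x ≤ 1 := by
  by_cases hx : x ∈ Prod.fst '' Ω
  · obtain ⟨b, t, hbt, hs⟩ := exists_slice_eq_Ioo ho hc hb hx
    rw [chord, hs, Real.volume_real_Ioo_of_le hbt.le]
    refine le_of_forall_lt_imp_le_of_dense fun a ha => ?_
    rcases le_or_gt a 0 with h0 | h0
    · linarith
    have h1 : (b + t - a) / 2 ∈ slice Ω x := by rw [hs]; constructor <;> linarith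
    have h2 : (b + t + a) / 2 ∈ slice Ω x := by rw [hs]; constructor <;> linarith
    have := hdiam _ h1 _ h2
    simp only at this
    nlinarith
  · rw [chord, slice_eq_empty hx]
    simp

theorem exists_max_chord {Ω : Set (ℝ × ℝ)} (ho : IsOpen Ω) (hc : Convex ℝ Ω)
    (hb : Bornology.IsBounded Ω) (hne : Ω.Nonempty)
    (hdiam : ∀ z ∈ Ω, ∀ w ∈ Ω, (w.1 - z.1) ^ 2 + (w.2 - z.2) ^ 2 ≤ 1) :
    ∃ X0 X1 H : ℝ, X0 < X1 ∧ X1 - X0 ≤ 1 ∧ Prod.fst '' Ω = Ioo X0 X1 ∧ 0 < volume.real Ω ∧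
      volume.real Ω ≤ H ∧ H ≤ 1 ∧ (∀ x, chord Ω x ≤ H) ∧
      ∀ r, 0 < r → ∀ x ∈ Icc (X0 + r) (X1 - r), r * H / 4 ≤ chord Ω x := by
  obtain ⟨X0, X1, hX, hfst⟩ := exists_fst_image_eq_Ioo ho hc hb hne
  have hlen : X1 - X0 ≤ 1 := by
    refine le_of_forall_lt_imp_le_of_dense fun a ha => ?_
    rcases le_or_gt a 0 with h0 | h0
    · linarith
    have h1 : (X0 + X1 - a) / 2 ∈ Prod.fst '' Ω := by rw [hfst]; constructor <;> linarith
    have h2 : (X0 + X1 + a) / 2 ∈ Prod.fst '' Ω := by rw [hfst]; constructor <;> linarith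
    obtain ⟨z, hz, ez⟩ := h1
    obtain ⟨w, hw, ew⟩ := h2
    have := hdiam z hz w hw
    rw [ez, ew] at this
    nlinarith [sq_nonneg (w.2 - z.2)]
  have hle1 := chord_le_one ho hc hb hdiam
  have hbdd : BddAbove (range (chord Ω)) := ⟨1, by rintro _ ⟨x, rfl⟩; exact hle1 x⟩
  have hV0 : 0 < volume.real Ω :=
    ENNReal.toReal_pos (ho.measure_pos volume hne).ne' hb.measure_lt_top.ne
  set H := ⨆ x, chord Ω x with hH
  have hH1 : H ≤ 1 := ciSup_le hle1
  have hcH : ∀ x, chord Ω x ≤ H := le_ciSup hbdd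
  have hVH : volume.real Ω ≤ H := by
    have h1 : volume.real Ω = ∫ x in Ioo X0 X1, chord Ω x := by
      have := setIntegral_eq_integral_slice_Ioo ho.measurableSet (F := fun _ => (1 : ℝ))
        (integrableOn_const hb.measure_lt_top.ne) hfst
      simpa [chord] using this
    have h0 : 0 ≤ H := (chord_nonneg Ω 0).trans (hcH 0)
    have h2 : ∫ x in Ioo X0 X1, chord Ω x ≤ H * volume.real (Ioo X0 X1) := by
      refine (Real.le_norm_self _).trans (norm_setIntegral_le_of_norm_le_const (by simp) ?_)
      intro x _
      rw [Real.norm_of_nonneg (chord_nonneg _ _)]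
      exact hcH x
    rw [Real.volume_real_Ioo_of_le hX.le] at h2
    nlinarith
  refine ⟨X0, X1, H, hX, hlen, hfst, hV0, hVH, hH1, hcH, fun r hr x hx => ?_⟩
  have hHpos : 0 < H := hV0.trans_le hVH
  obtain ⟨y, hy⟩ : ∃ y, H / 2 < chord Ω y := exists_lt_of_lt_ciSup (by rw [← hH]; linarith)
  have hymem : y ∈ Prod.fst '' Ω := by
    by_contra hcon
    rw [chord, slice_eq_empty hcon] at hy
    simp at hy
    linarith
  have hy' := hymem
  rw [hfst] at hy'
  have key : ∀ e, e ∈ Prod.fst '' Ω → ∀ b : ℝ, r / 2 ≤ b → b ≤ 1 →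
      b * (y - e) = x - e → r * H / 4 ≤ chord Ω x := by
    intro e he b hb2 hb1 hx'
    have h1 := chord_combo_le hc hb he hymem (sub_nonneg.2 hb1) (by linarith) (sub_add_cancel 1 b)
    rw [show (1 - b) * e + b * y = x by linarith] at h1
    have h2 := mul_nonneg (sub_nonneg.2 hb1) (chord_nonneg Ω e)
    have h3 : r / 2 * (H / 2) ≤ b * chord Ω y :=
      mul_le_mul hb2 hy.le (by positivity) (by linarith)
    linarith
  rcases le_total x y with hxy | hxy
  · have hd : 0 < y - (X0 + r / 2) := by linarith [hx.1]
    refine key (X0 + r / 2) (by rw [hfst]; constructor <;> linarith [hx.1, hx.2])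
      ((x - (X0 + r / 2)) / (y - (X0 + r / 2))) ?_ ?_ (div_mul_cancel₀ _ hd.ne')
    · rw [le_div_iff₀ hd]; nlinarith [hx.1, hy'.2]
    · rw [div_le_one hd]; linarith
  · have hd : y - (X1 - r / 2) < 0 := by linarith [hx.2]
    refine key (X1 - r / 2) (by rw [hfst]; constructor <;> linarith [hx.1, hx.2])
      ((x - (X1 - r / 2)) / (y - (X1 - r / 2))) ?_ ?_ (div_mul_cancel₀ _ hd.ne)
    · rw [le_div_iff_of_neg hd]; nlinarith [hx.2, hy'.1]
    · rw [div_le_one_of_neg hd]; linarith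

/-- A convex set in a thin strip is hardly longer than its diameter. -/
theorem length_le_of_strip {C : Set (ℝ × ℝ)} {σ τ ε x0 x1 : ℝ}
    (hdiam : ∀ z ∈ C, ∀ w ∈ C, (w.1 - z.1) ^ 2 + (w.2 - z.2) ^ 2 ≤ 1)
    (hfst : Prod.fst '' C = Ioo x0 x1) (hσ : σ ^ 2 ≤ 1) (hε : 0 ≤ ε)
    (hstrip : ∀ z ∈ C, |z.2 - (σ * z.1 + τ)| ≤ ε) : (x1 - x0) * √(1 + σ ^ 2) ≤ 1 + 2 * ε := by
  have hS : 0 < √(1 + σ ^ 2) := by positivity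
  rw [← le_div_iff₀ hS]
  refine le_of_forall_lt_imp_le_of_dense fun a ha => ?_
  rcases le_or_gt a 0 with h0 | h0
  · exact h0.trans (by positivity)
  have h1 : (x0 + x1 - a) / 2 ∈ Prod.fst '' C := by rw [hfst]; constructor <;> linarith
  have h2 : (x0 + x1 + a) / 2 ∈ Prod.fst '' C := by rw [hfst]; constructor <;> linarith
  obtain ⟨z, hz, ez⟩ := h1
  obtain ⟨w, hw, ew⟩ := h2
  have hd := hdiam z hz w hw
  have hwz : w.1 - z.1 = a := by rw [ez, ew]; ring
  have hk : |w.1 - z.1| ≤ 1 := by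
    rw [← sq_le_one_iff_abs_le_one]; nlinarith [sq_nonneg (w.2 - z.2)]
  have h3 := sq_mul_le_of_strip (hstrip z hz) (hstrip w hw) hσ hk
  rw [hwz] at h3 hd
  rw [le_div_iff₀ hS]
  refine (abs_le_of_sq_le_sq' ?_ (by linarith)).2
  rw [mul_pow, Real.sq_sqrt (by positivity)]
  nlinarith [sq_nonneg ε]

/-- A thin cell of small slope satisfies an improved inequality, or is a long cell of small
energy. -/
theorem ThinCell.exists_dichotomy {p ρ : ℝ} (hp : 1 < p) (hρ : 0 < ρ) (hρ1 : ρ ≤ 1 / 16) :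
    ∃ c1 : ℝ, 0 < c1 ∧ c1 ≤ ρ ^ 2 ∧ ∀ {ω ε ξ σ τ X0 X1 : ℝ} {m : ℕ} {C : Set (ℝ × ℝ)}
      {φ u G : ℝ × ℝ → ℝ} {x0 x1 : ℝ} {v v' : ℝ → ℝ},
      ThinCell p √(1 + σ ^ 2) ω m C φ u G x0 x1 v v' → 0 < ξ → ξ ≤ c1 → σ ^ 2 ≤ ρ / 8 →
      (∀ z ∈ C, ∀ w ∈ C, (w.1 - z.1) ^ 2 + (w.2 - z.2) ^ 2 ≤ 1) →
      (∀ z ∈ C, |z.2 - (σ * z.1 + τ)| ≤ ε) → 0 ≤ ε → ε ≤ ξ / 8 → X0 ≤ x0 → x1 ≤ X1 →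
      X1 - X0 ≤ 1 →
      ((piP p ^ p + ξ * min (piP p ^ p) 1) * (∫ z in C, φ z * |u z| ^ p) ≤
        (∫ z in C, φ z * G z ^ p) + 2 * (piP p ^ p + 2 ^ p) * (ω * ∫ z in C, φ z)) ∨
      (LongCell ρ ξ ε X0 X1 m C φ σ τ x0 x1 ∧
        ∫ z in C, φ z * G z ^ p ≤ (piP p ^ p + 1) * ∫ z in C, φ z * |u z| ^ p) := by
  obtain ⟨c0, hc0, hc08, halt⟩ := ThinCell.alternative hp (half_pos hρ)
  refine ⟨min c0 (ρ ^ 2), by positivity, min_le_right _ _, ?_⟩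
  intro ω ε ξ σ τ X0 X1 m C φ u G x0 x1 v v' h hξ hξc hσ hdiam hstrip hε0 hεξ hX0 hX1 hX
  have hξ0 : ξ ≤ c0 := hξc.trans (min_le_left _ _)
  have hξρ : ξ ≤ ρ / 16 := by
    have := hξc.trans (min_le_right _ _)
    nlinarith
  have hS : √(1 + σ ^ 2) ≤ 1 + ρ / 16 :=
    (Real.sqrt_one_add_le (by linarith [sq_nonneg σ])).trans (by linarith)
  have hlen := length_le_of_strip hdiam h.fst_image (by linarith) hε0 hstrip
  set A := ∫ z in C, φ z
  set E := ∫ z in C, φ z * G z ^ p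
  set M := ∫ z in C, φ z * |u z| ^ p with hM
  have hA0 : 0 ≤ ω * A := mul_nonneg h.err_nonneg h.setIntegral_weight_nonneg
  have hM0 : 0 ≤ M := h.setIntegral_nonneg fun z => by positivity
  have hE0 : 0 ≤ E := h.setIntegral_nonneg fun z => Real.rpow_nonneg (h.G_nonneg z) _
  have hπ : 0 < piP p ^ p := Real.rpow_pos_of_pos (piP_pos hp) _
  have hK0 : 0 < piP p ^ p + 2 ^ p := by positivity
  have hKA := mul_nonneg hK0.le hA0
  have hmin1 : ξ * min (piP p ^ p) 1 ≤ 1 :=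
    (mul_le_mul (by linarith : ξ ≤ 1) (min_le_right _ _) (by positivity) zero_le_one).trans
      (by norm_num)
  rcases lt_or_ge ((piP p ^ p + 1) * M) E with hEM | hEM
  · left
    have := mul_le_mul_of_nonneg_right hmin1 hM0
    linarith
  rcases halt h ξ hξ hξ0 (by linarith) (by linarith) with hbad | ⟨hl, hml, hmr⟩
  · left
    have h1 := mul_le_mul_of_nonneg_left hbad (by linarith : 0 ≤ 1 + ξ)
    have h2 : ξ * min (piP p ^ p) 1 * M ≤ ξ * piP p ^ p * M :=
      mul_le_mul_of_nonneg_right (mul_le_mul_of_nonneg_left (min_le_left _ _) hξ.le) hM0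
    have h3 := mul_nonneg (sq_nonneg ξ) hE0
    have h4 := mul_le_mul_of_nonneg_right (by linarith : 1 + ξ ≤ 2) hKA
    linarith
  · right
    have hlb : 1 - ρ / 8 ≤ x1 - x0 := by
      have h1 : (x1 - x0) * √(1 + σ ^ 2) ≤ (x1 - x0) * (1 + ρ / 16) :=
        mul_le_mul_of_nonneg_left hS (by linarith [h.lt])
      have h2 : (x1 - x0) * (ρ / 16) ≤ 1 * (ρ / 16) :=
        mul_le_mul_of_nonneg_right (by linarith) (by linarith)
      linarith
    exact ⟨{ h.toWeightedConvex with
      strip := hstrip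
      fst_image := h.fst_image
      slope_le := abs_le_of_sq_le_sq (by linarith) (by norm_num)
      long := hl
      left_ge := hX0
      left_le := by linarith
      right_ge := by linarith
      right_le := hX1
      marginal_left := hml
      marginal_right := hmr }, hEM⟩

theorem WeightedConvex.sum_setIntegral_le {m : ℕ} {Ω : Set (ℝ × ℝ)} {φ k : ℝ × ℝ → ℝ}
    (hΩ : WeightedConvex m Ω φ) (hk : Continuous k) (hk0 : ∀ z, 0 ≤ k z) {ι : Type*}
    {s : Finset ι} {C : ι → Set (ℝ × ℝ)} (ho : ∀ i ∈ s, IsOpen (C i)) (hC : ∀ i ∈ s, C i ⊆ Ω)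
    (hd : (s : Set ι).PairwiseDisjoint C) :
    ∑ i ∈ s, ∫ z in C i, φ z * k z ≤ ∫ z in Ω, φ z * k z := by
  have hi := hΩ.integrableOn_mul hk
  rw [← integral_biUnion_finset s (fun i hi => (ho i hi).measurableSet) hd
    fun i h => hi.mono_set (hC i h)]
  refine setIntegral_mono_set hi ?_ (LE.le.eventuallyLE (iUnion₂_subset hC))
  filter_upwards [self_mem_ae_restrict hΩ.isOpen.measurableSet] with z hz
  exact mul_nonneg (hΩ.pos z hz).le (hk0 z)

set_option maxHeartbeats 1000000 in
/-- Among disjoint thin cells of small slope, those without an improved inequality carry little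
mass. -/
theorem exists_sector_bound {p : ℝ} (hp : 1 < p) (m : ℕ) :
    ∃ K > 0, ∃ ρ0 > 0, ∀ ρ, 0 < ρ → ρ ≤ ρ0 → ∃ c > 0, ∀ {Ω : Set (ℝ × ℝ)} {φ u G : ℝ × ℝ → ℝ}
      {u' : ℝ × ℝ → ℝ × ℝ →L[ℝ] ℝ}, WeightedConvex m Ω φ → GradBound u u' G → Ω.Nonempty →
      (∀ z ∈ Ω, ∀ w ∈ Ω, (w.1 - z.1) ^ 2 + (w.2 - z.2) ^ 2 ≤ 1) → ∀ ω > 0, ∃ ε0 > 0,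
      ∀ {ι : Type} (s : Finset ι) (C : ι → Set (ℝ × ℝ)) (σ τ : ι → ℝ),
      (∀ i ∈ s, C i ⊆ Ω ∧ IsOpen (C i) ∧ Convex ℝ (C i) ∧ (C i).Nonempty ∧ σ i ^ 2 ≤ ρ / 8 ∧
        (∀ z ∈ C i, |z.2 - (σ i * z.1 + τ i)| ≤ ε0) ∧
        ∫ z in C i, φ z * |u z| ^ (p - 2) * u z = 0) →
      (s : Set ι).PairwiseDisjoint C → ∃ g ⊆ s,
        (∀ i ∈ s, i ∉ g → (piP p ^ p + c * volume.real Ω ^ 2) * (∫ z in C i, φ z * |u z| ^ p) ≤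
          (∫ z in C i, φ z * G z ^ p) + ω * ∫ z in C i, φ z) ∧
        (∀ i ∈ s, piP p ^ p * (∫ z in C i, φ z * |u z| ^ p) ≤
          (∫ z in C i, φ z * G z ^ p) +
            ω * ((∫ z in C i, φ z) + ∫ z in C i, φ z * G z ^ p)) ∧
        ∑ i ∈ g, (∫ z in C i, φ z * |u z| ^ p) ≤
          K * ρ * ((∫ z in Ω, φ z * |u z| ^ p) + ∫ z in Ω, φ z * G z ^ p) +
            ω * ∫ z in Ω, φ z := by
  have hπ : 0 < piP p ^ p := Real.rpow_pos_of_pos (piP_pos hp) _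
  have hp0 : 0 < p := by linarith
  set D := 4 * p * Real.exp 2 * (1 + 2 ^ p * (piP p ^ p + 1)) with hD
  have hD0 : 0 < D := by positivity
  set r := min (1 / 16) (1 / (4 * D)) with hr
  have hr0 : 0 < r := by positivity
  have hr1 : r ≤ 1 / 16 := min_le_left _ _
  have hrD : r * (4 * p * Real.exp 2) * (1 + 2 ^ p * (piP p ^ p + 1)) ≤ 1 / 4 := by
    have : r * D ≤ 1 / (4 * D) * D := mul_le_mul_of_nonneg_right (min_le_right _ _) hD0.le
    rw [show 1 / (4 * D) * D = 1 / 4 by field_simp] at this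
    rw [mul_assoc]
    exact this
  refine ⟨2 * (2 ^ (m + 1) * Real.exp 2 * 30 * (2 ^ m * (16 * p / r))), by positivity, r, hr0,
    fun ρ hρ hρr => ?_⟩
  have hρ1 : ρ ≤ 1 / 16 := hρr.trans hr1
  obtain ⟨c1, hc1, hc1ρ, hdich⟩ := ThinCell.exists_dichotomy hp hρ hρ1
  refine ⟨c1 * min (piP p ^ p) 1, by positivity, ?_⟩
  intro Ω φ u G u' hΩ hu hne hdiam ω hω
  obtain ⟨X0, X1, H, hX, hlen, hfst, hV0, hVH, hH1, hcH, hcr⟩ :=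
    exists_max_chord hΩ.isOpen hΩ.convex hΩ.isBounded hne hdiam
  set V := volume.real Ω
  have hH0 : 0 < H := hV0.trans_le hVH
  set ξ := c1 * V ^ 2 with hξ
  have hξ0 : 0 < ξ := by positivity
  have hV2 : V ^ 2 ≤ 1 := pow_le_one₀ hV0.le (hVH.trans hH1)
  have hξc : ξ ≤ c1 := mul_le_of_le_one_right hc1.le hV2
  have hρ2 : ρ ^ 2 ≤ ρ / 16 := by nlinarith
  have hξH : ξ ≤ (ρ * H) ^ 2 := by
    rw [mul_pow]
    exact mul_le_mul hc1ρ (pow_le_pow_left₀ hV0.le hVH 2) (by positivity) (by positivity)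
  have hK0 : 0 < piP p ^ p + 2 ^ p := by positivity
  set K0 := piP p ^ p + 2 ^ p
  set ω0 := ω / (2 * K0 + 6) with hω0
  have hω0p : 0 < ω0 := by positivity
  have hωe : ω0 * (2 * K0 + 6) = ω := div_mul_cancel₀ _ (by positivity)
  obtain ⟨ε1, hε1, hthin⟩ := hu.exists_thinCell hp hΩ (fun z hz w hw => by
    have := hdiam z hz w hw
    nlinarith [sq_nonneg (w.2 - z.2)]) hω0p
  obtain ⟨ε2, hε2, hpow⟩ : ∃ ε2 > 0, ∀ ε, 0 ≤ ε → ε ≤ ε2 → (1 + 2 * ε) ^ p ≤ 1 + ω := by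
    have hc : ContinuousAt (fun t : ℝ => (1 + 2 * t) ^ p) 0 :=
      ContinuousAt.rpow_const (by fun_prop) (Or.inr hp0.le)
    have hev : ∀ᶠ t in 𝓝 (0 : ℝ), (1 + 2 * t) ^ p < 1 + ω :=
      hc.eventually_lt_const (by simp [hω])
    obtain ⟨δ, hδ, hb⟩ := Metric.eventually_nhds_iff.1 hev
    refine ⟨δ / 2, by positivity, fun ε h0 h1 => (hb ?_).le⟩
    rw [Real.dist_eq, sub_zero, abs_of_nonneg h0]
    linarith
  set ε := min (min ε1 ε2) (min (ξ / 8) (ρ * V)) with hε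
  have hε0 : 0 < ε := by positivity
  have e1 : ε ≤ ε1 := (min_le_left _ _).trans (min_le_left _ _)
  have e2 : ε ≤ ε2 := (min_le_left _ _).trans (min_le_right _ _)
  have e3 : ε ≤ ξ / 8 := (min_le_right _ _).trans (min_le_left _ _)
  have e4 : ε ≤ ρ * H := (min_le_right _ _).trans ((min_le_right _ _).trans (by gcongr))
  refine ⟨ε, hε0, ?_⟩
  intro ι s C σ τ hcell hd
  have hT : ∀ i ∈ s, ∃ x0 x1, ThinCell p √(1 + σ i ^ 2) ω0 m (C i) φ u G x0 x1
      (fun t => u (t, σ i * t + τ i)) (fun t => u' (t, σ i * t + τ i) (1, σ i)) := by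
    intro i hi
    obtain ⟨h1, h2, h3, h4, h5, h6, h7⟩ := hcell i hi
    exact hthin (C i) (σ i) (τ i) h1 h2 h3 h4 (by linarith) (fun z hz => (h6 z hz).trans e1) h7
  choose! x0 x1 hT using hT
  have hA0 : ∀ i ∈ s, 0 ≤ ∫ z in C i, φ z := fun i hi => (hT i hi).setIntegral_weight_nonneg
  have hE0 : ∀ i ∈ s, 0 ≤ ∫ z in C i, φ z * G z ^ p := fun i hi =>
    (hT i hi).setIntegral_nonneg fun z => Real.rpow_nonneg (hu.nonneg z) _
  have hdi : ∀ i ∈ s, ∀ z ∈ C i, ∀ w ∈ C i, (w.1 - z.1) ^ 2 + (w.2 - z.2) ^ 2 ≤ 1 :=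
    fun i hi z hz w hw => hdiam z ((hcell i hi).1 hz) w ((hcell i hi).1 hw)
  have hends : ∀ i ∈ s, X0 ≤ x0 i ∧ x1 i ≤ X1 := fun i hi => by
    have : Ioo (x0 i) (x1 i) ⊆ Ioo X0 X1 := by
      rw [← (hT i hi).fst_image, ← hfst]
      exact image_mono (hcell i hi).1
    exact (Ioo_subset_Ioo_iff (hT i hi).lt).1 this
  have hd2 : ∀ i ∈ s, _ := fun i hi => hdich (hT i hi) hξ0 hξc (hcell i hi).2.2.2.2.1 (hdi i hi)
    (hcell i hi).2.2.2.2.2.1 hε0.le e3 (hends i hi).1 (hends i hi).2 hlen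
  classical
  refine ⟨s.filter fun i => ¬ ((piP p ^ p + c1 * min (piP p ^ p) 1 * V ^ 2) *
    (∫ z in C i, φ z * |u z| ^ p) ≤ (∫ z in C i, φ z * G z ^ p) + ω * ∫ z in C i, φ z),
    Finset.filter_subset _ _, ?_, ?_, ?_⟩
  · intro i hi hig
    by_contra hcon
    exact hig (Finset.mem_filter.2 ⟨hi, hcon⟩)
  · intro i hi
    have h1 := (hT i hi).poincare (length_le_of_strip (hdi i hi) (hT i hi).fst_image
      (by linarith [(hcell i hi).2.2.2.2.1]) hε0.le (hcell i hi).2.2.2.2.2.1)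
    have h2 := mul_le_mul_of_nonneg_right (hpow ε hε0.le e2) (hE0 i hi)
    have h3 : K0 * (ω0 * ∫ z in C i, φ z) ≤ ω * ∫ z in C i, φ z := by
      rw [← mul_assoc]
      refine mul_le_mul_of_nonneg_right ?_ (hA0 i hi)
      nlinarith [mul_pos hω0p hK0]
    linarith
  · set g := s.filter fun i => ¬ ((piP p ^ p + c1 * min (piP p ^ p) 1 * V ^ 2) *
      (∫ z in C i, φ z * |u z| ^ p) ≤ (∫ z in C i, φ z * G z ^ p) + ω * ∫ z in C i, φ z) with hg
    have hgs : ∀ i ∈ g, i ∈ s := fun i hi => (Finset.mem_filter.1 hi).1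
    have hlong : ∀ i ∈ g, LongCell ρ ξ ε X0 X1 m (C i) φ (σ i) (τ i) (x0 i) (x1 i) ∧
        ∫ z in C i, φ z * G z ^ p ≤ (piP p ^ p + 1) * ∫ z in C i, φ z * |u z| ^ p := by
      intro i hi
      refine (hd2 i (hgs i hi)).resolve_left fun hbad => (Finset.mem_filter.1 hi).2 ?_
      have h3 : 2 * K0 * (ω0 * ∫ z in C i, φ z) ≤ ω * ∫ z in C i, φ z := by
        rw [← mul_assoc]
        refine mul_le_mul_of_nonneg_right ?_ (hA0 i (hgs i hi))
        nlinarith [mul_pos hω0p hK0]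
      rw [show c1 * min (piP p ^ p) 1 * V ^ 2 = ξ * min (piP p ^ p) 1 by rw [hξ]; ring]
      linarith
    have hdg : (g : Set ι).PairwiseDisjoint C := hd.subset fun i hi => hgs i hi
    have hmass := hΩ.sum_mass_le hp hu (g := g) (C := C) (fun i hi => (hcell i (hgs i hi)).2.1)
      (fun i hi => (hcell i (hgs i hi)).1) (J := Icc (X0 + r) (X1 - r)) measurableSet_Icc
      (κ := r * H / 4) (B := 2 ^ (m + 1) * Real.exp 2 * (30 * (ρ * H))) (by positivity)
      (hcr r hr0) (fun x => (hcH x).trans hH1) (by positivity) (fun x hx =>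
        LongCell.sum_chord_le hΩ.convex hΩ.isBounded hdiam (fun i hi => (hlong i hi).1)
          (fun i hi => (hcell i (hgs i hi)).1) hdg hH0 hcH hρ hρ1 hξ0 (by linarith) (by linarith)
          hξH hε0.le e3 e4 (Icc_subset_Icc (by linarith) (by linarith) hx))
    have hone : ∀ i ∈ g, ∫ z in C i, φ z * |u z| ^ p ≤
        2 * (∫ z in C i ∩ Prod.fst ⁻¹' Icc (X0 + r) (X1 - r), φ z * |u z| ^ p) +
        6 * (ω0 * ∫ z in C i, φ z) := fun i hi =>
      (hlong i hi).1.mass_le_two_mul (hT i (hgs i hi)) hr0 hr1 hρ1 (by linarith)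
        (by positivity) hrD (hlong i hi).2
    have hsum := Finset.sum_le_sum hone
    rw [Finset.sum_add_distrib, ← Finset.mul_sum, ← Finset.mul_sum, ← Finset.mul_sum] at hsum
    have hA := hΩ.sum_setIntegral_le (k := fun _ => 1) continuous_const (fun _ => zero_le_one)
      (s := g) (C := C) (fun i hi => (hcell i (hgs i hi)).2.1)
      (fun i hi => (hcell i (hgs i hi)).1) hdg
    simp only [mul_one] at hA
    have hAΩ : 0 ≤ ∫ z in Ω, φ z := hΩ.setIntegral_weight_nonneg
    have h6 : 6 * (ω0 * ∑ i ∈ g, ∫ z in C i, φ z) ≤ ω * ∫ z in Ω, φ z := by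
      have h7 : 6 * ω0 ≤ ω := by nlinarith [mul_pos hω0p hK0]
      have h8 := mul_le_mul_of_nonneg_left hA hω0p.le
      have h9 := mul_le_mul_of_nonneg_right h7 hAΩ
      linarith
    have hcoef : 2 ^ (m + 1) * Real.exp 2 * (30 * (ρ * H)) * (2 ^ m * (4 * p / (r * H / 4))) =
        2 ^ (m + 1) * Real.exp 2 * 30 * (2 ^ m * (16 * p / r)) * ρ := by
      field_simp
      ring
    rw [hcoef] at hmass
    linarith

/-- The set lies in a strip of half-width `ε` in some direction. -/
def IsThin (ε : ℝ) (C : Set (ℝ × ℝ)) : Prop :=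
  ∃ c s t : ℝ, c ^ 2 + s ^ 2 = 1 ∧ ∀ z ∈ C, |c * z.2 - s * z.1 - t| ≤ ε

theorem exists_det_of_not_isThin {ε : ℝ} (hε : 0 < ε) {C : Set (ℝ × ℝ)} (hne : C.Nonempty)
    (h : ¬ IsThin ε C) : ∃ a ∈ C, ∃ b ∈ C, ∃ c ∈ C,
      ε ^ 2 ≤ |(b.1 - a.1) * (c.2 - a.2) - (b.2 - a.2) * (c.1 - a.1)| := by
  obtain ⟨a, ha⟩ := hne
  simp only [IsThin] at h
  push Not at h
  obtain ⟨b, hb, hba⟩ := h 1 0 a.2 (by norm_num)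
  set d := √((b.1 - a.1) ^ 2 + (b.2 - a.2) ^ 2) with hd
  have hdε : ε ≤ d := by
    refine hba.le.trans ?_
    rw [show 1 * b.2 - 0 * b.1 - a.2 = b.2 - a.2 by ring]
    exact Real.abs_le_sqrt (by nlinarith [sq_nonneg (b.1 - a.1)])
  have hd0 : 0 < d := hε.trans_le hdε
  have hdsq : d ^ 2 = (b.1 - a.1) ^ 2 + (b.2 - a.2) ^ 2 := Real.sq_sqrt (by positivity)
  obtain ⟨c, hc, hca⟩ := h ((b.1 - a.1) / d) ((b.2 - a.2) / d)
    ((b.1 - a.1) / d * a.2 - (b.2 - a.2) / d * a.1) (by field_simp; exact hdsq.symm)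
  refine ⟨a, ha, b, hb, c, hc, ?_⟩
  have he : (b.1 - a.1) * (c.2 - a.2) - (b.2 - a.2) * (c.1 - a.1) =
      d * ((b.1 - a.1) / d * c.2 - (b.2 - a.2) / d * c.1 -
        ((b.1 - a.1) / d * a.2 - (b.2 - a.2) / d * a.1)) := by
    field_simp
    ring
  rw [he, abs_mul, abs_of_pos hd0, sq]
  exact mul_le_mul hdε hca.le hε.le hd0.le

/-- A convex set of diameter at most one which is not thin contains a ball of controlled radius. -/
theorem exists_ball_of_not_isThin {ε : ℝ} (hε : 0 < ε) {C : Set (ℝ × ℝ)} (hc : Convex ℝ C)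
    (hne : C.Nonempty) (hdiam : ∀ z ∈ C, ∀ w ∈ C, (w.1 - z.1) ^ 2 + (w.2 - z.2) ^ 2 ≤ 1)
    (h : ¬ IsThin ε C) : ∃ o, Metric.ball o (ε ^ 2 / 12) ⊆ C := by
  obtain ⟨a, ha, b, hb, c, hc', hdet⟩ := exists_det_of_not_isThin hε hne h
  set Δ := (b.1 - a.1) * (c.2 - a.2) - (b.2 - a.2) * (c.1 - a.1) with hΔ
  have hΔ0 : 0 < |Δ| := (by positivity : 0 < ε ^ 2).trans_le hdet
  have hΔne : Δ ≠ 0 := abs_pos.1 hΔ0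
  have hone : ∀ z ∈ C, ∀ w ∈ C, |w.1 - z.1| ≤ 1 ∧ |w.2 - z.2| ≤ 1 := fun z hz w hw => by
    have := hdiam z hz w hw
    constructor <;> rw [← sq_le_one_iff_abs_le_one] <;>
      nlinarith [sq_nonneg (w.1 - z.1), sq_nonneg (w.2 - z.2)]
  refine ⟨((a.1 + b.1 + c.1) / 3, (a.2 + b.2 + c.2) / 3), fun z hz => ?_⟩
  set v1 := z.1 - (a.1 + b.1 + c.1) / 3 with hv1
  set v2 := z.2 - (a.2 + b.2 + c.2) / 3 with hv2
  rw [Metric.mem_ball, Prod.dist_eq, max_lt_iff, Real.dist_eq, Real.dist_eq] at hz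
  have key : ∀ d1 d2 : ℝ, |d1| ≤ 1 → |d2| ≤ 1 → |(v1 * d2 - v2 * d1) / Δ| ≤ 1 / 6 := by
    intro d1 d2 h1 h2
    rw [abs_div, div_le_iff₀ hΔ0]
    have e1 : |v1 * d2| ≤ ε ^ 2 / 12 * 1 := by
      rw [abs_mul]; exact mul_le_mul hz.1.le h2 (abs_nonneg _) (by positivity)
    have e2 : |v2 * d1| ≤ ε ^ 2 / 12 * 1 := by
      rw [abs_mul]; exact mul_le_mul hz.2.le h1 (abs_nonneg _) (by positivity)
    have e3 := abs_sub (v1 * d2) (v2 * d1)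
    linarith
  have hα := abs_le.1 (key (c.1 - a.1) (c.2 - a.2) (hone a ha c hc').1 (hone a ha c hc').2)
  have hβ := abs_le.1 (key (b.1 - a.1) (b.2 - a.2) (hone a ha b hb).1 (hone a ha b hb).2)
  set α := (v1 * (c.2 - a.2) - v2 * (c.1 - a.1)) / Δ with hαd
  set β := (v1 * (b.2 - a.2) - v2 * (b.1 - a.1)) / Δ with hβd
  have hmem := hc.sum_mem (t := Finset.univ) (w := ![1 / 3 - α + β, 1 / 3 + α, 1 / 3 - β])
    (z := ![a, b, c]) (by
      intro i _
      fin_cases i <;> simp <;> linarith [hα.1, hα.2, hβ.1, hβ.2])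
    (by simp [Fin.sum_univ_three]; ring) (by intro i _; fin_cases i <;> simpa)
  simp only [Fin.sum_univ_three, Matrix.cons_val_zero, Matrix.cons_val_one, Matrix.cons_val] at hmem
  convert hmem using 1
  have h1 : α * (b.1 - a.1) - β * (c.1 - a.1) = v1 := by
    rw [hαd, hβd]
    field_simp
    rw [hΔ]
    ring
  have h2 : α * (b.2 - a.2) - β * (c.2 - a.2) = v2 := by
    rw [hαd, hβd]
    field_simp
    rw [hΔ]
    ring
  ext
  · simp
    linarith
  · simp
    linarith

theorem volume_line_eq_zero {c s : ℝ} (h : c ^ 2 + s ^ 2 = 1) (o : ℝ × ℝ) :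
    volume {z : ℝ × ℝ | c * (z.1 - o.1) + s * (z.2 - o.2) = 0} = 0 := by
  set f : ℝ × ℝ →ₗ[ℝ] ℝ := c • LinearMap.fst ℝ ℝ ℝ + s • LinearMap.snd ℝ ℝ ℝ with hf
  have htop : LinearMap.ker f ≠ ⊤ := by
    intro ht
    have : ((c, s) : ℝ × ℝ) ∈ LinearMap.ker f := by rw [ht]; trivial
    simp [hf] at this
    nlinarith
  have := Measure.addHaar_submodule volume (LinearMap.ker f) htop
  rw [← measure_preimage_add_right volume (-o)] at this
  convert this using 2
  ext z
  simp [hf, sub_eq_add_neg]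

/-- Open half of a set, cut by the line through `o` with normal direction `θ`. -/
def halfCut (C : Set (ℝ × ℝ)) (o : ℝ × ℝ) (θ : ℝ) : Set (ℝ × ℝ) :=
  C ∩ {z | 0 < Real.cos θ * (z.1 - o.1) + Real.sin θ * (z.2 - o.2)}

theorem halfCut_subset (C : Set (ℝ × ℝ)) (o : ℝ × ℝ) (θ : ℝ) : halfCut C o θ ⊆ C :=
  inter_subset_left

theorem mem_halfCut_add_pi {C : Set (ℝ × ℝ)} {o z : ℝ × ℝ} {θ : ℝ} :
    z ∈ halfCut C o (θ + Real.pi) ↔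
      z ∈ C ∧ Real.cos θ * (z.1 - o.1) + Real.sin θ * (z.2 - o.2) < 0 := by
  rw [halfCut, mem_inter_iff, mem_ofPred_eq, Real.cos_add_pi, Real.sin_add_pi]
  exact and_congr_right fun _ => ⟨fun h => by linarith, fun h => by linarith⟩

theorem disjoint_halfCut (C : Set (ℝ × ℝ)) (o : ℝ × ℝ) (θ : ℝ) :
    Disjoint (halfCut C o θ) (halfCut C o (θ + Real.pi)) :=
  Set.disjoint_left.2 fun _ h h' => lt_asymm h.2 (mem_halfCut_add_pi.1 h').2

theorem isOpen_halfCut {C : Set (ℝ × ℝ)} (h : IsOpen C) (o : ℝ × ℝ) (θ : ℝ) :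
    IsOpen (halfCut C o θ) :=
  h.inter (isOpen_lt continuous_const (by fun_prop))

theorem convex_halfCut {C : Set (ℝ × ℝ)} (h : Convex ℝ C) (o : ℝ × ℝ) (θ : ℝ) :
    Convex ℝ (halfCut C o θ) := by
  refine h.inter fun z hz w hw a b ha hb hab => ?_
  simp only [mem_ofPred_eq, Prod.fst_add, Prod.snd_add, Prod.smul_fst, Prod.smul_snd,
    smul_eq_mul] at hz hw ⊢
  have e : Real.cos θ * (a * z.1 + b * w.1 - o.1) + Real.sin θ * (a * z.2 + b * w.2 - o.2) =
      a * (Real.cos θ * (z.1 - o.1) + Real.sin θ * (z.2 - o.2)) +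
      b * (Real.cos θ * (w.1 - o.1) + Real.sin θ * (w.2 - o.2)) := by
    linear_combination (Real.cos θ * o.1 + Real.sin θ * o.2) * hab
  rw [e]
  rcases ha.eq_or_lt with rfl | ha'
  · rw [show b = 1 by linarith]; linarith
  · have := mul_pos ha' hz
    have := mul_nonneg hb hw.le
    linarith

theorem volume_sdiff_halfCut (C : Set (ℝ × ℝ)) (o : ℝ × ℝ) (θ : ℝ) :
    volume (C \ (halfCut C o θ ∪ halfCut C o (θ + Real.pi))) = 0 := by
  refine measure_mono_null ?_ (volume_line_eq_zero (Real.cos_sq_add_sin_sq θ) o)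
  rintro z ⟨hz, hn⟩
  rw [mem_union, mem_halfCut_add_pi, not_or] at hn
  have h1 : ¬ (0 < Real.cos θ * (z.1 - o.1) + Real.sin θ * (z.2 - o.2)) := fun h => hn.1 ⟨hz, h⟩
  have h2 : ¬ (Real.cos θ * (z.1 - o.1) + Real.sin θ * (z.2 - o.2) < 0) := fun h => hn.2 ⟨hz, h⟩
  exact le_antisymm (not_lt.1 h1) (not_lt.1 h2)

theorem setIntegral_halfCut_add {C : Set (ℝ × ℝ)} (h : IsOpen C) (o : ℝ × ℝ) (θ : ℝ)
    {ψ : ℝ × ℝ → ℝ} (hψ : IntegrableOn ψ C) :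
    (∫ z in halfCut C o θ, ψ z) + ∫ z in halfCut C o (θ + Real.pi), ψ z = ∫ z in C, ψ z := by
  have hs := fun t => halfCut_subset C o t
  rw [← setIntegral_union (disjoint_halfCut C o θ) (isOpen_halfCut h o _).measurableSet
    (hψ.mono_set (hs _)) (hψ.mono_set (hs _))]
  refine setIntegral_congr_set ?_
  refine (LE.le.eventuallyLE (union_subset (hs _) (hs _))).antisymm ?_
  exact ae_le_set.2 (volume_sdiff_halfCut C o θ)

theorem continuous_setIntegral_halfCut {C : Set (ℝ × ℝ)} (o : ℝ × ℝ)
    {ψ : ℝ × ℝ → ℝ} (hψ : IntegrableOn ψ C) :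
    Continuous fun θ => ∫ z in halfCut C o θ, ψ z := by
  have he : (fun θ => ∫ z in halfCut C o θ, ψ z) = fun θ => ∫ z in C,
      {z : ℝ × ℝ | 0 < Real.cos θ * (z.1 - o.1) + Real.sin θ * (z.2 - o.2)}.indicator ψ z := by
    ext θ
    rw [setIntegral_indicator (measurableSet_lt measurable_const (by fun_prop))]
    rfl
  rw [he, continuous_iff_continuousAt]
  intro θ
  refine continuousAt_of_dominated (bound := fun z => ‖ψ z‖) (Eventually.of_forall fun t =>
    hψ.1.indicator (measurableSet_lt measurable_const (by fun_prop)))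
    (Eventually.of_forall fun t => Eventually.of_forall fun z => norm_indicator_le_norm_self _ _)
    hψ.norm ?_
  have hnull := volume_line_eq_zero (Real.cos_sq_add_sin_sq θ) o
  filter_upwards [ae_restrict_of_ae (compl_mem_ae_iff.2 hnull)] with z hz
  have hc : ContinuousAt
      (fun t => Real.cos t * (z.1 - o.1) + Real.sin t * (z.2 - o.2)) θ := by fun_prop
  rcases lt_or_gt_of_ne hz with h1 | h1
  · have : (fun t => {z : ℝ × ℝ | 0 < Real.cos t * (z.1 - o.1) +
        Real.sin t * (z.2 - o.2)}.indicator ψ z) =ᶠ[𝓝 θ] fun _ => 0 := by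
      filter_upwards [hc.eventually_lt_const h1] with t ht
      exact indicator_of_notMem (s := {z : ℝ × ℝ | 0 < Real.cos t * (z.1 - o.1) +
        Real.sin t * (z.2 - o.2)}) (fun h => lt_asymm h ht) ψ
    exact continuousAt_const.congr this.symm
  · have : (fun t => {z : ℝ × ℝ | 0 < Real.cos t * (z.1 - o.1) +
        Real.sin t * (z.2 - o.2)}.indicator ψ z) =ᶠ[𝓝 θ] fun _ => ψ z := by
      filter_upwards [hc.eventually_const_lt h1] with t ht
      exact indicator_of_mem (s := {z : ℝ × ℝ | 0 < Real.cos t * (z.1 - o.1) +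
        Real.sin t * (z.2 - o.2)}) ht ψ
    exact continuousAt_const.congr this.symm

theorem exists_halfCut_eq_zero {C : Set (ℝ × ℝ)} (h : IsOpen C) (o : ℝ × ℝ) {ψ : ℝ × ℝ → ℝ}
    (hψ : IntegrableOn ψ C) (h0 : ∫ z in C, ψ z = 0) :
    ∃ θ, ∫ z in halfCut C o θ, ψ z = 0 := by
  have hc := continuous_setIntegral_halfCut o hψ
  have hs := setIntegral_halfCut_add h o 0 hψ
  rw [h0] at hs
  rcases le_total (∫ z in halfCut C o 0, ψ z) 0 with hle | hle
  · exact mem_range_of_exists_le_of_exists_ge hc ⟨0, hle⟩ ⟨0 + Real.pi, by linarith⟩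
  · exact mem_range_of_exists_le_of_exists_ge hc ⟨0 + Real.pi, by linarith⟩ ⟨0, hle⟩

theorem le_volume_halfCut {C : Set (ℝ × ℝ)} (hb : Bornology.IsBounded C) {o : ℝ × ℝ} {δ : ℝ}
    (hδ : 0 < δ) (hball : Metric.ball o δ ⊆ C) (θ : ℝ) :
    (δ / 2) ^ 2 ≤ volume.real (halfCut C o θ) := by
  set q : ℝ × ℝ := (o.1 + δ / 2 * Real.cos θ, o.2 + δ / 2 * Real.sin θ) with hq
  have hsub : Metric.ball q (δ / 4) ⊆ halfCut C o θ := by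
    intro z hz
    rw [Metric.mem_ball, Prod.dist_eq, max_lt_iff, Real.dist_eq, Real.dist_eq] at hz
    simp only [hq] at hz
    have hc := Real.cos_sq_add_sin_sq θ
    have hc1 := Real.abs_cos_le_one θ
    have hs1 := Real.abs_sin_le_one θ
    constructor
    · refine hball ?_
      rw [Metric.mem_ball, Prod.dist_eq, max_lt_iff, Real.dist_eq, Real.dist_eq]
      have g1 := abs_le.1 hc1
      have g2 := abs_le.1 hs1
      have k1 := abs_lt.1 hz.1
      have k2 := abs_lt.1 hz.2
      constructor <;> rw [abs_lt] <;> constructor <;> nlinarith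
    · have e1 : |Real.cos θ * (z.1 - (o.1 + δ / 2 * Real.cos θ))| ≤
          1 * |z.1 - (o.1 + δ / 2 * Real.cos θ)| := by
        rw [abs_mul]; exact mul_le_mul_of_nonneg_right hc1 (abs_nonneg _)
      have e2 : |Real.sin θ * (z.2 - (o.2 + δ / 2 * Real.sin θ))| ≤
          1 * |z.2 - (o.2 + δ / 2 * Real.sin θ)| := by
        rw [abs_mul]; exact mul_le_mul_of_nonneg_right hs1 (abs_nonneg _)
      have e3 := (abs_le.1 e1).1
      have e4 := (abs_le.1 e2).1
      have e5 : Real.cos θ * (z.1 - o.1) + Real.sin θ * (z.2 - o.2) =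
          Real.cos θ * (z.1 - (o.1 + δ / 2 * Real.cos θ)) +
          Real.sin θ * (z.2 - (o.2 + δ / 2 * Real.sin θ)) + δ / 2 := by
        linear_combination (δ / 2) * hc
      rw [mem_ofPred_eq, e5]
      linarith [hz.1, hz.2]
  have hv : volume.real (Metric.ball q (δ / 4)) = (δ / 2) ^ 2 := by
    rw [← ball_prod_same, Measure.volume_eq_prod, measureReal_prod_prod, Measure.real,
      Measure.real, Real.volume_ball, Real.volume_ball, ENNReal.toReal_ofReal (by positivity)]
    ring
  rw [← hv]
  exact measureReal_mono hsub (hb.subset (halfCut_subset _ _ _)).measure_lt_top.ne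

/-- A finite family of thin convex cells with vanishing integrals which covers `C` up to a null
set. -/
structure IsThinPartition (ε : ℝ) (ψ : ℝ × ℝ → ℝ) (C : Set (ℝ × ℝ))
    (s : Finset (Set (ℝ × ℝ))) : Prop where
  isOpen : ∀ D ∈ s, IsOpen D
  convex : ∀ D ∈ s, Convex ℝ D
  nonempty : ∀ D ∈ s, D.Nonempty
  subset : ∀ D ∈ s, D ⊆ C
  isThin : ∀ D ∈ s, IsThin ε D
  integral_eq_zero : ∀ D ∈ s, ∫ z in D, ψ z = 0
  disjoint : (s : Set (Set (ℝ × ℝ))).PairwiseDisjoint id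
  volume_sdiff : volume (C \ ⋃ D ∈ s, D) = 0

theorem exists_isThinPartition {ε : ℝ} (hε : 0 < ε) {ψ : ℝ × ℝ → ℝ} {C : Set (ℝ × ℝ)}
    (ho : IsOpen C) (hc : Convex ℝ C) (hb : Bornology.IsBounded C) (hne : C.Nonempty)
    (hdiam : ∀ z ∈ C, ∀ w ∈ C, (w.1 - z.1) ^ 2 + (w.2 - z.2) ^ 2 ≤ 1) (hψ : IntegrableOn ψ C)
    (h0 : ∫ z in C, ψ z = 0) : ∃ s, IsThinPartition ε ψ C s := by
  set δ := ε ^ 2 / 12 with hδ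
  have hδ0 : 0 < δ := by positivity
  have hδ2 : 0 < (δ / 2) ^ 2 := by positivity
  obtain ⟨n, hn⟩ : ∃ n : ℕ, volume.real C ≤ n * (δ / 2) ^ 2 := by
    obtain ⟨n, hn⟩ := exists_nat_ge (volume.real C / (δ / 2) ^ 2)
    exact ⟨n, (div_le_iff₀ hδ2).1 hn⟩
  induction n generalizing C with
  | zero =>
    have := ENNReal.toReal_pos (ho.measure_pos volume hne).ne' hb.measure_lt_top.ne
    simp only [Nat.cast_zero, zero_mul] at hn
    exact absurd hn (not_le.2 this)
  | succ n ih =>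
    by_cases hthin : IsThin ε C
    · refine ⟨{C}, by simpa, by simpa, by simpa, by simp, by simpa, by simpa, by simp, by simp⟩
    obtain ⟨o, hball⟩ := exists_ball_of_not_isThin hε hc hne hdiam hthin
    obtain ⟨θ, hθ⟩ := exists_halfCut_eq_zero ho o hψ h0
    have hθ' : ∫ z in halfCut C o (θ + Real.pi), ψ z = 0 := by
      have := setIntegral_halfCut_add ho o θ hψ
      linarith
    have hvol := fun t => le_volume_halfCut hb hδ0 hball t
    have hsum : volume.real (halfCut C o θ) + volume.real (halfCut C o (θ + Real.pi)) ≤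
        volume.real C := by
      rw [← measureReal_union (disjoint_halfCut C o θ) (isOpen_halfCut ho o _).measurableSet
        (hb.subset (halfCut_subset _ _ _)).measure_lt_top.ne
        (hb.subset (halfCut_subset _ _ _)).measure_lt_top.ne]
      exact measureReal_mono (union_subset (halfCut_subset _ _ _) (halfCut_subset _ _ _))
        hb.measure_lt_top.ne
    push_cast at hn
    have hnonempty : ∀ t, (halfCut C o t).Nonempty := fun t => by
      rw [nonempty_iff_ne_empty]
      intro he
      have := hvol t
      rw [he] at this
      simp at this
      linarith
    have hpart : ∀ t, ∫ z in halfCut C o t, ψ z = 0 →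
        volume.real (halfCut C o t) ≤ n * (δ / 2) ^ 2 → ∃ s, IsThinPartition ε ψ (halfCut C o t) s :=
      fun t ht hv => ih (isOpen_halfCut ho o t) (convex_halfCut hc o t)
        (hb.subset (halfCut_subset _ _ _)) (hnonempty t)
        (fun z hz w hw => hdiam z hz.1 w hw.1) (hψ.mono_set (halfCut_subset _ _ _)) ht hv
    obtain ⟨s1, h1⟩ := hpart θ hθ (by linarith [hvol (θ + Real.pi)])
    obtain ⟨s2, h2⟩ := hpart (θ + Real.pi) hθ' (by linarith [hvol θ])
    classical
    refine ⟨s1 ∪ s2, ?_, ?_, ?_, ?_, ?_, ?_, ?_, ?_⟩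
    · intro D hD
      exact (Finset.mem_union.1 hD).elim (h1.isOpen D) (h2.isOpen D)
    · intro D hD
      exact (Finset.mem_union.1 hD).elim (h1.convex D) (h2.convex D)
    · intro D hD
      exact (Finset.mem_union.1 hD).elim (h1.nonempty D) (h2.nonempty D)
    · intro D hD
      exact (Finset.mem_union.1 hD).elim (fun h => (h1.subset D h).trans (halfCut_subset _ _ _))
        fun h => (h2.subset D h).trans (halfCut_subset _ _ _)
    · intro D hD
      exact (Finset.mem_union.1 hD).elim (h1.isThin D) (h2.isThin D)
    · intro D hD
      exact (Finset.mem_union.1 hD).elim (h1.integral_eq_zero D) (h2.integral_eq_zero D)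
    · rw [Finset.coe_union, pairwiseDisjoint_union]
      refine ⟨h1.disjoint, h2.disjoint, fun D hD D' hD' _ => ?_⟩
      exact (disjoint_halfCut C o θ).mono (h1.subset D hD) (h2.subset D' hD')
    · refine measure_mono_null (t := (C \ (halfCut C o θ ∪ halfCut C o (θ + Real.pi))) ∪
        ((halfCut C o θ \ ⋃ D ∈ s1, D) ∪ (halfCut C o (θ + Real.pi) \ ⋃ D ∈ s2, D))) ?_
        (measure_union_null (volume_sdiff_halfCut C o θ)
          (measure_union_null h1.volume_sdiff h2.volume_sdiff))
      rintro z ⟨hz, hn⟩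
      simp only [mem_iUnion, Finset.mem_union, not_exists] at hn
      by_cases k1 : z ∈ halfCut C o θ
      · refine Or.inr (Or.inl ⟨k1, ?_⟩)
        simp only [mem_iUnion, not_exists]
        exact fun D hD => hn D (Or.inl hD)
      by_cases k2 : z ∈ halfCut C o (θ + Real.pi)
      · refine Or.inr (Or.inr ⟨k2, ?_⟩)
        simp only [mem_iUnion, not_exists]
        exact fun D hD => hn D (Or.inr hD)
      · exact Or.inl ⟨hz, fun h => h.elim k1 k2⟩

/-- The linear map with matrix `!![c, -s; s, c]`. -/
noncomputable def rotMap (c s : ℝ) : ℝ × ℝ →L[ℝ] ℝ × ℝ :=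
  (c • ContinuousLinearMap.fst ℝ ℝ ℝ - s • ContinuousLinearMap.snd ℝ ℝ ℝ).prod
    (s • ContinuousLinearMap.fst ℝ ℝ ℝ + c • ContinuousLinearMap.snd ℝ ℝ ℝ)

theorem rotMap_apply (c s : ℝ) (z : ℝ × ℝ) :
    rotMap c s z = (c * z.1 - s * z.2, s * z.1 + c * z.2) := by simp [rotMap]

/-- Rotation of the plane. -/
noncomputable def rot (α : ℝ) : (ℝ × ℝ) ≃L[ℝ] (ℝ × ℝ) :=
  ContinuousLinearEquiv.equivOfInverse (rotMap (Real.cos α) (Real.sin α))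
    (rotMap (Real.cos α) (-Real.sin α))
    (fun z => by
      have h := Real.cos_sq_add_sin_sq α
      rw [rotMap_apply, rotMap_apply]
      ext
      · simp only; linear_combination z.1 * h
      · simp only; linear_combination z.2 * h)
    (fun z => by
      have h := Real.cos_sq_add_sin_sq α
      rw [rotMap_apply, rotMap_apply]
      ext
      · simp only; linear_combination z.1 * h
      · simp only; linear_combination z.2 * h)

theorem rot_apply (α : ℝ) (z : ℝ × ℝ) :
    rot α z = (Real.cos α * z.1 - Real.sin α * z.2, Real.sin α * z.1 + Real.cos α * z.2) :=
  rotMap_apply _ _ z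

theorem measurePreserving_rot (α : ℝ) : MeasurePreserving (rot α) := by
  refine ⟨(rot α).continuous.measurable, ?_⟩
  have hdet : LinearMap.det ((rot α : (ℝ × ℝ) →L[ℝ] (ℝ × ℝ)) : (ℝ × ℝ) →ₗ[ℝ] (ℝ × ℝ)) = 1 := by
    have : ((rot α : (ℝ × ℝ) →L[ℝ] (ℝ × ℝ)) : (ℝ × ℝ) →ₗ[ℝ] (ℝ × ℝ)) =
        Matrix.toLin (Module.Basis.finTwoProd ℝ) (Module.Basis.finTwoProd ℝ)
          !![Real.cos α, -Real.sin α; Real.sin α, Real.cos α] := by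
      refine LinearMap.ext fun z => ?_
      rw [Matrix.toLin_finTwoProd_apply]
      refine (rot_apply α z).trans ?_
      rw [neg_mul, sub_eq_add_neg]
    rw [this, LinearMap.det_toLin, Matrix.det_fin_two_of]
    linarith [Real.cos_sq_add_sin_sq α]
  have h := Measure.map_linearMap_addHaar_eq_smul_addHaar (volume : Measure (ℝ × ℝ))
    (f := ((rot α : (ℝ × ℝ) →L[ℝ] (ℝ × ℝ)) : (ℝ × ℝ) →ₗ[ℝ] (ℝ × ℝ))) (by rw [hdet]; norm_num)
  rw [hdet] at h
  simpa using h

theorem setIntegral_rot (α : ℝ) (D : Set (ℝ × ℝ)) (F : ℝ × ℝ → ℝ) :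
    ∫ z in rot α ⁻¹' D, F (rot α z) = ∫ z in D, F z :=
  (measurePreserving_rot α).setIntegral_preimage_emb
    (rot α).toHomeomorph.measurableEmbedding F D

theorem volume_real_rot (α : ℝ) (D : Set (ℝ × ℝ)) : volume.real (rot α ⁻¹' D) = volume.real D :=
  congrArg ENNReal.toReal ((measurePreserving_rot α).measure_preimage_emb
    (rot α).toHomeomorph.measurableEmbedding D)

theorem rot_sq_add_sq (α a b : ℝ) : (rot α (a, b)).1 ^ 2 + (rot α (a, b)).2 ^ 2 = a ^ 2 + b ^ 2 := by
  rw [rot_apply]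
  simp only
  linear_combination (a ^ 2 + b ^ 2) * Real.cos_sq_add_sin_sq α

theorem WeightedConvex.comp_rot {m : ℕ} {C : Set (ℝ × ℝ)} {φ : ℝ × ℝ → ℝ}
    (h : WeightedConvex m C φ) (α : ℝ) :
    WeightedConvex m (rot α ⁻¹' C) fun z => φ (rot α z) where
  m_pos := h.m_pos
  isOpen := h.isOpen.preimage (rot α).continuous
  convex := h.convex.linear_preimage ((rot α : (ℝ × ℝ) →L[ℝ] (ℝ × ℝ)) : (ℝ × ℝ) →ₗ[ℝ] (ℝ × ℝ))
  isBounded := (rot α).antilipschitz.isBounded_preimage h.isBounded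
  pos _ hz := h.pos _ hz
  concave := h.concave.comp_linearMap
    ((rot α : (ℝ × ℝ) →L[ℝ] (ℝ × ℝ)) : (ℝ × ℝ) →ₗ[ℝ] (ℝ × ℝ))

theorem GradBound.comp_rot {u G : ℝ × ℝ → ℝ} {u' : ℝ × ℝ → ℝ × ℝ →L[ℝ] ℝ}
    (h : GradBound u u' G) (α : ℝ) :
    GradBound (fun z => u (rot α z))
      (fun z => (u' (rot α z)).comp (rot α : (ℝ × ℝ) →L[ℝ] (ℝ × ℝ))) fun z => G (rot α z) where
  hasFDerivAt z := (h.hasFDerivAt (rot α z)).comp z (rot α).hasFDerivAt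
  cont_deriv := (h.cont_deriv.comp (rot α).continuous).clm_comp continuous_const
  cont_G := h.cont_G.comp (rot α).continuous
  le z a b := by
    have := h.le (rot α z) (rot α (a, b)).1 (rot α (a, b)).2
    rwa [rot_sq_add_sq] at this

/-- In suitable rotated coordinates the strip containing a thin set has small slope. -/
theorem IsThin.exists_rot {ε : ℝ} {D : Set (ℝ × ℝ)} (h : IsThin ε D) {N : ℕ} (hN : 7 ≤ N) :
    ∃ k ∈ Finset.Icc (-(N : ℤ)) N, ∃ σ τ : ℝ, σ ^ 2 ≤ 40 / (N : ℝ) ^ 2 ∧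
      ∀ z ∈ rot (k * (Real.pi / N)) ⁻¹' D, |z.2 - (σ * z.1 + τ)| ≤ 2 * ε := by
  obtain ⟨c, s, t, hcs, hst⟩ := h
  have hN0 : (0 : ℝ) < N := by positivity
  have hN7 : (7 : ℝ) ≤ N := by exact_mod_cast hN
  obtain ⟨β, hβ0, hβ1, hc, hs⟩ : ∃ β, -Real.pi < β ∧ β ≤ Real.pi ∧ Real.cos β = c ∧
      Real.sin β = s := by
    have hn : ‖(⟨c, s⟩ : ℂ)‖ = 1 := by
      rw [Complex.norm_eq_sqrt_sq_add_sq, hcs, Real.sqrt_one]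
    have h0 : (⟨c, s⟩ : ℂ) ≠ 0 := by rw [← norm_ne_zero_iff, hn]; norm_num
    exact ⟨Complex.arg ⟨c, s⟩, Complex.neg_pi_lt_arg _, Complex.arg_le_pi _, by
      rw [Complex.cos_arg h0, hn, div_one], by rw [Complex.sin_arg, hn, div_one]⟩
  have hπ := Real.pi_pos
  set w := Real.pi / N with hw
  have hw0 : 0 < w := by positivity
  have hwN : w * N = Real.pi := div_mul_cancel₀ _ hN0.ne'
  have hw1 : w ≤ 1 / 2 := by
    rw [hw, div_le_iff₀ hN0]; linarith [Real.pi_lt_d2]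
  set k := ⌊β / w⌋ with hk
  have hk1 : k * w ≤ β := by
    rw [← le_div_iff₀ hw0]; exact Int.floor_le _
  have hk2 : β < (k + 1) * w := by
    rw [← div_lt_iff₀ hw0]; exact Int.lt_floor_add_one _
  refine ⟨k, Finset.mem_Icc.2 ⟨?_, ?_⟩, ?_⟩
  · rw [hk, Int.le_floor, le_div_iff₀ hw0]
    push_cast
    linarith
  · have : ((k : ℤ) : ℝ) ≤ N := by
      by_contra! hcon
      have := mul_lt_mul_of_pos_right hcon hw0
      linarith
    exact_mod_cast this
  set γ := β - k * w with hγ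
  have hγ0 : 0 ≤ γ := by linarith
  have hγ1 : γ ≤ w := by linarith
  have hcos : 1 / 2 ≤ Real.cos γ := by
    have := Real.one_sub_sq_div_two_le_cos (x := γ)
    nlinarith
  have hcos0 : 0 < Real.cos γ := by linarith
  have hsin : |Real.sin γ| ≤ γ := by
    have := Real.abs_sin_le_abs (x := γ)
    rwa [abs_of_nonneg hγ0] at this
  have hσ : |Real.sin γ / Real.cos γ| ≤ 2 * w := by
    rw [abs_div, abs_of_pos hcos0, div_le_iff₀ hcos0]
    nlinarith
  refine ⟨Real.sin γ / Real.cos γ, t / Real.cos γ, ?_, fun z hz => ?_⟩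
  · have h1 : (Real.sin γ / Real.cos γ) ^ 2 ≤ (2 * w) ^ 2 := sq_le_sq' (abs_le.1 hσ).1 (abs_le.1 hσ).2
    refine h1.trans ?_
    rw [hw, mul_pow, div_pow, mul_div_assoc']
    refine div_le_div_of_nonneg_right ?_ (by positivity)
    nlinarith [Real.pi_lt_d2]
  · have h1 := hst _ hz
    rw [rot_apply] at h1
    have h2 : c * (Real.sin (k * w) * z.1 + Real.cos (k * w) * z.2) -
        s * (Real.cos (k * w) * z.1 - Real.sin (k * w) * z.2) - t =
        Real.cos γ * (z.2 - (Real.sin γ / Real.cos γ * z.1 + t / Real.cos γ)) := by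
      have e1 : Real.cos γ = c * Real.cos (k * w) + s * Real.sin (k * w) := by
        rw [hγ, Real.cos_sub, hc, hs]
      have e2 : Real.sin γ = s * Real.cos (k * w) - c * Real.sin (k * w) := by
        rw [hγ, Real.sin_sub, hc, hs]
      have e3 : Real.cos γ * (z.2 - (Real.sin γ / Real.cos γ * z.1 + t / Real.cos γ)) =
          Real.cos γ * z.2 - Real.sin γ * z.1 - t := by
        field_simp
        ring
      rw [e3, e1, e2]
      ring
    simp only at h1
    rw [h2, abs_mul, abs_of_pos hcos0] at h1
    have := mul_le_mul_of_nonneg_right hcos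
      (abs_nonneg (z.2 - (Real.sin γ / Real.cos γ * z.1 + t / Real.cos γ)))
    linarith

theorem IsThinPartition.sum_setIntegral {ε : ℝ} {ψ F : ℝ × ℝ → ℝ} {C : Set (ℝ × ℝ)}
    {s : Finset (Set (ℝ × ℝ))} (h : IsThinPartition ε ψ C s) (hF : IntegrableOn F C) :
    ∑ D ∈ s, ∫ z in D, F z = ∫ z in C, F z := by
  rw [← integral_biUnion_finset s (fun D hD => (h.isOpen D hD).measurableSet) h.disjoint
    fun D hD => hF.mono_set (h.subset D hD)]
  refine setIntegral_congr_set ?_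
  exact (LE.le.eventuallyLE (iUnion₂_subset h.subset)).antisymm (ae_le_set.2 h.volume_sdiff)

set_option maxHeartbeats 1000000 in
/-- The quantitative inequality for continuously differentiable functions. -/
theorem exists_smooth_bound {p : ℝ} (hp : 1 < p) (m : ℕ) :
    ∃ c > 0, ∀ {Ω : Set (ℝ × ℝ)} {φ u G : ℝ × ℝ → ℝ} {u' : ℝ × ℝ → ℝ × ℝ →L[ℝ] ℝ},
      WeightedConvex m Ω φ → GradBound u u' G → Ω.Nonempty →
      (∀ z ∈ Ω, ∀ w ∈ Ω, (w.1 - z.1) ^ 2 + (w.2 - z.2) ^ 2 ≤ 1) →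
      ∫ z in Ω, φ z * |u z| ^ (p - 2) * u z = 0 →
      (piP p ^ p + c * volume.real Ω ^ 2) * (∫ z in Ω, φ z * |u z| ^ p) ≤
        ∫ z in Ω, φ z * G z ^ p := by
  have hπ : 0 < piP p ^ p := Real.rpow_pos_of_pos (piP_pos hp) _
  have hp0 : 0 < p := by linarith
  obtain ⟨K, hK, ρ0, hρ0, hsec⟩ := exists_sector_bound hp m
  obtain ⟨N, hN⟩ := exists_nat_ge (max 7 (max (320 / ρ0) (1920 * K * (2 + piP p ^ p))))
  have hN7 : (7 : ℝ) ≤ N := (le_max_left _ _).trans hN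
  have hN1 : 320 / ρ0 ≤ N := (le_max_left _ _).trans ((le_max_right _ _).trans hN)
  have hN2 : 1920 * K * (2 + piP p ^ p) ≤ N := (le_max_right _ _).trans ((le_max_right _ _).trans hN)
  have hN7' : 7 ≤ N := by exact_mod_cast hN7
  have hN0 : (0 : ℝ) < N := by linarith
  set ρ := 320 / (N : ℝ) ^ 2 with hρ
  have hρp : 0 < ρ := by positivity
  have hρle : ρ ≤ ρ0 := by
    rw [hρ, div_le_iff₀ (by positivity)]
    rw [div_le_iff₀ hρ0] at hN1
    nlinarith
  obtain ⟨c, hc, hsec⟩ := hsec ρ hρp hρle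
  refine ⟨min (c / 2) 1, by positivity, ?_⟩
  intro Ω φ u G u' hΩ hu hne hdiam horth
  obtain ⟨-, -, H, -, -, -, hV0, hVH, hH1, -⟩ :=
    exists_max_chord hΩ.isOpen hΩ.convex hΩ.isBounded hne hdiam
  set V := volume.real Ω with hV
  have hV2 : V ^ 2 ≤ 1 := pow_le_one₀ hV0.le (hVH.trans hH1)
  have hcu : Continuous fun z => |u z| ^ p := hu.cont.abs.rpow_const fun _ => Or.inr hp0.le
  have hcG : Continuous fun z => G z ^ p := hu.cont_G.rpow_const fun _ => Or.inr hp0.le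
  have hiu := hΩ.integrableOn_mul hcu
  have hiG := hΩ.integrableOn_mul hcG
  set A := ∫ z in Ω, φ z with hA
  set E := ∫ z in Ω, φ z * G z ^ p with hE
  set M := ∫ z in Ω, φ z * |u z| ^ p with hM
  have hA0 : 0 ≤ A := hΩ.setIntegral_weight_nonneg
  have hM0 : 0 ≤ M := hΩ.setIntegral_nonneg fun z => by positivity
  have hE0 : 0 ≤ E := hΩ.setIntegral_nonneg fun z => Real.rpow_nonneg (hu.nonneg z) _
  have hM2 := mul_nonneg (sq_nonneg V) hM0
  rcases le_or_gt ((piP p ^ p + 1) * M) E with hEM | hEM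
  · have h1 : min (c / 2) 1 * (V ^ 2 * M) ≤ 1 * (1 * M) := by
      refine mul_le_mul (min_le_right _ _) ?_ hM2 zero_le_one
      exact mul_le_mul_of_nonneg_right hV2 hM0
    linarith
  suffices hsuff : ∀ ω > 0, (piP p ^ p + c / 2 * V ^ 2) * M ≤
      E + ω * (2 * A + E + c * V ^ 2 * ((2 * N + 1) * A)) by
    have h1 : min (c / 2) 1 * (V ^ 2 * M) ≤ c / 2 * (V ^ 2 * M) :=
      mul_le_mul_of_nonneg_right (min_le_left _ _) hM2
    have h2 : (piP p ^ p + c / 2 * V ^ 2) * M ≤ E := by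
      set T := 2 * A + E + c * V ^ 2 * ((2 * N + 1) * A)
      have hT : 0 ≤ T := by positivity
      refine le_of_forall_pos_le_add fun η hη => ?_
      refine (hsuff (η / (T + 1)) (by positivity)).trans ?_
      have : η / (T + 1) * T ≤ η := by
        rw [div_mul_eq_mul_div, div_le_iff₀ (by positivity)]
        nlinarith
      linarith
    linarith
  intro ω hω
  have hsec' := fun k : ℤ =>
    hsec (hΩ.comp_rot (k * (Real.pi / N))) (hu.comp_rot (k * (Real.pi / N)))
      (hne.preimage (rot _).surjective) (fun z hz w hw => by
        have h1 := hdiam _ hz _ hw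
        have h2 := rot_sq_add_sq (k * (Real.pi / N)) (w.1 - z.1) (w.2 - z.2)
        have h3 : rot (k * (Real.pi / N)) (w.1 - z.1, w.2 - z.2) =
          rot (k * (Real.pi / N)) w - rot (k * (Real.pi / N)) z := (rot _).map_sub w z
        rw [h3] at h2
        rw [← h2]
        exact h1) ω hω
  choose ε0 hε0 hcells using hsec'
  obtain ⟨ε, hε, hεk⟩ : ∃ ε > 0, ∀ k ∈ Finset.Icc (-(N : ℤ)) N, 2 * ε ≤ ε0 k := by
    have hnon : (Finset.Icc (-(N : ℤ)) N).Nonempty := ⟨0, by simp⟩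
    refine ⟨(Finset.Icc (-(N : ℤ)) N).inf' hnon ε0 / 2, ?_, fun k hk => ?_⟩
    · have : 0 < (Finset.Icc (-(N : ℤ)) N).inf' hnon ε0 :=
        (Finset.lt_inf'_iff hnon).2 fun k _ => hε0 k
      positivity
    · have := Finset.inf'_le ε0 hk
      linarith
  have hψ : IntegrableOn (fun z => φ z * |u z| ^ (p - 2) * u z) Ω := by
    have := hΩ.integrableOn_mul (k := fun z => |u z| ^ (p - 2) * u z)
      ((continuous_abs_rpow_mul hp).comp hu.cont)
    refine this.congr_fun (fun z _ => ?_) hΩ.isOpen.measurableSet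
    simp only [mul_assoc]
  obtain ⟨s, hs⟩ := exists_isThinPartition hε hΩ.isOpen hΩ.convex hΩ.isBounded hne hdiam hψ horth
  choose! k hk σ τ hσ hstrip using fun D (hD : D ∈ s) => (hs.isThin D hD).exists_rot hN7'
  have happ := fun j : ℤ => hcells j (s.filter fun D => k D = j)
    (fun D => rot (j * (Real.pi / N)) ⁻¹' D) σ τ
  simp only [setIntegral_rot _ _ (fun z => φ z * |u z| ^ (p - 2) * u z),
    setIntegral_rot _ _ (fun z => φ z * |u z| ^ p), setIntegral_rot _ _ (fun z => φ z * G z ^ p),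
    setIntegral_rot _ _ φ, volume_real_rot] at happ
  have hcellD := fun (j : ℤ) (hj : j ∈ Finset.Icc (-(N : ℤ)) N) => happ j (fun D hD => by
      obtain ⟨hDs, hkD⟩ := Finset.mem_filter.1 hD
      refine ⟨preimage_mono (hs.subset D hDs), (hs.isOpen D hDs).preimage (rot _).continuous,
        (hs.convex D hDs).linear_preimage
          ((rot _ : (ℝ × ℝ) →L[ℝ] (ℝ × ℝ)) : (ℝ × ℝ) →ₗ[ℝ] (ℝ × ℝ)),
        (hs.nonempty D hDs).preimage (rot _).surjective, ?_, fun z hz => ?_,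
        hs.integral_eq_zero D hDs⟩
      · refine (hσ D hDs).trans (le_of_eq ?_)
        rw [hρ]; ring
      · subst hkD
        exact (hstrip D hDs z hz).trans (hεk _ hj))
      (fun D hD D' hD' hne' =>
        (hs.disjoint (Finset.mem_filter.1 hD).1 (Finset.mem_filter.1 hD').1 hne').preimage _)
  choose! g hgs hbad hall hgood using hcellD
  classical
  have hD : ∀ D ∈ s, piP p ^ p * (∫ z in D, φ z * |u z| ^ p) +
      c * V ^ 2 * ((∫ z in D, φ z * |u z| ^ p) -
        if D ∈ g (k D) then ∫ z in D, φ z * |u z| ^ p else 0) ≤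
      (∫ z in D, φ z * G z ^ p) + ω * (2 * (∫ z in D, φ z) + ∫ z in D, φ z * G z ^ p) := by
    intro D hD
    have hW := hΩ.mono (hs.isOpen D hD) (hs.convex D hD) (hs.subset D hD)
    have a0 : 0 ≤ ω * ∫ z in D, φ z := mul_nonneg hω.le hW.setIntegral_weight_nonneg
    have b0 : 0 ≤ ω * ∫ z in D, φ z * G z ^ p :=
      mul_nonneg hω.le (hW.setIntegral_nonneg fun z => Real.rpow_nonneg (hu.nonneg z) _)
    have hmem : D ∈ s.filter fun D' => k D' = k D := Finset.mem_filter.2 ⟨hD, rfl⟩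
    split_ifs with hg
    · have := hall (k D) (hk D hD) D hmem
      rw [sub_self, mul_zero]
      linarith
    · have := hbad (k D) (hk D hD) D hmem hg
      rw [sub_zero]
      linarith
  have hsum := Finset.sum_le_sum hD
  simp only [Finset.sum_add_distrib, ← Finset.mul_sum, Finset.sum_sub_distrib] at hsum
  rw [hs.sum_setIntegral hiu, hs.sum_setIntegral hiG, hs.sum_setIntegral hΩ.integrableOn] at hsum
  have hgoodsum : (∑ D ∈ s, if D ∈ g (k D) then ∫ z in D, φ z * |u z| ^ p else 0) ≤
      (2 * N + 1) * (K * ρ * (M + E) + ω * A) := by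
    rw [← Finset.sum_fiberwise_of_maps_to (t := Finset.Icc (-(N : ℤ)) N) hk]
    have h1 : ∀ j ∈ Finset.Icc (-(N : ℤ)) N, (∑ D ∈ s.filter fun D => k D = j,
        if D ∈ g (k D) then ∫ z in D, φ z * |u z| ^ p else 0) ≤ K * ρ * (M + E) + ω * A := by
      intro j hj
      refine le_of_eq_of_le ?_ (hgood j hj)
      rw [← Finset.inter_eq_right.2 (hgs j hj), ← Finset.sum_ite_mem]
      refine Finset.sum_congr rfl fun D hD => ?_
      rw [(Finset.mem_filter.1 hD).2]
    refine (Finset.sum_le_card_nsmul _ _ _ h1).trans (le_of_eq ?_)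
    rw [nsmul_eq_mul, Int.card_Icc]
    congr 1
    have : (((N : ℤ) + 1 - -(N : ℤ)).toNat : ℤ) = 2 * N + 1 := by
      rw [Int.toNat_of_nonneg (by lia)]; ring
    exact_mod_cast this
  have hhalf : (2 * N + 1) * (K * ρ * (M + E)) ≤ M / 2 := by
    have h1 : M + E ≤ (2 + piP p ^ p) * M := by linarith
    have h2 : (2 * N + 1) * (K * ρ) ≤ 960 * K / N := by
      rw [hρ, le_div_iff₀ hN0]
      have : (2 * N + 1) * (K * (320 / (N : ℝ) ^ 2)) * N = 320 * K * ((2 * N + 1) / N) := by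
        field_simp
      rw [this]
      have h3 : (2 * (N : ℝ) + 1) / N ≤ 3 := by rw [div_le_iff₀ hN0]; linarith
      have := mul_le_mul_of_nonneg_left h3 (by positivity : 0 ≤ 320 * K)
      linarith
    have h4 : 960 * K / N * (2 + piP p ^ p) ≤ 1 / 2 := by
      rw [div_mul_eq_mul_div, div_le_iff₀ hN0]
      linarith
    calc (2 * N + 1) * (K * ρ * (M + E)) = (2 * N + 1) * (K * ρ) * (M + E) := by ring
      _ ≤ 960 * K / N * ((2 + piP p ^ p) * M) := by
          refine mul_le_mul h2 h1 (by positivity) (by positivity)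
      _ = 960 * K / N * (2 + piP p ^ p) * M := by ring
      _ ≤ 1 / 2 * M := mul_le_mul_of_nonneg_right h4 hM0
      _ = M / 2 := by ring
  have hcV : 0 ≤ c * V ^ 2 := by positivity
  have hfin := mul_le_mul_of_nonneg_left hgoodsum hcV
  have hfin2 := mul_le_mul_of_nonneg_left hhalf hcV
  linarith

section Mollification

open ContinuousLinearMap Convolution

variable {E : Type*} [NormedAddCommGroup E] [NormedSpace ℝ E] [FiniteDimensional ℝ E]
  [MeasurableSpace E] [BorelSpace E] {μ : Measure E} [μ.IsAddHaarMeasure]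

theorem LipschitzWith.hasFDerivAt_normed_convolution {u : E → ℝ} {K : NNReal}
    (hu : LipschitzWith K u) (ρ : ContDiffBump (0 : E)) (x : E) :
    HasFDerivAt (ρ.normed μ ⋆[lsmul ℝ ℝ, μ] u)
      ((ρ.normed μ ⋆[lsmul ℝ ℝ, μ] fderiv ℝ u) x) x := by
  have hmp : MeasurePreserving (fun t : E => x - t) μ μ := Measure.measurePreserving_sub_left μ x
  have hmeas : Measurable (fderiv ℝ u) := measurable_fderiv ℝ u
  refine (hasFDerivAt_integral_of_dominated_loc_of_lip (𝕜 := ℝ) (s := univ)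
    (F := fun x t => lsmul ℝ ℝ (ρ.normed μ t) (u (x - t)))
    (F' := fun t => lsmul ℝ ℝ (ρ.normed μ t) (fderiv ℝ u (x - t)))
    (bound := fun t => ρ.normed μ t * K) univ_mem ?_ ?_ ?_ ?_ ?_ ?_).2
  · refine Eventually.of_forall fun y => Continuous.aestronglyMeasurable ?_
    exact ρ.continuous_normed.smul (hu.continuous.comp (continuous_const.sub continuous_id))
  · refine Continuous.integrable_of_hasCompactSupport
      (ρ.continuous_normed.smul (hu.continuous.comp (continuous_const.sub continuous_id))) ?_
    exact ρ.hasCompactSupport_normed.smul_right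
  · exact ρ.continuous_normed.aestronglyMeasurable.smul
      (hmeas.comp hmp.measurable).aestronglyMeasurable
  · refine Eventually.of_forall fun t => LipschitzOnWith.of_dist_le_mul fun y _ z _ => ?_
    have h0 := ρ.nonneg_normed (μ := μ) t
    have h1 := hu.dist_le_mul (y - t) (z - t)
    rw [dist_sub_right, Real.dist_eq] at h1
    simp only [lsmul_apply, smul_eq_mul, Real.dist_eq, ← mul_sub, abs_mul, Real.coe_nnabs,
      abs_of_nonneg h0, NNReal.abs_eq]
    rw [mul_assoc]
    exact mul_le_mul_of_nonneg_left h1 h0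
  · exact ρ.integrable_normed.mul_const _
  · filter_upwards [hmp.quasiMeasurePreserving.ae (hu.ae_differentiableAt (μ := μ))] with t ht
    have := (ht.hasFDerivAt.comp x ((hasFDerivAt_id x).sub_const t)).const_smul (ρ.normed μ t)
    simpa [Function.comp_def, Pi.smul_def] using this

/-- Lipschitz functions can be approximated by continuously differentiable ones, uniformly, with
bounded and almost everywhere convergent derivatives. -/
theorem LipschitzWith.exists_contDiff_approx (μ : Measure E) [μ.IsAddHaarMeasure] {u : E → ℝ}
    {K : NNReal} (hu : LipschitzWith K u) :
    ∃ (v : ℕ → E → ℝ) (v' : ℕ → E → E →L[ℝ] ℝ), (∀ n x, HasFDerivAt (v n) (v' n x) x) ∧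
      (∀ n, Continuous (v' n)) ∧ (∀ n x, |v n x - u x| ≤ K * (1 / ((n : ℝ) + 1))) ∧
      (∀ n x, ‖v' n x‖ ≤ K) ∧
      ∀ᵐ x ∂μ, Tendsto (fun n => v' n x) atTop (𝓝 (fderiv ℝ u x)) := by
  let ρ : ℕ → ContDiffBump (0 : E) := fun n =>
    ⟨1 / ((n : ℝ) + 1) / 2, 1 / ((n : ℝ) + 1), by positivity, half_lt_self (by positivity)⟩
  have hbd : ∀ x, ‖fderiv ℝ u x‖ ≤ K := fun x => norm_fderiv_le_of_lipschitz ℝ hu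
  have hmeas : Measurable (fderiv ℝ u) := measurable_fderiv ℝ u
  have hloc : LocallyIntegrable (fderiv ℝ u) μ :=
    (locallyIntegrable_const (K : ℝ)).mono hmeas.aestronglyMeasurable
      (Eventually.of_forall fun x => (hbd x).trans (le_abs_self _))
  have hder := fun n x => hu.hasFDerivAt_normed_convolution (μ := μ) (ρ n) x
  refine ⟨fun n => (ρ n).normed μ ⋆[lsmul ℝ ℝ, μ] u,
    fun n => (ρ n).normed μ ⋆[lsmul ℝ ℝ, μ] fderiv ℝ u, hder, fun n => ?_, fun n x => ?_,
    fun n x => ?_, ?_⟩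
  · have hcd : ContDiff ℝ 1 ((ρ n).normed μ ⋆[lsmul ℝ ℝ, μ] u) := by
      have := (ρ n).hasCompactSupport_normed (μ := μ) |>.contDiff_convolution_left
        (n := 1) (lsmul ℝ ℝ) (ρ n).contDiff_normed (hu.continuous.locallyIntegrable (μ := μ))
      exact_mod_cast this
    have h2 := hcd.continuous_fderiv one_ne_zero
    rwa [show fderiv ℝ ((ρ n).normed μ ⋆[lsmul ℝ ℝ, μ] u) =
      (ρ n).normed μ ⋆[lsmul ℝ ℝ, μ] fderiv ℝ u from funext fun x => (hder n x).fderiv] at h2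
  · refine ContDiffBump.dist_normed_convolution_le hu.continuous.aestronglyMeasurable
      fun y hy => ?_
    exact (hu.dist_le_mul y x).trans
      (mul_le_mul_of_nonneg_left (Metric.mem_ball.1 hy).le K.coe_nonneg)
  · refine (norm_integral_le_of_norm_le ((ρ n).integrable_normed.mul_const (K : ℝ))
      (Eventually.of_forall fun t => ?_)).trans (le_of_eq ?_)
    · rw [lsmul_apply, norm_smul, Real.norm_of_nonneg ((ρ n).nonneg_normed t)]
      exact mul_le_mul_of_nonneg_left (hbd _) ((ρ n).nonneg_normed t)
    · rw [integral_mul_const, (ρ n).integral_normed, one_mul]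
  · refine ContDiffBump.ae_convolution_tendsto_right_of_locallyIntegrable (K := 2)
      tendsto_one_div_add_atTop_nhds_zero_nat (Eventually.of_forall fun n => ?_) hloc
    change 1 / ((n : ℝ) + 1) ≤ 2 * (1 / ((n : ℝ) + 1) / 2)
    linarith

end Mollification

theorem abs_abs_rpow_mul {p : ℝ} (hp : 1 < p) (a : ℝ) : |(|a| ^ (p - 2) * a)| = |a| ^ (p - 1) := by
  by_cases h0 : a = 0
  · simp [h0, Real.zero_rpow (show p - 1 ≠ 0 by linarith)]
  · rw [abs_mul, abs_of_nonneg (by positivity), ← Real.rpow_add_one (abs_pos.2 h0).ne']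
    congr 1
    ring

theorem WeightedConvex.exists_shift_integral_eq_zero {m : ℕ} {C : Set (ℝ × ℝ)} {φ : ℝ × ℝ → ℝ}
    (h : WeightedConvex m C φ) {p : ℝ} (hp : 1 < p) {v : ℝ × ℝ → ℝ} (hv : Continuous v) {B : ℝ}
    (hB0 : 0 ≤ B) (hB : ∀ z ∈ C, |v z| ≤ B) :
    ∃ c, |c| ≤ B ∧ ∫ z in C, φ z * |v z - c| ^ (p - 2) * (v z - c) = 0 := by
  have hcont := continuous_abs_rpow_mul hp
  have hF : ContinuousOn (fun c => ∫ z in C, φ z * (|v z - c| ^ (p - 2) * (v z - c)))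
      (Icc (-B) B) := by
    refine continuousOn_of_dominated (bound := fun z => φ z * (2 * B) ^ (p - 1))
      (fun c _ => ?_) (fun c hc => ?_) (h.integrableOn_mul continuous_const) ?_
    · exact (h.integrableOn_mul (k := fun z => |v z - c| ^ (p - 2) * (v z - c))
        (hcont.comp (hv.sub continuous_const))).aestronglyMeasurable
    · refine (ae_restrict_iff' h.isOpen.measurableSet).2 (Eventually.of_forall fun z hz => ?_)
      rw [norm_mul, Real.norm_of_nonneg (h.pos z hz).le, Real.norm_eq_abs, abs_abs_rpow_mul hp]
      refine mul_le_mul_of_nonneg_left ?_ (h.pos z hz).le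
      refine Real.rpow_le_rpow (abs_nonneg _) ?_ (by linarith)
      have := abs_sub (v z) c
      have := hB z hz
      have := abs_le.2 hc
      linarith
    · refine Eventually.of_forall fun z => Continuous.continuousOn ?_
      exact continuous_const.mul (hcont.comp (continuous_const.sub continuous_id))
  have h0 : (0 : ℝ) ∈ Icc (∫ z in C, φ z * (|v z - B| ^ (p - 2) * (v z - B)))
      (∫ z in C, φ z * (|v z - -B| ^ (p - 2) * (v z - -B))) := by
    constructor
    · refine setIntegral_nonpos h.isOpen.measurableSet fun z hz => ?_
      have := (abs_le.1 (hB z hz)).2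
      exact mul_nonpos_of_nonneg_of_nonpos (h.pos z hz).le
        (mul_nonpos_of_nonneg_of_nonpos (by positivity) (by linarith))
    · refine MeasureTheory.setIntegral_nonneg h.isOpen.measurableSet fun z hz => ?_
      have := (abs_le.1 (hB z hz)).1
      exact mul_nonneg (h.pos z hz).le (mul_nonneg (by positivity) (by linarith))
  obtain ⟨c, hc, hc0⟩ := intermediate_value_Icc' (by linarith) hF h0
  refine ⟨c, abs_le.2 hc, ?_⟩
  simpa only [mul_assoc] using hc0

theorem chord_le_of_mem_closure {Ω : Set (ℝ × ℝ)} (ho : IsOpen Ω) (hc : Convex ℝ Ω)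
    (hb : Bornology.IsBounded Ω) (hne : Ω.Nonempty)
    (hdiam : ∀ z ∈ Ω, ∀ w ∈ Ω, (w.1 - z.1) ^ 2 + (w.2 - z.2) ^ 2 ≤ 1)
    (h0 : (0, 0) ∈ closure Ω) (h1 : (1, 0) ∈ closure Ω) (x : ℝ) :
    chord Ω x ≤ 32 * volume.real Ω := by
  obtain ⟨X0, X1, H, hX, hlen, hfst, hV0, hVH, hH1, hle, hlow⟩ :=
    exists_max_chord ho hc hb hne hdiam
  have hcl : ∀ z ∈ closure Ω, z.1 ∈ Icc X0 X1 := by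
    intro z hz
    have : closure Ω ⊆ Prod.fst ⁻¹' Icc X0 X1 := by
      refine closure_minimal (fun w hw => ?_) (isClosed_Icc.preimage continuous_fst)
      exact Ioo_subset_Icc_self (hfst ▸ mem_image_of_mem _ hw)
    exact this hz
  have e0 : X0 ≤ 0 := (hcl _ h0).1
  have e1 : 1 ≤ X1 := (hcl _ h1).2
  have hV : volume.real Ω = ∫ x in Ioo X0 X1, chord Ω x := by
    have := setIntegral_eq_integral_slice_Ioo ho.measurableSet (F := fun _ => (1 : ℝ))
      (integrableOn_const hb.measure_lt_top.ne) hfst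
    simpa [chord] using this
  have hkint : IntegrableOn (chord Ω) (Ioo X0 X1) := by
    by_contra hcon
    rw [integral_undef hcon] at hV
    linarith
  have hsub : Icc (X0 + 1 / 4) (X1 - 1 / 4) ⊆ Ioo X0 X1 :=
    fun y hy => ⟨by linarith [hy.1], by linarith [hy.2]⟩
  have h2 : ∫ x in Icc (X0 + 1 / 4) (X1 - 1 / 4), chord Ω x ≤ volume.real Ω := by
    rw [hV]
    exact setIntegral_mono_set hkint (Eventually.of_forall fun y => chord_nonneg _ _)
      (LE.le.eventuallyLE hsub)
  have h3 : ∫ x in Icc (X0 + 1 / 4) (X1 - 1 / 4), (1 / 4 * H / 4) ≤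
      ∫ x in Icc (X0 + 1 / 4) (X1 - 1 / 4), chord Ω x :=
    setIntegral_mono_on (integrableOn_const (by simp)) (hkint.mono_set hsub) measurableSet_Icc
      fun y hy => hlow _ (by norm_num) y hy
  rw [setIntegral_const, Real.volume_real_Icc_of_le (by linarith), smul_eq_mul] at h3
  have h4 := hle x
  nlinarith

/-- The identification of the product plane with the Euclidean plane. -/
noncomputable def plane : (ℝ × ℝ) ≃L[ℝ] EuclideanSpace ℝ (Fin 2) :=
  ((EuclideanSpace.equiv (Fin 2) ℝ).trans (ContinuousLinearEquiv.finTwoArrow ℝ ℝ)).symm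

theorem plane_apply_zero (z : ℝ × ℝ) : plane z 0 = z.1 := rfl

theorem plane_apply_one (z : ℝ × ℝ) : plane z 1 = z.2 := rfl

theorem norm_plane (z : ℝ × ℝ) : ‖plane z‖ = √(z.1 ^ 2 + z.2 ^ 2) := by
  rw [EuclideanSpace.norm_eq, Fin.sum_univ_two, plane_apply_zero, plane_apply_one]
  simp

theorem measurePreserving_plane : MeasurePreserving plane := by
  have h := (volume_preserving_finTwoArrow ℝ).comp (PiLp.volume_preserving_ofLp (Fin 2))
  have h2 : MeasurePreserving (plane.symm.toHomeomorph.toMeasurableEquiv) := h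
  exact h2.symm

theorem measurableEmbedding_plane : MeasurableEmbedding plane :=
  plane.toHomeomorph.measurableEmbedding

theorem setIntegral_plane (Ω : Set (EuclideanSpace ℝ (Fin 2))) (F : EuclideanSpace ℝ (Fin 2) → ℝ) :
    ∫ z in plane ⁻¹' Ω, F (plane z) = ∫ x in Ω, F x :=
  measurePreserving_plane.setIntegral_preimage_emb measurableEmbedding_plane F Ω

theorem gradBound_comp_plane {v : EuclideanSpace ℝ (Fin 2) → ℝ}
    {v' : EuclideanSpace ℝ (Fin 2) → EuclideanSpace ℝ (Fin 2) →L[ℝ] ℝ}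
    (hv : ∀ x, HasFDerivAt v (v' x) x) (hv' : Continuous v') (c : ℝ) :
    GradBound (fun z => v (plane z) - c)
      (fun z => (v' (plane z)).comp (plane : (ℝ × ℝ) →L[ℝ] EuclideanSpace ℝ (Fin 2)))
      fun z => ‖v' (plane z)‖ where
  hasFDerivAt z := ((hv (plane z)).comp z plane.hasFDerivAt).sub_const c
  cont_deriv := (hv'.comp plane.continuous).clm_comp continuous_const
  cont_G := (hv'.comp plane.continuous).norm
  le z a b := by
    rw [← norm_plane (a, b)]
    exact (v' (plane z)).le_opNorm (plane (a, b))

/-- The quantitative inequality for Lipschitz functions. -/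
theorem exists_lipschitz_bound {p : ℝ} (hp : 1 < p) (m : ℕ) :
    ∃ c > 0, ∀ {Ω : Set (EuclideanSpace ℝ (Fin 2))} {φ u : EuclideanSpace ℝ (Fin 2) → ℝ}
      {K : NNReal}, WeightedConvex m (plane ⁻¹' Ω) (fun z => φ (plane z)) → LipschitzWith K u →
      Ω.Nonempty → (∀ z ∈ plane ⁻¹' Ω, ∀ w ∈ plane ⁻¹' Ω,
        (w.1 - z.1) ^ 2 + (w.2 - z.2) ^ 2 ≤ 1) →
      ∫ x in Ω, φ x * |u x| ^ (p - 2) * u x = 0 →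
      (piP p ^ p + c * volume.real (plane ⁻¹' Ω) ^ 2) * (∫ x in Ω, φ x * |u x| ^ p) ≤
        ∫ x in Ω, φ x * ‖fderiv ℝ u x‖ ^ p := by
  obtain ⟨c, hc, hbound⟩ := exists_smooth_bound hp m
  refine ⟨c, hc, fun {Ω φ u K} hW hu hne hdiam horth => ?_⟩
  have hp0 : 0 < p := by linarith
  have hπ : 0 < piP p ^ p := Real.rpow_pos_of_pos (piP_pos hp) _
  have hne' : (plane ⁻¹' Ω).Nonempty := hne.preimage plane.surjective
  have hmeas : MeasurableSet (plane ⁻¹' Ω) := hW.isOpen.measurableSet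
  have hcu : Continuous fun z => u (plane z) := hu.continuous.comp plane.continuous
  obtain ⟨v, v', hv, hv', hvu, hK, hae⟩ := hu.exists_contDiff_approx volume
  rw [← setIntegral_plane Ω (fun x => φ x * |u x| ^ p),
    ← setIntegral_plane Ω (fun x => φ x * ‖fderiv ℝ u x‖ ^ p)]
  rw [← setIntegral_plane Ω (fun x => φ x * |u x| ^ (p - 2) * u x)] at horth
  set κ := piP p ^ p + c * volume.real (plane ⁻¹' Ω) ^ 2 with hκ
  have hκ0 : 0 ≤ κ := by positivity
  obtain ⟨B0, hB0, hB⟩ : ∃ B0, 0 ≤ B0 ∧ ∀ z ∈ plane ⁻¹' Ω, |u (plane z)| ≤ B0 := by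
    have hbdd : Bornology.IsBounded ((fun z => u (plane z)) '' (plane ⁻¹' Ω)) :=
      (hu.comp plane.lipschitz).isBounded_image hW.isBounded
    obtain ⟨B0, hB⟩ := hbdd.exists_norm_le
    obtain ⟨z, hz⟩ := hne'
    exact ⟨B0, (norm_nonneg _).trans (hB _ (mem_image_of_mem _ hz)),
      fun z hz => hB _ (mem_image_of_mem _ hz)⟩
  have hδ : ∀ n : ℕ, K * (1 / ((n : ℝ) + 1)) ≤ K := fun n =>
    mul_le_of_le_one_right K.coe_nonneg
      (by rw [div_le_one (by positivity)]; linarith [n.cast_nonneg (α := ℝ)])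
  set L := p * (2 * (B0 + K)) ^ (p - 1) with hL
  have hL0 : 0 ≤ L := by positivity
  set A := ∫ z in plane ⁻¹' Ω, φ (plane z) with hA
  have hcont : ∀ f : ℝ × ℝ → ℝ, Continuous f → Continuous fun z => |f z| ^ p := fun f hf =>
    hf.abs.rpow_const fun _ => Or.inr hp0.le
  have hstep : ∀ n : ℕ, κ * (∫ z in plane ⁻¹' Ω, φ (plane z) * |u (plane z)| ^ p) ≤
      (∫ z in plane ⁻¹' Ω, φ (plane z) * ‖v' n (plane z)‖ ^ p) +
        κ * (L * (K * (1 / ((n : ℝ) + 1))) * A) := by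
    intro n
    have hcv : Continuous fun z => v n (plane z) :=
      (continuous_iff_continuousAt.2 fun x => (hv n x).continuousAt).comp plane.continuous
    obtain ⟨d, hd, hd0⟩ := hW.exists_shift_integral_eq_zero hp hcv (B := B0 + K)
      (by positivity) (fun z hz => by
        have h1 := hvu n (plane z)
        have h2 := abs_sub_abs_le_abs_sub (v n (plane z)) (u (plane z))
        linarith [hB z hz, hδ n])
    have h1 := hbound hW (gradBound_comp_plane (hv n) (hv' n) d) hne' hdiam hd0
    have h2 := hW.integral_le_shift hp hcu horth d
    have hi1 := hW.integrableOn_mul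
      (hcont (fun z => v n (plane z) - d) (hcv.sub continuous_const))
    have hi2 := hW.integrableOn_mul
      (hcont (fun z => u (plane z) - d) (hcu.sub continuous_const))
    have h3 : ∫ z in plane ⁻¹' Ω, φ (plane z) * |u (plane z) - d| ^ p ≤
        (∫ z in plane ⁻¹' Ω, φ (plane z) * |v n (plane z) - d| ^ p) +
          L * (K * (1 / ((n : ℝ) + 1))) * A := by
      rw [hA, ← integral_const_mul, ← integral_add hi1 (hW.integrableOn.const_mul _)]
      refine setIntegral_mono_on hi2 (hi1.add (hW.integrableOn.const_mul _)) hmeas fun z hz => ?_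
      have hpos := (hW.pos z hz).le
      set a := u (plane z) - d with ha
      set b := v n (plane z) - d with hb
      have t1 := abs_rpow_tangent_le hp a b
      have t2 : |a| ^ (p - 1) ≤ (2 * (B0 + K)) ^ (p - 1) := by
        refine Real.rpow_le_rpow (abs_nonneg _) ?_ (by linarith)
        have := abs_sub (u (plane z)) d
        have := hB z hz
        have := K.coe_nonneg
        linarith
      have t3 : |b - a| ≤ K * (1 / ((n : ℝ) + 1)) := by
        rw [hb, ha, sub_sub_sub_cancel_right]
        exact hvu n (plane z)
      have t4 : -((|a| ^ (p - 2) * a) * (b - a)) ≤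
          (2 * (B0 + K)) ^ (p - 1) * (K * (1 / ((n : ℝ) + 1))) := by
        refine (neg_le_abs _).trans ?_
        rw [abs_mul, abs_abs_rpow_mul hp]
        exact mul_le_mul t2 t3 (abs_nonneg _) (by positivity)
      have t5 := mul_le_mul_of_nonneg_left t4 hp0.le
      have t6 : |a| ^ p ≤ |b| ^ p + L * (K * (1 / ((n : ℝ) + 1))) := by
        rw [hL]
        linarith
      have t7 := mul_le_mul_of_nonneg_left t6 hpos
      linarith
    have h4 := mul_le_mul_of_nonneg_left (h2.trans h3) hκ0
    rw [mul_add] at h4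
    exact h4.trans (add_le_add_left h1 _)
  have hlim : Tendsto (fun n => ∫ z in plane ⁻¹' Ω, φ (plane z) * ‖v' n (plane z)‖ ^ p) atTop
      (𝓝 (∫ z in plane ⁻¹' Ω, φ (plane z) * ‖fderiv ℝ u (plane z)‖ ^ p)) := by
    refine tendsto_integral_of_dominated_convergence (fun z => φ (plane z) * (K : ℝ) ^ p)
      (fun n => ?_) (hW.integrableOn_mul continuous_const) (fun n => ?_) ?_
    · exact (hW.integrableOn_mul (((hv' n).comp plane.continuous).norm.rpow_const
        fun _ => Or.inr hp0.le)).aestronglyMeasurable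
    · refine (ae_restrict_iff' hmeas).2 (Eventually.of_forall fun z hz => ?_)
      rw [norm_mul, Real.norm_of_nonneg (hW.pos z hz).le, Real.norm_of_nonneg (by positivity)]
      exact mul_le_mul_of_nonneg_left
        (Real.rpow_le_rpow (norm_nonneg _) (hK n _) hp0.le) (hW.pos z hz).le
    · refine ae_restrict_of_ae ?_
      filter_upwards [measurePreserving_plane.quasiMeasurePreserving.ae hae] with z hz
      exact (hz.norm.rpow_const (Or.inr hp0.le)).const_mul _
  have hlim2 : Tendsto (fun n : ℕ => κ * (L * (K * (1 / ((n : ℝ) + 1))) * A)) atTop (𝓝 0) := by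
    have := ((((tendsto_one_div_add_atTop_nhds_zero_nat (𝕜 := ℝ)).const_mul (K : ℝ)).const_mul
      L).mul_const A).const_mul κ
    simpa using this
  have hlim3 := hlim.add hlim2
  rw [add_zero] at hlim3
  exact ge_of_tendsto' hlim3 hstep

theorem integral_mul_abs_rpow_pos {m : ℕ} {Ω : Set (EuclideanSpace ℝ (Fin 2))}
    {φ u : EuclideanSpace ℝ (Fin 2) → ℝ} (hW : WeightedConvex m (plane ⁻¹' Ω) fun z => φ (plane z))
    {p : ℝ} (hp : 1 < p) (hu : Continuous u) (h0 : ¬ ∀ᵐ x ∂(volume.restrict Ω), u x = 0) :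
    0 < ∫ x in Ω, φ x * |u x| ^ p := by
  have hp0 : 0 < p := by linarith
  have hmeas : MeasurableSet (plane ⁻¹' Ω) := hW.isOpen.measurableSet
  rw [← setIntegral_plane Ω (fun x => φ x * |u x| ^ p)]
  refine lt_of_le_of_ne (hW.setIntegral_nonneg (k := fun z => |u (plane z)| ^ p)
    fun z => by positivity) fun hcon => h0 ?_
  have hi : IntegrableOn (fun z => φ (plane z) * |u (plane z)| ^ p) (plane ⁻¹' Ω) :=
    hW.integrableOn_mul ((hu.comp plane.continuous).abs.rpow_const fun _ => Or.inr hp0.le)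
  rw [eq_comm, setIntegral_eq_zero_iff_of_nonneg_ae ((ae_restrict_iff' hmeas).2
    (Eventually.of_forall fun z hz => mul_nonneg (hW.pos z hz).le (by positivity))) hi] at hcon
  rw [← (measurePreserving_plane.restrict_preimage_emb measurableEmbedding_plane Ω).map_eq,
    measurableEmbedding_plane.ae_map_iff]
  filter_upwards [hcon, ae_restrict_mem hmeas] with z hz hzΩ
  have h1 := (mul_eq_zero.1 hz).resolve_left (hW.pos z hzΩ).ne'
  exact abs_eq_zero.1 ((Real.rpow_eq_zero (abs_nonneg _) hp0.ne').1 h1)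

theorem exists_lipschitz_orthogonal {m : ℕ} {Ω : Set (EuclideanSpace ℝ (Fin 2))}
    {φ : EuclideanSpace ℝ (Fin 2) → ℝ} (hW : WeightedConvex m (plane ⁻¹' Ω) fun z => φ (plane z))
    (hne : Ω.Nonempty) {p : ℝ} (hp : 1 < p) :
    ∃ (u : EuclideanSpace ℝ (Fin 2) → ℝ) (K : NNReal), LipschitzWith K u ∧
      ¬ (∀ᵐ x ∂(volume.restrict Ω), u x = 0) ∧ ∫ x in Ω, φ x * |u x| ^ (p - 2) * u x = 0 := by
  obtain ⟨B, hB⟩ := (hW.isBounded.image_fst).exists_norm_le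
  have hne' : (plane ⁻¹' Ω).Nonempty := hne.preimage plane.surjective
  obtain ⟨z0, hz0⟩ := hne'
  obtain ⟨c, -, hc⟩ := hW.exists_shift_integral_eq_zero hp continuous_fst (B := B)
    ((norm_nonneg _).trans (hB _ (mem_image_of_mem _ hz0)))
    fun z hz => hB _ (mem_image_of_mem _ hz)
  refine ⟨fun x => x 0 - c, 1, LipschitzWith.of_dist_le_mul fun x y => ?_, fun hae => ?_, ?_⟩
  · rw [dist_sub_right, NNReal.coe_one, one_mul, dist_eq_norm, dist_eq_norm]
    exact PiLp.norm_apply_le (x - y) 0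
  · rw [← (measurePreserving_plane.restrict_preimage_emb measurableEmbedding_plane Ω).map_eq,
      measurableEmbedding_plane.ae_map_iff, ae_restrict_iff' hW.isOpen.measurableSet] at hae
    have h1 := volume_line_eq_zero (c := 1) (s := 0) (by norm_num) (c, 0)
    refine (hW.isOpen.measure_pos volume ⟨z0, hz0⟩).ne' (measure_mono_null_ae ?_ h1)
    filter_upwards [hae] with z hz hzΩ
    have := hz hzΩ
    change 1 * (z.1 - c) + 0 * (z.2 - 0) = 0
    rw [plane_apply_zero] at this
    rw [this]
    ring
  · rw [← setIntegral_plane Ω]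
    exact hc

/-- Lemma 5.2, quantitative inequality for general planar convex sets:
there is an explicit constant `c' = c'(p,m) > 0` such that every open bounded convex
`Ω ⊂ ℝ²` with diameter one, positioned so that `[0,1]×{0}` is a diameter, and every positive
`(1/m)`-concave weight `φ` on `Ω`, satisfy `μ_p(Ω,φ) ≥ π_p^p + c' η_Ω²`. -/
theorem stmt16 (p : ℝ) (hp : 1 < p) (m : ℕ) (hm : 0 < m) :
    ∃ c' : ℝ, 0 < c' ∧
      ∀ (Ω : Set (EuclideanSpace ℝ (Fin 2))) (φ : EuclideanSpace ℝ (Fin 2) → ℝ),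
        IsOpen Ω → Convex ℝ Ω → Bornology.IsBounded Ω → Ω.Nonempty →
        Metric.diam Ω = 1 →
        segment ℝ (0 : EuclideanSpace ℝ (Fin 2)) (EuclideanSpace.single 0 1) ⊆ closure Ω →
        IsAlphaConcaveOn (1 / m) Ω φ →
        muP p Ω φ ≥ piP p ^ p + c' * etaOmega Ω ^ 2 := by
  obtain ⟨c, hc, hbound⟩ := exists_lipschitz_bound hp m
  refine ⟨c / 1024, by positivity, fun Ω φ ho hconv hb hne hdiam hseg hφ => ?_⟩
  have hW : WeightedConvex m (plane ⁻¹' Ω) (fun z => φ (plane z)) :=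
    { m_pos := hm
      isOpen := ho.preimage plane.continuous
      convex := hconv.linear_preimage
        ((plane : (ℝ × ℝ) →L[ℝ] EuclideanSpace ℝ (Fin 2)) : (ℝ × ℝ) →ₗ[ℝ] EuclideanSpace ℝ (Fin 2))
      isBounded := plane.antilipschitz.isBounded_preimage hb
      pos := fun z hz => hφ.1 _ hz
      concave := hφ.2.comp_linearMap
        ((plane : (ℝ × ℝ) →L[ℝ] EuclideanSpace ℝ (Fin 2)) :
          (ℝ × ℝ) →ₗ[ℝ] EuclideanSpace ℝ (Fin 2)) }
  have hdiam' : ∀ z ∈ plane ⁻¹' Ω, ∀ w ∈ plane ⁻¹' Ω,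
      (w.1 - z.1) ^ 2 + (w.2 - z.2) ^ 2 ≤ 1 := by
    intro z hz w hw
    have h1 := Metric.dist_le_diam_of_mem hb hw hz
    rw [hdiam, dist_eq_norm, ← map_sub, norm_plane, Real.sqrt_le_one] at h1
    exact h1
  have hcl : ∀ z : ℝ × ℝ, plane z ∈ closure Ω → z ∈ closure (plane ⁻¹' Ω) := by
    intro z hz
    have := plane.toHomeomorph.preimage_closure Ω
    exact this ▸ hz
  have h0 : ((0 : ℝ), (0 : ℝ)) ∈ closure (plane ⁻¹' Ω) := by
    refine hcl _ (hseg ?_)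
    rw [show plane ((0 : ℝ), (0 : ℝ)) = 0 from map_zero plane]
    exact left_mem_segment ℝ _ _
  have h1 : ((1 : ℝ), (0 : ℝ)) ∈ closure (plane ⁻¹' Ω) := by
    refine hcl _ (hseg ?_)
    have : plane ((1 : ℝ), (0 : ℝ)) = EuclideanSpace.single 0 1 := by
      ext i
      fin_cases i
      · simp [plane_apply_zero]
      · simp [plane_apply_one]
    rw [this]
    exact right_mem_segment ℝ _ _
  set V := volume.real (plane ⁻¹' Ω) with hV
  have heta : etaOmega Ω ≤ 32 * V := by
    refine ciSup_le fun x => ?_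
    have hset : {y : ℝ | ∃ z ∈ Ω, z 0 = x ∧ z 1 = y} = slice (plane ⁻¹' Ω) x := by
      ext y
      constructor
      · rintro ⟨z, hz, rfl, rfl⟩
        change plane (z 0, z 1) ∈ Ω
        rwa [show plane (z 0, z 1) = z by
          ext i
          fin_cases i
          · exact plane_apply_zero _
          · exact plane_apply_one _]
      · exact fun hy => ⟨plane (x, y), hy, plane_apply_zero _, plane_apply_one _⟩
    rw [hset]
    exact chord_le_of_mem_closure hW.isOpen hW.convex hW.isBounded
      (hne.preimage plane.surjective) hdiam' h0 h1 x
  have heta0 : 0 ≤ etaOmega Ω := Real.iSup_nonneg fun x => ENNReal.toReal_nonneg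
  have heta2 : c / 1024 * etaOmega Ω ^ 2 ≤ c * V ^ 2 := by
    have h2 : etaOmega Ω ^ 2 ≤ (32 * V) ^ 2 := pow_le_pow_left₀ heta0 heta 2
    have h3 := mul_le_mul_of_nonneg_left h2 (by positivity : 0 ≤ c / 1024)
    linarith
  refine le_csInf ?_ ?_
  · obtain ⟨u, K, hu, hu0, horth⟩ := exists_lipschitz_orthogonal hW hne hp
    exact ⟨_, u, K, hu, hu0, horth, rfl⟩
  · rintro r ⟨u, K, hu, hu0, horth, rfl⟩
    have hM := integral_mul_abs_rpow_pos hW hp hu.continuous hu0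
    rw [le_div_iff₀ hM]
    refine le_trans ?_ (hbound hW hu hne hdiam' horth)
    exact mul_le_mul_of_nonneg_right (by linarith) hM.le
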